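/- arXiv:1306.3577 — 2 statements merged into one kernel-verified Lean document; each statement's English description precedes it below -/
import Mathlib

section
/- Let ε > 0 and let e : ℝ × [0,∞) → ℝ be continuous, bounded, not identically zero, and a classical solution on ℝ × (0,∞) of ∂_t e = a(x,t) ∂²_x e + b(x,t) ∂_x e + c(x,t) e, where a(x,t) ≥ ε for all (x,t) and a, 1/a, ∂_t a, ∂_x a, ∂²_x a, b, ∂_t b, ∂_x b, c are bounded. If the set A(0) = {x ∈ ℝ : e(x,0) > 0} is preconnected (an interval, possibly empty), then for every t > 0 the set A(t) = {x ∈ ℝ : e(x,t) > 0} is preconnected. -/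
open Set

lemma edge_log (g G : ℝ → ℂ) (k : ℂ) (hk : k ≠ 0) (hg : Continuous g) (hG : Continuous G)
    (h : ∀ s, Complex.exp (g s) = G s) (hre : ∀ s, 0 ≤ (k * G s).re) :
    g 1 - g 0 = Complex.log (k * G 1) - Complex.log (k * G 0) := by
  have hne : ∀ s, k * G s ≠ 0 := fun s => mul_ne_zero hk (h s ▸ Complex.exp_ne_zero _)
  have hslit : ∀ s, k * G s ∈ Complex.slitPlane := by
    intro s
    rw [Complex.mem_slitPlane_iff]
    rcases (hre s).lt_or_eq with h1 | h1
    · exact Or.inl h1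
    · right
      intro h2
      exact hne s (Complex.ext h1.symm h2)
  have h1 : Continuous fun s => Complex.log (k * G s) :=
    (continuous_const.mul hG).clog hslit
  have key : (fun s => Complex.log (k * G s)) =
      fun s => g s + (Complex.log (k * G 0) - g 0) := by
    refine Complex.isCoveringMap_exp.eq_of_comp_eq h1 (by fun_prop) ?_ 0 (by simp)
    funext s
    apply Subtype.ext
    simp only [Function.comp]
    rw [Complex.exp_log (hne s), Complex.exp_add, Complex.exp_sub, Complex.exp_log (hne 0), h, h]
    have := hne 0
    have h0 : G 0 ≠ 0 := right_ne_zero_of_mul this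
    field_simp
  have := congrFun key 1
  rw [this]; ring

lemma crossing (α β : ℝ → ℝ × ℝ) (T y1 x1 y2 x2 : ℝ) (hα : Continuous α) (hβ : Continuous β)
    (hα0 : α 0 = (y1, 0)) (hα1 : α 1 = (x1, T)) (hβ0 : β 0 = (y2, 0)) (hβ1 : β 1 = (x2, T))
    (hαS : ∀ s, 0 ≤ (α s).2 ∧ (α s).2 ≤ T) (hβS : ∀ s, 0 ≤ (β s).2 ∧ (β s).2 ≤ T)
    (hy : y2 < y1) (hx : x1 < x2) : ∃ s t, α s = β t := by
  by_contra! hne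
  let F : ℝ × ℝ → ℂ := fun p => ⟨(α p.1).1 - (β p.2).1, (α p.1).2 - (β p.2).2⟩
  have hF : Continuous F := by
    have : F = fun p => (((α p.1).1 - (β p.2).1 : ℝ) : ℂ) + (((α p.1).2 - (β p.2).2 : ℝ) : ℂ) * Complex.I := by
      funext p
      apply Complex.ext <;> simp [F]
    rw [this]
    fun_prop
  have hF0 : ∀ p, F p ≠ 0 := by
    intro p hp
    apply hne p.1 p.2
    have h1 := congrArg Complex.re hp
    have h2 := congrArg Complex.im hp
    simp only [F, Complex.zero_re, Complex.zero_im] at h1 h2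
    exact Prod.ext (by linarith) (by linarith)
  have hsc : IsSimplyConnected (univ : Set (ℝ × ℝ)) := by
    have hcv : Convex ℝ (univ : Set (ℝ × ℝ)) := convex_univ
    have := hcv.contractibleSpace univ_nonempty
    unfold IsSimplyConnected
    infer_instance
  obtain ⟨L, hL, hLF⟩ := Complex.exists_continuousOn_eqOn_exp_comp hsc isOpen_univ
    hF.continuousOn (by
      rintro ⟨p, _, hp⟩
      exact hF0 p hp)
  rw [continuousOn_univ] at hL
  have hLF' : ∀ p, Complex.exp (L p) = F p := fun p => hLF (mem_univ p)
  have e1 := edge_log (fun s => L (0, s)) (fun s => F (0, s)) Complex.I Complex.I_ne_zero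
    (by fun_prop) (by fun_prop) (fun s => hLF' _) (by
      intro s
      have := (hβS s).1
      simp [F, hα0]; linarith)
  have e2 := edge_log (fun s => L (s, 1)) (fun s => F (s, 1)) Complex.I Complex.I_ne_zero
    (by fun_prop) (by fun_prop) (fun s => hLF' _) (by
      intro s
      have := (hαS s).2
      simp [F, hβ1]; linarith)
  have e3 := edge_log (fun s => L (s, 0)) (fun s => F (s, 0)) (-Complex.I)
    (neg_ne_zero.2 Complex.I_ne_zero)
    (by fun_prop) (by fun_prop) (fun s => hLF' _) (by
      intro s
      have := (hαS s).1
      simp [F, hβ0]; linarith)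
  have e4 := edge_log (fun s => L (1, s)) (fun s => F (1, s)) (-Complex.I)
    (neg_ne_zero.2 Complex.I_ne_zero)
    (by fun_prop) (by fun_prop) (fun s => hLF' _) (by
      intro s
      have := (hβS s).2
      simp [F, hα1]; linarith)
  have key : Complex.log (Complex.I * F (1, 1)) - Complex.log (Complex.I * F (0, 0)) =
      Complex.log (-Complex.I * F (1, 1)) - Complex.log (-Complex.I * F (0, 0)) := by
    linear_combination e3 + e4 - e1 - e2
  have f0 : F (0, 0) = ((y1 - y2 : ℝ) : ℂ) := by
    apply Complex.ext <;> simp [F, hα0, hβ0]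
  have f1 : F (1, 1) = -((x2 - x1 : ℝ) : ℂ) := by
    apply Complex.ext <;> simp [F, hα1, hβ1]
  have k := congrArg Complex.im key
  have r1 : Complex.I * F (1, 1) = ((x2 - x1 : ℝ) : ℂ) * (-Complex.I) := by rw [f1]; ring
  have r2 : -Complex.I * F (1, 1) = ((x2 - x1 : ℝ) : ℂ) * Complex.I := by rw [f1]; ring
  have r3 : Complex.I * F (0, 0) = ((y1 - y2 : ℝ) : ℂ) * Complex.I := by rw [f0]; ring
  have r4 : -Complex.I * F (0, 0) = ((y1 - y2 : ℝ) : ℂ) * (-Complex.I) := by rw [f0]; ring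
  rw [r1, r2, r3, r4] at k
  simp only [Complex.sub_im, Complex.log_im] at k
  rw [Complex.arg_real_mul _ (sub_pos.2 hx), Complex.arg_real_mul _ (sub_pos.2 hx),
    Complex.arg_real_mul _ (sub_pos.2 hy), Complex.arg_real_mul _ (sub_pos.2 hy),
    Complex.arg_I, Complex.arg_neg_I] at k
  linarith [Real.pi_pos]

lemma second_deriv_le {g g' : ℝ → ℝ} {g'' x0 : ℝ} (h1 : ∀ x, HasDerivAt g (g' x) x)
    (h2 : HasDerivAt g' g'' x0) (hmax : IsLocalMax g x0) : g' x0 = 0 ∧ g'' ≤ 0 := by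
  have h0 : g' x0 = 0 := hmax.hasDerivAt_eq_zero (h1 x0)
  refine ⟨h0, ?_⟩
  by_contra! hpos
  have hd : deriv g = g' := funext fun x => (h1 x).deriv
  have hmin : IsLocalMin g x0 := isLocalMin_of_deriv_deriv_pos
    (by rw [hd, h2.deriv]; exact hpos) (by rw [hd, h0]) (h1 x0).continuousAt
  have hconst : g =ᶠ[nhds x0] fun _ => g x0 := by
    filter_upwards [hmax, hmin] with x hx hx'
    exact le_antisymm hx hx'
  have hg' : g' =ᶠ[nhds x0] fun _ => 0 := by
    filter_upwards [hconst.eventuallyEq_nhds] with x hx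
    exact (h1 x).unique ((hasDerivAt_const x (g x0)).congr_of_eventuallyEq hx)
  have := h2.unique ((hasDerivAt_const x0 (0:ℝ)).congr_of_eventuallyEq hg')
  linarith

lemma left_deriv_nonneg {h : ℝ → ℝ} {h' t0 r : ℝ} (hr : 0 < r) (hd : HasDerivAt h h' t0)
    (hle : ∀ t, t0 - r < t → t ≤ t0 → h t ≤ h t0) : 0 ≤ h' := by
  have h1 : Filter.Tendsto (slope h t0) (nhdsWithin t0 (Iio t0)) (nhds h') := by
    refine (hasDerivAt_iff_tendsto_slope.1 hd).mono_left (nhdsWithin_mono _ ?_)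
    intro x hx
    exact ne_of_lt hx
  refine ge_of_tendsto h1 ?_
  filter_upwards [Ioo_mem_nhdsLT (show t0 - r < t0 by linarith)] with t ht
  rw [slope_def_field]
  exact div_nonneg_of_nonpos (sub_nonpos.2 (hle t ht.1 ht.2.le)) (by linarith [ht.2])

lemma pc_box {S W : Set (ℝ × ℝ)} (hS : Convex ℝ S) (hWS : W ⊆ S)
    (hWo : ∀ p ∈ W, ∃ r > 0, Metric.ball p r ∩ S ⊆ W) (p0 q : ℝ × ℝ) (hq : q ∈ W)
    (hqc : q ∈ closure (pathComponentIn W p0)) :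
    ∃ r > 0, Metric.ball q r ∩ S ⊆ pathComponentIn W p0 := by
  obtain ⟨r, hr, hb⟩ := hWo q hq
  refine ⟨r, hr, ?_⟩
  have hconv : Convex ℝ (Metric.ball q r ∩ S) := (convex_ball q r).inter hS
  obtain ⟨z, hzb, hzU⟩ := mem_closure_iff.1 hqc _ Metric.isOpen_ball (Metric.mem_ball_self hr)
  have hz : z ∈ Metric.ball q r ∩ S := ⟨hzb, hWS (pathComponentIn_subset hzU)⟩
  intro p hp
  have : JoinedIn W z p := JoinedIn.of_segment_subset ((hconv.segment_subset hz hp).trans hb)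
  exact JoinedIn.trans hzU this

lemma reach (T M : ℝ) (v vx vxx vt a b c : ℝ → ℝ → ℝ)
    (hvc : ContinuousOn (fun p : ℝ × ℝ => v p.1 p.2) {p : ℝ × ℝ | 0 ≤ p.2})
    (N : ℝ) (hN : ∀ x t, 0 ≤ t → v x t ≤ N)
    (hvx : ∀ x t : ℝ, 0 < t → HasDerivAt (fun y => v y t) (vx x t) x)
    (hvxx : ∀ x t : ℝ, 0 < t → HasDerivAt (fun y => vx y t) (vxx x t) x)
    (hvt : ∀ x t : ℝ, 0 < t → HasDerivAt (fun s => v x s) (vt x t) t)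
    (hpde : ∀ x t : ℝ, 0 < t → vt x t ≤ a x t * vxx x t + b x t * vx x t + c x t * v x t)
    (ha : ∀ x t : ℝ, 0 < t → 0 ≤ a x t ∧ a x t ≤ M)
    (hb : ∀ x t : ℝ, 0 < t → |b x t| ≤ M) (hc : ∀ x t : ℝ, 0 < t → |c x t| ≤ M)
    (W : Set (ℝ × ℝ)) (hWS : W ⊆ {p : ℝ × ℝ | 0 ≤ p.2 ∧ p.2 ≤ T})
    (hWo : ∀ p ∈ W, ∃ r > 0, Metric.ball p r ∩ {p : ℝ × ℝ | 0 ≤ p.2 ∧ p.2 ≤ T} ⊆ W)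
    (hle : ∀ p : ℝ × ℝ, 0 ≤ p.2 → p.2 ≤ T → p ∉ W → v p.1 p.2 ≤ 0)
    (p0 : ℝ × ℝ) (hp0 : p0 ∈ W) (hv0 : 0 < v p0.1 p0.2) :
    ∃ y, (y, (0:ℝ)) ∈ pathComponentIn W p0 := by
  by_contra! hno
  set S : Set (ℝ × ℝ) := {p : ℝ × ℝ | 0 ≤ p.2 ∧ p.2 ≤ T} with hSdef
  have hSclosed : IsClosed S :=
    (isClosed_le continuous_const continuous_snd).inter (isClosed_le continuous_snd continuous_const)
  have hSconv : Convex ℝ S := by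
    have : S = univ ×ˢ Icc 0 T := by ext p; simp [hSdef]
    rw [this]
    exact convex_univ.prod (convex_Icc _ _)
  have hvS : ContinuousOn (fun p : ℝ × ℝ => v p.1 p.2) S := hvc.mono fun p hp => hp.1
  obtain ⟨l, hl⟩ : ∃ l, l = 4 * M + 1 := ⟨_, rfl⟩
  have hpos0 : 0 ≤ M := by
    have := ha 0 1 one_pos
    linarith
  let φ : ℝ × ℝ → ℝ := fun p => Real.exp (l * p.2) * (1 + p.1 ^ 2)
  have hφc : Continuous φ := by fun_prop
  have hφ : ∀ p, 0 < φ p := fun p => by positivity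
  obtain ⟨m0, hm0⟩ : ∃ m0, m0 = v p0.1 p0.2 / φ p0 := ⟨_, rfl⟩
  have hm0pos : 0 < m0 := hm0 ▸ div_pos hv0 (hφ _)
  let K : Set (ℝ × ℝ) := closure (pathComponentIn W p0) ∩ {p ∈ S | m0 * φ p ≤ v p.1 p.2}
  have hKclosed : IsClosed K := isClosed_closure.inter
    (hSclosed.isClosed_le (by fun_prop) hvS)
  have hKsub : K ⊆ Icc (-(1 + N / m0)) (1 + N / m0) ×ˢ Icc 0 T := by
    rintro ⟨x, t⟩ ⟨_, ⟨h0, hT⟩, h2⟩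
    simp only [φ] at h0 hT h2
    have h3 := hN x t h0
    have h4 : 1 ≤ Real.exp (l * t) := Real.one_le_exp (by rw [hl]; positivity)
    have h5 : m0 * (1 + x ^ 2) ≤ N := by
      have : m0 * (1 + x ^ 2) ≤ m0 * (Real.exp (l * t) * (1 + x ^ 2)) := by
        apply mul_le_mul_of_nonneg_left _ hm0pos.le
        nlinarith [sq_nonneg x]
      linarith
    have h6 : 1 + x ^ 2 ≤ N / m0 := by
      rw [le_div_iff₀ hm0pos]; linarith
    refine ⟨⟨?_, ?_⟩, h0, hT⟩ <;> simp only <;> nlinarith [sq_nonneg (x - 1), sq_nonneg (x + 1)]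
  have hKcomp : IsCompact K :=
    (isCompact_Icc.prod isCompact_Icc).of_isClosed_subset hKclosed hKsub
  have hp0K : p0 ∈ K := by
    refine ⟨subset_closure (mem_pathComponentIn_self hp0), hWS hp0, ?_⟩
    rw [hm0, div_mul_cancel₀ _ (hφ _).ne']
  obtain ⟨q, hqK, hqmax⟩ := hKcomp.exists_isMaxOn ⟨p0, hp0K⟩
    (f := fun p : ℝ × ℝ => v p.1 p.2 / φ p)
    ((hvS.mono fun p hp => hp.2.1).div hφc.continuousOn fun p _ => (hφ p).ne')
  obtain ⟨m, hm⟩ : ∃ m, m = v q.1 q.2 / φ q := ⟨_, rfl⟩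
  have hmm0 : m0 ≤ m := by
    have := hqmax hp0K
    simp only [mem_ofPred_eq] at this
    rw [hm, hm0]; exact this
  have hmpos : 0 < m := hm0pos.trans_le hmm0
  have hvq : v q.1 q.2 = m * φ q := by rw [hm, div_mul_cancel₀ _ (hφ _).ne']
  have hqS : q ∈ S := hqK.2.1
  have hqW : q ∈ W := by
    by_contra hn
    have := hle q hqS.1 hqS.2 hn
    have := mul_pos hmpos (hφ q)
    linarith
  obtain ⟨r, hr, hball⟩ := pc_box hSconv hWS hWo p0 q hqW hqK.1
  have hloc : ∀ p ∈ Metric.ball q r ∩ S, v p.1 p.2 ≤ m * φ p := by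
    intro p hp
    by_cases hpK : m0 * φ p ≤ v p.1 p.2
    · have := hqmax (show p ∈ K from ⟨subset_closure (hball hp), hp.2, hpK⟩)
      simp only [mem_ofPred_eq] at this
      rw [← hm, div_le_iff₀ (hφ p)] at this
      exact this
    · push Not at hpK
      have := mul_le_mul_of_nonneg_right hmm0 (hφ p).le
      linarith
  obtain ⟨x0, t0⟩ := q
  have ht0 : 0 < t0 := by
    rcases hqS.1.lt_or_eq with h | h
    · exact h
    · exfalso
      have hqU := hball ⟨Metric.mem_ball_self hr, hqS⟩
      simp only at h
      rw [← h] at hqU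
      exact hno _ hqU
  obtain ⟨E, hE⟩ : ∃ E, E = m * Real.exp (l * t0) := ⟨_, rfl⟩
  have hEpos : 0 < E := hE ▸ mul_pos hmpos (Real.exp_pos _)
  have hvq' : v x0 t0 = E * (1 + x0 ^ 2) := by
    simp only [φ] at hvq; rw [hvq, hE]; ring
  have hx := second_deriv_le (g := fun x => v x t0 - E * (1 + x ^ 2))
    (g' := fun x => vx x t0 - E * (2 * x)) (g'' := vxx x0 t0 - E * 2) (x0 := x0)
    (by
      intro x
      have h1 : HasDerivAt (fun x : ℝ => E * (1 + x ^ 2)) (E * (2 * x)) x := by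
        have := ((hasDerivAt_pow 2 x).const_add 1).const_mul E
        simpa using this
      exact (hvx x t0 ht0).sub h1)
    (by
      have h1 : HasDerivAt (fun x : ℝ => E * (2 * x)) (E * 2) x0 := by
        have := ((hasDerivAt_id x0).const_mul 2).const_mul E
        simpa using this
      exact (hvxx x0 t0 ht0).sub h1)
    (by
      filter_upwards [Metric.ball_mem_nhds x0 hr] with x hx
      have := hloc (x, t0) ⟨by
        rw [← ball_prod_same]
        exact ⟨hx, Metric.mem_ball_self hr⟩, hqS⟩
      simp only [φ] at this
      rw [hvq', hE]
      linarith)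
  have ht := left_deriv_nonneg (h := fun t => v x0 t - m * (Real.exp (l * t) * (1 + x0 ^ 2)))
    (h' := vt x0 t0 - m * (Real.exp (l * t0) * l * (1 + x0 ^ 2))) (t0 := t0) (r := min r t0)
    (lt_min hr ht0)
    (by
      have h1 : HasDerivAt (fun t : ℝ => m * (Real.exp (l * t) * (1 + x0 ^ 2)))
          (m * (Real.exp (l * t0) * l * (1 + x0 ^ 2))) t0 := by
        have := ((((hasDerivAt_id t0).const_mul l).exp).mul_const (1 + x0 ^ 2)).const_mul m
        simpa using this
      exact (hvt x0 t0 ht0).sub h1)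
    (by
      intro t h1 h2
      have h3 : min r t0 ≤ r := min_le_left _ _
      have h4 : min r t0 ≤ t0 := min_le_right _ _
      have := hloc (x0, t) ⟨by
        rw [← ball_prod_same]
        refine ⟨Metric.mem_ball_self hr, ?_⟩
        rw [Metric.mem_ball, Real.dist_eq, abs_lt]
        constructor <;> linarith, ⟨by simp only; linarith, h2.trans hqS.2⟩⟩
      simp only [φ] at this hvq
      linarith)
  have hp := hpde x0 t0 ht0
  obtain ⟨ha0, haM⟩ := ha x0 t0 ht0
  have hbM := abs_le.1 (hb x0 t0 ht0)
  have hcM := abs_le.1 (hc x0 t0 ht0)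
  obtain ⟨hx1, hx2⟩ := hx
  have hx1' : vx x0 t0 = E * (2 * x0) := by linarith
  have i1 : a x0 t0 * vxx x0 t0 ≤ M * (E * 2) :=
    (mul_le_mul_of_nonneg_left (by linarith : vxx x0 t0 ≤ E * 2) ha0).trans
      (mul_le_mul_of_nonneg_right haM (by positivity))
  have i2 : b x0 t0 * vx x0 t0 ≤ M * (E * (1 + x0 ^ 2)) := by
    rw [hx1']
    have : b x0 t0 * (2 * x0) ≤ M * (1 + x0 ^ 2) := by
      nlinarith [mul_nonneg (by linarith : 0 ≤ M - b x0 t0) (sq_nonneg (1 + x0)),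
        mul_nonneg (by linarith : 0 ≤ M + b x0 t0) (sq_nonneg (1 - x0))]
    nlinarith
  have i3 : c x0 t0 * v x0 t0 ≤ M * (E * (1 + x0 ^ 2)) := by
    rw [hvq']
    exact mul_le_mul_of_nonneg_right hcM.2 (by positivity)
  have i4 : m * (Real.exp (l * t0) * l * (1 + x0 ^ 2)) = (4 * M + 1) * (E * (1 + x0 ^ 2)) := by
    rw [hE, ← hl]; ring
  have i5 : 0 < E * (1 + x0 ^ 2) := by positivity
  have i6 : M * (E * 2) ≤ 2 * M * (E * (1 + x0 ^ 2)) := by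
    have : 0 ≤ M * E * x0 ^ 2 := by positivity
    nlinarith
  nlinarith

theorem connectedness_of_positivity_set
    (ε : ℝ) (hε : 0 < ε)
    (e a b c : ℝ → ℝ → ℝ)
    (ex exx et ax axx aT bx bT : ℝ → ℝ → ℝ)
    -- `e` is continuous on ℝ × [0,∞) and bounded there
    (he_cont : ContinuousOn (fun p : ℝ × ℝ => e p.1 p.2) {p : ℝ × ℝ | 0 ≤ p.2})
    (he_bdd : ∃ M : ℝ, ∀ x t : ℝ, 0 ≤ t → |e x t| ≤ M)
    -- `e` is not identically zero
    (hnontriv : ∃ x t : ℝ, 0 ≤ t ∧ e x t ≠ 0)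
    -- `e` is a classical solution on ℝ × (0,∞): the partial derivatives exist
    (hex : ∀ x t : ℝ, 0 < t → HasDerivAt (fun y => e y t) (ex x t) x)
    (hexx : ∀ x t : ℝ, 0 < t → HasDerivAt (fun y => ex y t) (exx x t) x)
    (het : ∀ x t : ℝ, 0 < t → HasDerivAt (fun s => e x s) (et x t) t)
    -- and the equation holds pointwise on ℝ × (0,∞)
    (hpde : ∀ x t : ℝ, 0 < t →
      et x t = a x t * exx x t + b x t * ex x t + c x t * e x t)
    -- derivatives of the coefficients
    (hax : ∀ x t : ℝ, 0 < t → HasDerivAt (fun y => a y t) (ax x t) x)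
    (haxx : ∀ x t : ℝ, 0 < t → HasDerivAt (fun y => ax y t) (axx x t) x)
    (haT : ∀ x t : ℝ, 0 < t → HasDerivAt (fun s => a x s) (aT x t) t)
    (hbx : ∀ x t : ℝ, 0 < t → HasDerivAt (fun y => b y t) (bx x t) x)
    (hbT : ∀ x t : ℝ, 0 < t → HasDerivAt (fun s => b x s) (bT x t) t)
    -- uniform parabolicity
    (ha_lb : ∀ x t : ℝ, 0 < t → ε ≤ a x t)
    -- boundedness of a, 1/a, ∂ₜa, ∂ₓa, ∂ₓₓa, b, ∂ₜb, ∂ₓb, c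
    (hbounds : ∃ M : ℝ, ∀ x t : ℝ, 0 < t →
      |a x t| ≤ M ∧ |1 / a x t| ≤ M ∧ |aT x t| ≤ M ∧
      |ax x t| ≤ M ∧ |axx x t| ≤ M ∧ |b x t| ≤ M ∧ |bT x t| ≤ M ∧
      |bx x t| ≤ M ∧ |c x t| ≤ M)
    -- the initial positivity set is an interval
    (hA0 : IsPreconnected {x : ℝ | 0 < e x 0}) :
    ∀ t : ℝ, 0 < t → IsPreconnected {x : ℝ | 0 < e x t} := by
  intro T hT
  obtain ⟨N, hN⟩ := he_bdd
  obtain ⟨M, hM⟩ := hbounds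
  have ha : ∀ x t : ℝ, 0 < t → 0 ≤ a x t ∧ a x t ≤ M := fun x t ht =>
    ⟨hε.le.trans (ha_lb x t ht), (le_abs_self _).trans (hM x t ht).1⟩
  have hb : ∀ x t : ℝ, 0 < t → |b x t| ≤ M := fun x t ht => (hM x t ht).2.2.2.2.2.1
  have hc : ∀ x t : ℝ, 0 < t → |c x t| ≤ M := fun x t ht => (hM x t ht).2.2.2.2.2.2.2.2
  rw [isPreconnected_iff_ordConnected] at hA0 ⊢
  refine ⟨fun x1 hx1 x3 hx3 x2 hx2 => ?_⟩
  by_contra hx2n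
  simp only [mem_ofPred_eq, not_lt] at hx1 hx3 hx2n
  have h12 : x1 < x2 := by
    rcases hx2.1.lt_or_eq with h | h
    · exact h
    · subst h; linarith
  have h23 : x2 < x3 := by
    rcases hx2.2.lt_or_eq with h | h
    · exact h
    · subst h; linarith
  -- the positivity set in the strip
  let S : Set (ℝ × ℝ) := {p : ℝ × ℝ | 0 ≤ p.2 ∧ p.2 ≤ T}
  let P : Set (ℝ × ℝ) := {p : ℝ × ℝ | p ∈ S ∧ 0 < e p.1 p.2}
  have hPo : ∀ p ∈ P, ∃ r > 0, Metric.ball p r ∩ S ⊆ P := by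
    intro p hp
    have h1 := (he_cont p hp.1.1).eventually (lt_mem_nhds hp.2)
    obtain ⟨r, hr, h2⟩ := Metric.mem_nhdsWithin_iff.1 h1
    exact ⟨r, hr, fun z hz => ⟨hz.2, h2 ⟨hz.1, hz.2.1⟩⟩⟩
  have reachP : ∀ x, 0 < e x T → ∃ y, JoinedIn P (x, T) (y, 0) := by
    intro x hx
    exact reach T M e ex exx et a b c he_cont N (fun x t ht => (le_abs_self _).trans (hN x t ht))
      hex hexx het (fun x t ht => (hpde x t ht).le) ha hb hc P (fun p hp => hp.1) hPo
      (fun p h0 h1 hp => by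
        by_contra! h
        exact hp ⟨⟨h0, h1⟩, h⟩) (x, T) ⟨⟨hT.le, le_rfl⟩, hx⟩ hx
  obtain ⟨y1, hy1⟩ := reachP x1 hx1
  obtain ⟨y3, hy3⟩ := reachP x3 hx3
  have hy1p : 0 < e y1 0 := hy1.target_mem.2
  have hy3p : 0 < e y3 0 := hy3.target_mem.2
  obtain ⟨g1, hg1⟩ := hy1.symm
  obtain ⟨g3, hg3⟩ := hy3.symm
  let K : Set (ℝ × ℝ) := range g1 ∪ range g3 ∪ (uIcc y1 y3 ×ˢ {0})
  have hKP : K ⊆ P := by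
    rintro p ((⟨s, rfl⟩ | ⟨s, rfl⟩) | ⟨h1, h2⟩)
    · exact hg1 s
    · exact hg3 s
    · obtain ⟨x, t⟩ := p
      simp only [mem_singleton_iff] at h1 h2
      subst h2
      exact ⟨⟨le_rfl, hT.le⟩, hA0.uIcc_subset hy1p hy3p h1⟩
  have hKc : IsCompact K :=
    ((isCompact_range g1.continuous).union (isCompact_range g3.continuous)).union
      (isCompact_uIcc.prod isCompact_singleton)
  obtain ⟨q, hqK, hqmin⟩ := hKc.exists_isMinOn ⟨_, Or.inl (Or.inl (mem_range_self 0))⟩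
    (he_cont.mono fun p hp => (hKP hp).1.1)
  obtain ⟨d, hd⟩ : ∃ d, d = e q.1 q.2 := ⟨_, rfl⟩
  have hdpos : 0 < d := hd ▸ (hKP hqK).2
  have hKd : ∀ p ∈ K, d ≤ e p.1 p.2 := fun p hp => hd ▸ hqmin hp
  have hM0 : 0 ≤ M := by
    have := ha 0 1 one_pos
    linarith
  have hexple : ∀ t : ℝ, 0 ≤ t → d * Real.exp (-M * t) ≤ d := by
    intro t ht
    have : Real.exp (-M * t) ≤ 1 := Real.exp_le_one_iff.2 (by nlinarith)
    nlinarith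
  obtain ⟨y2, hy2⟩ := reach T M (fun x t => d * Real.exp (-M * t) - e x t)
    (fun x t => - ex x t) (fun x t => - exx x t)
    (fun x t => d * (Real.exp (-M * t) * -M) - et x t) a b c
    (ContinuousOn.sub (by fun_prop) he_cont) (d + N)
    (fun x t ht => by
      have h1 := hexple t ht
      have h2 := (abs_le.1 (hN x t ht)).1
      linarith)
    (fun x t ht => (hex x t ht).const_sub _)
    (fun x t ht => (hexx x t ht).neg)
    (fun x t ht => by
      have h1 : HasDerivAt (fun t : ℝ => d * Real.exp (-M * t)) (d * (Real.exp (-M * t) * -M)) t := by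
        have := (((hasDerivAt_id t).const_mul (-M)).exp).const_mul d
        simpa using this
      exact h1.sub (het x t ht))
    (fun x t ht => by
      have h1 := hpde x t ht
      have h2 := (abs_le.1 (hc x t ht)).1
      have h3 : 0 < d * Real.exp (-M * t) := mul_pos hdpos (Real.exp_pos _)
      have h4 := mul_le_mul_of_nonneg_right h2 h3.le
      linarith)
    ha hb hc (S \ K) sdiff_subset
    (by
      intro p hp
      obtain ⟨r, hr, h⟩ := Metric.isOpen_iff.1 hKc.isClosed.isOpen_compl p hp.2
      exact ⟨r, hr, fun z hz => ⟨hz.2, h hz.1⟩⟩)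
    (fun p h0 h1 hp => by
      have hpK : p ∈ K := by
        by_contra h
        exact hp ⟨⟨h0, h1⟩, h⟩
      have h2 := hKd p hpK
      have h3 := hexple p.2 h0
      linarith)
    (x2, T) ⟨⟨hT.le, le_rfl⟩, fun h => by
      have := (hKP h).2
      simp only at this
      linarith⟩
    (by
      have h3 : 0 < d * Real.exp (-M * T) := mul_pos hdpos (Real.exp_pos _)
      simp only
      linarith)
  have hy2K : (y2, (0:ℝ)) ∉ K := (pathComponentIn_subset hy2).2
  obtain ⟨g2, hg2⟩ := JoinedIn.symm hy2
  have ext : ∀ {p q : ℝ × ℝ} (g : Path p q) (Q : Set (ℝ × ℝ)), (∀ s, g s ∈ Q) →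
      ∀ s : ℝ, g.extend s ∈ Q := by
    intro p q g Q h s
    have : g.extend s ∈ range g := by
      rw [← Path.extend_range]
      exact mem_range_self s
    obtain ⟨u, hu⟩ := this
    rw [← hu]
    exact h u
  have h2out := ext g2 _ hg2
  have hu : y2 ∉ uIcc y1 y3 := fun h => hy2K (Or.inr ⟨h, rfl⟩)
  rw [mem_uIcc] at hu
  push Not at hu
  by_cases hlt : y2 < y1
  · obtain ⟨s, t, hst⟩ := crossing g1.extend g2.extend T y1 x1 y2 x2 g1.continuous_extend
      g2.continuous_extend (by simp) (by simp) (by simp) (by simp)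
      (fun s => (ext g1 _ hg1 s).1) (fun s => (h2out s).1) hlt h12
    exact (h2out t).2 (Or.inl (Or.inl (hst ▸ ext g1 _ (fun s => mem_range_self s) s)))
  · have hlt' : y3 < y2 := hu.1 (not_lt.1 hlt)
    obtain ⟨s, t, hst⟩ := crossing g2.extend g3.extend T y2 x2 y3 x3 g2.continuous_extend
      g3.continuous_extend (by simp) (by simp) (by simp) (by simp)
      (fun s => (h2out s).1) (fun s => (ext g3 _ hg3 s).1) hlt' h23
    exact (h2out s).2 (Or.inl (Or.inr (hst ▸ ext g3 _ (fun s => mem_range_self s) t)))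
end

section
/- Let ε > 0, C > 0, and let σ : (0,∞) × ℝ × ℝ × ℝ → ℝ, written σ(t,z,p,q), be smooth and satisfy ε ≤ ∂σ/∂q (t,z,p,q) ≤ C for all arguments. Let u : ℝ × (0,∞) → ℝ be a smooth solution of ∂_t u = σ(t,u,∂_x u,∂²_x u) that is bounded together with its spatial derivatives up to second order and its first time derivative. If there exist t₀ > 0 and a nondegenerate interval I ⊆ ℝ such that x ↦ u(x,t₀) is constant on I, then there exists a function α : (0,∞) → ℝ satisfying the ordinary differential equation α'(t) = σ(t,α(t),0,0) such that u(x,t) = α(t) for all x ∈ ℝ and all t > 0. -/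
namespace PUC
open Set Filter Topology MeasureTheory
open scoped ContDiff

/-- directional derivative -/
noncomputable def dd (e : ℝ × ℝ) (F : ℝ × ℝ → ℝ) : ℝ × ℝ → ℝ := fun p => fderiv ℝ F p e
local notation "dx" => dd ((1 : ℝ), (0 : ℝ))
local notation "dt" => dd ((0 : ℝ), (1 : ℝ))

abbrev Sm (U : Set (ℝ × ℝ)) (F : ℝ × ℝ → ℝ) : Prop := ContDiffOn ℝ ∞ F U

section basic
variable {U : Set (ℝ × ℝ)} {F G : ℝ × ℝ → ℝ} {p e : ℝ × ℝ}

theorem Sm.diffAt (hF : Sm U F) (hU : IsOpen U) (hp : p ∈ U) : DifferentiableAt ℝ F p :=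
  (hF.differentiableOn (by simp)).differentiableAt (hU.mem_nhds hp)

theorem Sm.cdAt (hF : Sm U F) (hU : IsOpen U) (hp : p ∈ U) : ContDiffAt ℝ ∞ F p :=
  hF.contDiffAt (hU.mem_nhds hp)

theorem Sm.dd (hF : Sm U F) (hU : IsOpen U) (e : ℝ × ℝ) : Sm U (dd e F) := by
  have : ContDiffOn ℝ ∞ (fderiv ℝ F) U := hF.fderiv_of_isOpen hU (by simp)
  exact this.clm_apply contDiffOn_const

theorem Sm.mul' (hF : Sm U F) (hG : Sm U G) : Sm U (fun p => F p * G p) := ContDiffOn.mul hF hG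
theorem Sm.add' (hF : Sm U F) (hG : Sm U G) : Sm U (fun p => F p + G p) := ContDiffOn.add hF hG

theorem dd_mul (hU : IsOpen U) (hF : Sm U F) (hG : Sm U G) (hp : p ∈ U) (e : ℝ × ℝ) :
    dd e (fun p => F p * G p) p = dd e F p * G p + F p * dd e G p := by
  have := fderiv_fun_mul (hF.diffAt hU hp) (hG.diffAt hU hp)
  simp only [PUC.dd, this]
  simp; ring

theorem dd_add (hU : IsOpen U) (hF : Sm U F) (hG : Sm U G) (hp : p ∈ U) (e : ℝ × ℝ) :
    dd e (fun p => F p + G p) p = dd e F p + dd e G p := by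
  have := fderiv_fun_add (hF.diffAt hU hp) (hG.diffAt hU hp)
  simp only [PUC.dd, this]
  simp

theorem dd_congr (hU : IsOpen U) (h : ∀ p ∈ U, F p = G p) (hp : p ∈ U) (e : ℝ × ℝ) :
    dd e F p = dd e G p := by
  have : F =ᶠ[𝓝 p] G := by
    filter_upwards [hU.mem_nhds hp] with q hq using h q hq
  simp only [PUC.dd, this.fderiv_eq]

theorem dd_comm (hU : IsOpen U) (hF : Sm U F) (hp : p ∈ U) (e e' : ℝ × ℝ) :
    dd e (dd e' F) p = dd e' (dd e F) p := by
  have h1 : IsSymmSndFDerivAt ℝ F p := (hF.cdAt hU hp).isSymmSndFDerivAt (by simp; exact WithTop.coe_le_coe.2 (le_top : (2:ℕ∞) ≤ ⊤))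
  have h2 : DifferentiableAt ℝ (fderiv ℝ F) p :=
    ((hF.fderiv_of_isOpen hU (m := ∞) (by simp)).differentiableOn (by simp)).differentiableAt
      (hU.mem_nhds hp)
  have key : ∀ a b : ℝ × ℝ, dd a (dd b F) p = fderiv ℝ (fderiv ℝ F) p a b := by
    intro a b
    have h3 : HasFDerivAt (fun q => fderiv ℝ F q b) _ p :=
      h2.hasFDerivAt.clm_apply (hasFDerivAt_const b p)
    have h4 : dd a (dd b F) p = fderiv ℝ (fun q => fderiv ℝ F q b) p a := rfl
    rw [h4, h3.fderiv]
    simp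
  rw [key, key, h1.eq]

theorem hasDeriv_dx {x t : ℝ} (hU : IsOpen U) (hF : Sm U F) (hp : (x, t) ∈ U) :
    HasDerivAt (fun y => F (y, t)) (dx F (x, t)) x := by
  have h := (hF.diffAt hU hp).hasFDerivAt
  have h2 : HasDerivAt (fun y : ℝ => (y, t)) ((1 : ℝ), (0 : ℝ)) x :=
    (hasDerivAt_id x).prodMk (hasDerivAt_const x t)
  exact h.comp_hasDerivAt x h2

theorem hasDeriv_dt {x t : ℝ} (hU : IsOpen U) (hF : Sm U F) (hp : (x, t) ∈ U) :
    HasDerivAt (fun s => F (x, s)) (dt F (x, t)) t := by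
  have h := (hF.diffAt hU hp).hasFDerivAt
  have h2 : HasDerivAt (fun s : ℝ => (x, s)) ((0 : ℝ), (1 : ℝ)) t :=
    (hasDerivAt_const t x).prodMk (hasDerivAt_id t)
  exact h.comp_hasDerivAt t h2

theorem Sm.cont_x {t : ℝ} (hF : Sm U F) (h : ∀ x, (x, t) ∈ U) :
    Continuous (fun x => F (x, t)) := by
  have : ContinuousOn (fun x => F (x, t)) univ :=
    hF.continuousOn.comp (by fun_prop) (fun x _ => h x)
  exact continuousOn_univ.1 this

end basic

def Om : Set (ℝ × ℝ) := {p | 0 < p.2}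

theorem isOpen_Om : IsOpen Om := isOpen_lt continuous_const continuous_snd

theorem second_deriv_nonpos {h h' : ℝ → ℝ} {x c : ℝ} (hm : IsLocalMax h x)
    (h1 : ∀ᶠ y in 𝓝 x, HasDerivAt h (h' y) y) (h2 : HasDerivAt h' c x) :
    h' x = 0 ∧ c ≤ 0 := by
  have h0 : h' x = 0 := hm.hasDerivAt_eq_zero h1.self_of_nhds
  refine ⟨h0, ?_⟩
  by_contra hc
  push Not at hc
  have e1 : deriv h =ᶠ[𝓝 x] h' := h1.mono fun y hy => hy.deriv
  have e2 : deriv (deriv h) x = c := by rw [e1.deriv_eq]; exact h2.deriv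
  have hmin : IsLocalMin h x := isLocalMin_of_deriv_deriv_pos (by rw [e2]; exact hc)
    (by rw [e1.self_of_nhds]; exact h0) h1.self_of_nhds.continuousAt
  have hcst : ∀ᶠ y in 𝓝 x, h y = h x := by
    filter_upwards [hm, hmin] with y a b using le_antisymm a b
  have e3 : deriv h =ᶠ[𝓝 x] fun _ => 0 := by
    filter_upwards [hcst.eventually_nhds] with y hy
    have : h =ᶠ[𝓝 y] fun _ => h x := hy
    rw [this.deriv_eq]; simp
  rw [e3.deriv_eq] at e2
  simp at e2
  linarith

theorem deriv_nonneg_of_left_max {h : ℝ → ℝ} {c t δ : ℝ} (hd : HasDerivAt h c t) (hδ : δ < t)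
    (hmax : ∀ s, δ ≤ s → s ≤ t → h s ≤ h t) : 0 ≤ c := by
  have h1 := (hasDerivWithinAt_iff_tendsto_slope' (by simp)).1 (hd.hasDerivWithinAt (s := Iio t))
  refine ge_of_tendsto h1 ?_
  have : Ioo δ t ∈ 𝓝[<] t := Ioo_mem_nhdsLT hδ
  filter_upwards [this] with s hs
  rw [slope_def_field]
  have := hmax s hs.1.le hs.2.le
  exact div_nonneg_of_nonpos (by linarith) (by linarith [hs.2])

set_option maxHeartbeats 2000000 in
theorem lip_core {ε K M δ T : ℝ} (hε : 0 < ε) (hδ : 0 < δ)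
    {Z a b f : ℝ × ℝ → ℝ} (hZ : Sm Om Z)
    (heq : ∀ x t, δ ≤ t → t ≤ T → dt Z (x,t) = a (x,t) * dx (dx Z) (x,t) + b (x,t) * dx Z (x,t) + f (x,t))
    (ha : ∀ x t, δ ≤ t → t ≤ T → ε ≤ a (x,t))
    (hb : ∀ x t, δ ≤ t → t ≤ T → |b (x,t)| ≤ K)
    (hf : ∀ x t, δ ≤ t → t ≤ T → |f (x,t)| ≤ K)
    (hM : ∀ x t, δ ≤ t → t ≤ T → |Z (x,t)| ≤ M)
    (h0 : ∀ x, Z (x, δ) = 0) {m s0 L : ℝ} (hm : m = (2 * K + 1) / (2 * ε)) (hs0 : s0 = 1 / (2 * m))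
    (hL1 : 1 ≤ L) (hL2 : 4 * M ≤ L * s0) :
    ∀ x r t, δ ≤ t → t ≤ T → 0 ≤ r → r ≤ s0 → Z (x, t) - Z (x - r, t) ≤ L * (r - m * r ^ 2) := by
  intro x₁ r₁ t₁ ht₁ ht₁' hr₁ hr₁'
  by_contra hcon
  push Not at hcon
  have hK : 0 ≤ K := (abs_nonneg _).trans (hb 0 t₁ ht₁ ht₁')
  have hM0 : 0 ≤ M := (abs_nonneg _).trans (hM 0 t₁ ht₁ ht₁')
  have hmpos : 0 < m := by rw [hm]; positivity
  have hs0pos : 0 < s0 := by rw [hs0]; positivity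
  have hms0 : m * s0 = 1 / 2 := by rw [hs0]; field_simp
  have h2me : 2 * m * ε = 2 * K + 1 := by rw [hm]; field_simp
  obtain ⟨η, hη0, hη1, hη2, hη3, hη4⟩ : ∃ η : ℝ, 0 < η ∧
      η * x₁ ^ 2 < Z (x₁, t₁) - Z (x₁ - r₁, t₁) - L * (r₁ - m * r₁ ^ 2) ∧ η * ε < 1 / 2 ∧
      8 * M * K ^ 2 * η < 1 ∧ η < m * L := by
    have key : ∀ c d : ℝ, 0 < d → ∀ᶠ η : ℝ in 𝓝[>] 0, c * η < d := by
      intro c d hd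
      have : Tendsto (fun η : ℝ => c * η) (𝓝[>] 0) (𝓝 (c * 0)) :=
        ((continuous_const.mul continuous_id).tendsto 0).mono_left nhdsWithin_le_nhds
      exact this.eventually (gt_mem_nhds (by simpa using hd))
    have hmL : 0 < m * L := by positivity
    obtain ⟨η, h⟩ := ((key (x₁ ^ 2) _ (by linarith : 0 < Z (x₁, t₁) - Z (x₁ - r₁, t₁) - L * (r₁ - m * r₁ ^ 2))).and
      ((key ε (1/2) (by norm_num)).and ((key (8 * M * K ^ 2) 1 one_pos).and
      ((key 1 (m * L) hmL).and self_mem_nhdsWithin)))).exists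
    obtain ⟨a1, a2, a3, a4, a5⟩ := h
    exact ⟨η, a5, by linarith, by linarith, a3, by linarith⟩
  set A : ℝ := |x₁| + (2 * M / η + 1) with hA
  have hMη : 0 ≤ 2 * M / η := by positivity
  have hA1 : 1 ≤ A := by have := abs_nonneg x₁; linarith
  have hA2 : 2 * M ≤ η * A ^ 2 := by
    have h1 : 2 * M / η ≤ A := by have := abs_nonneg x₁; linarith
    have h2 : 2 * M ≤ η * A := by rw [div_le_iff₀ hη0] at h1; linarith
    have h3 : A ≤ A ^ 2 := le_self_pow₀ hA1 two_ne_zero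
    exact h2.trans (mul_le_mul_of_nonneg_left h3 hη0.le)
  let Φ : ℝ × ℝ × ℝ → ℝ := fun q => Z (q.1, q.2.2) - Z (q.1 - q.2.1, q.2.2) -
    L * (q.2.1 - m * q.2.1 ^ 2) - η * q.1 ^ 2
  let S : Set (ℝ × ℝ × ℝ) := Icc (-A) A ×ˢ Icc 0 s0 ×ˢ Icc δ T
  have hS : IsCompact S := isCompact_Icc.prod (isCompact_Icc.prod isCompact_Icc)
  have hmem : (x₁, r₁, t₁) ∈ S := by
    refine ⟨?_, ⟨hr₁, hr₁'⟩, ⟨ht₁, ht₁'⟩⟩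
    constructor
    · show -A ≤ x₁
      have := neg_abs_le x₁; linarith
    · show x₁ ≤ A
      have := le_abs_self x₁; linarith
  have hΦc : ContinuousOn Φ S := by
    have hc1 : ContinuousOn (fun q : ℝ × ℝ × ℝ => Z (q.1, q.2.2)) S :=
      hZ.continuousOn.comp (by fun_prop) (fun q hq => lt_of_lt_of_le hδ hq.2.2.1)
    have hc2 : ContinuousOn (fun q : ℝ × ℝ × ℝ => Z (q.1 - q.2.1, q.2.2)) S :=
      hZ.continuousOn.comp (by fun_prop) (fun q hq => lt_of_lt_of_le hδ hq.2.2.1)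
    exact ((hc1.sub hc2).sub (by fun_prop)).sub (by fun_prop)
  obtain ⟨⟨x, r, t⟩, hxS, hmax⟩ := hS.exists_isMaxOn ⟨_, hmem⟩ hΦc
  have hpos : 0 < Φ (x, r, t) := by
    have h1 := hmax hmem
    have h2 : 0 < Φ (x₁, r₁, t₁) := by simp only [Φ]; linarith
    exact lt_of_lt_of_le h2 h1
  obtain ⟨⟨hx1, hx2⟩, ⟨hr1, hr2⟩, ⟨ht1, ht2⟩⟩ := hxS
  simp only at hx1 hx2 hr1 hr2 ht1 ht2
  have hΦv : Φ (x, r, t) = Z (x, t) - Z (x - r, t) - L * (r - m * r ^ 2) - η * x ^ 2 := rfl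
  have hZd : Z (x, t) - Z (x - r, t) ≤ 2 * M := by
    have b1 := (abs_le.1 (hM x t ht1 ht2)).2
    have b2 := (abs_le.1 (hM (x - r) t ht1 ht2)).1
    linarith
  have hψ : 0 ≤ L * (r - m * r ^ 2) := by
    have : m * r ≤ 1 / 2 := by rw [← hms0]; gcongr
    have : 0 ≤ r - m * r ^ 2 := by
      have e : r - m * r ^ 2 = r * (1 - m * r) := by ring
      rw [e]; exact mul_nonneg hr1 (by linarith)
    positivity
  have hηx0 : 0 ≤ η * x ^ 2 := by positivity
  have hηx : η * x ^ 2 ≤ 2 * M := by rw [hΦv] at hpos; linarith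
  have hr0 : 0 < r := by
    rcases hr1.eq_or_lt with h | h
    · exfalso; rw [hΦv, ← h] at hpos; simp at hpos; linarith
    · exact h
  have hrs : r < s0 := by
    rcases hr2.eq_or_lt with h | h
    · exfalso
      rw [hΦv] at hpos
      have : L * (r - m * r ^ 2) = L * s0 / 2 := by
        rw [h]; have : m * s0 ^ 2 = s0 / 2 := by rw [pow_two, ← mul_assoc, hms0]; ring
        rw [this]; ring
      linarith
    · exact h
  have htδ : δ < t := by
    rcases ht1.eq_or_lt with h | h
    · exfalso
      rw [hΦv, ← h, h0, h0] at hpos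
      linarith
    · exact h
  have hxA : |x| < A := by
    by_contra hge
    push Not at hge
    have : A ^ 2 ≤ x ^ 2 := by rw [← sq_abs x]; gcongr
    have : η * A ^ 2 ≤ η * x ^ 2 := by gcongr
    rw [hΦv] at hpos
    linarith
  obtain ⟨hxA1, hxA2⟩ := abs_lt.1 hxA
  have htpos : 0 < t := by linarith
  have hin : ∀ y : ℝ, (y, t) ∈ Om := fun y => htpos
  have hZx := hZ.dd isOpen_Om (1, 0)
  -- variation in x
  have vx : dx Z (x, t) - L * (1 - 2 * m * r) - 2 * η * x = 0 ∧
      dx (dx Z) (x, t) + L * (2 * m) - 2 * η ≤ 0 := by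
    have := second_deriv_nonpos (x := x)
      (h := fun z => Z (z, t) - Z (x - r, t) - L * ((z - (x - r)) - m * (z - (x - r)) ^ 2) - η * z ^ 2)
      (h' := fun z => dx Z (z, t) - L * (1 - 2 * m * (z - (x - r))) - 2 * η * z)
      (c := dx (dx Z) (x, t) + L * (2 * m) - 2 * η) ?_ ?_ ?_
    · simpa using this
    · have n1 : ∀ᶠ z in 𝓝 x, z ∈ Ioo (-A) A := Ioo_mem_nhds hxA1 hxA2
      have n2 : ∀ᶠ z in 𝓝 x, z ∈ Ioo (x - r) (x - r + s0) := Ioo_mem_nhds (by linarith) (by linarith)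
      filter_upwards [n1, n2] with z hz hz'
      have hmz : (z, z - (x - r), t) ∈ S :=
        ⟨⟨hz.1.le, hz.2.le⟩, ⟨by simpa using hz'.1.le, by show z - (x - r) ≤ s0; linarith [hz'.2]⟩, ⟨ht1, ht2⟩⟩
      have := hmax hmz
      simp only [mem_ofPred_eq, Φ] at this
      convert this using 2 <;> ring_nf
    · refine Eventually.of_forall fun z => ?_
      have d1 := hasDeriv_dx isOpen_Om hZ (hin z)
      have d2 : HasDerivAt (fun z : ℝ => z - (x - r)) 1 z := (hasDerivAt_id z).sub_const _
      have d3 := (((d1.sub_const (Z (x - r, t))).sub ((d2.sub ((d2.pow 2).const_mul m)).const_mul L))).sub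
        (((hasDerivAt_id z).pow 2).const_mul η)
      exact d3.congr_deriv (by simp <;> ring)
    · have d1 := hasDeriv_dx isOpen_Om hZx (hin x)
      have d2 : HasDerivAt (fun z : ℝ => z - (x - r)) 1 x := (hasDerivAt_id x).sub_const _
      have d3 := (d1.sub (((d2.const_mul (2 * m)).const_sub 1).const_mul L)).sub
        ((hasDerivAt_id x).const_mul (2 * η))
      exact d3.congr_deriv (by simp <;> ring)
  have vy : -dx Z (x - r, t) + L * (1 - 2 * m * r) = 0 ∧
      -dx (dx Z) (x - r, t) + L * (2 * m) ≤ 0 := by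
    have := second_deriv_nonpos (x := x - r)
      (h := fun z => Z (x, t) - Z (z, t) - L * ((x - z) - m * (x - z) ^ 2) - η * x ^ 2)
      (h' := fun z => -dx Z (z, t) + L * (1 - 2 * m * (x - z)))
      (c := -dx (dx Z) (x - r, t) + L * (2 * m)) ?_ ?_ ?_
    · simpa using this
    · have n2 : ∀ᶠ z in 𝓝 (x - r), z ∈ Ioo (x - s0) x := Ioo_mem_nhds (by linarith) (by linarith)
      filter_upwards [n2] with z hz'
      have hmz : (x, x - z, t) ∈ S :=
        ⟨⟨hx1, hx2⟩, ⟨by simpa using hz'.2.le, by show x - z ≤ s0; linarith [hz'.1]⟩, ⟨ht1, ht2⟩⟩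
      have := hmax hmz
      simp only [mem_ofPred_eq, Φ] at this
      convert this using 2 <;> ring_nf
    · refine Eventually.of_forall fun z => ?_
      have d1 := hasDeriv_dx isOpen_Om hZ (hin z)
      have d2 : HasDerivAt (fun z : ℝ => x - z) (-1) z := (hasDerivAt_id z).const_sub _
      have d3 := (((d1.const_sub (Z (x, t))).sub ((d2.sub ((d2.pow 2).const_mul m)).const_mul L))).sub_const (η * x ^ 2)
      exact d3.congr_deriv (by simp <;> ring)
    · have d1 := hasDeriv_dx isOpen_Om hZx (hin (x - r))
      have d2 : HasDerivAt (fun z : ℝ => x - z) (-1) (x - r) := (hasDerivAt_id (x - r)).const_sub _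
      have d3 := d1.neg.add (((d2.const_mul (2 * m)).const_sub 1).const_mul L)
      exact d3.congr_deriv (by simp <;> ring)
  have vt : 0 ≤ dt Z (x, t) - dt Z (x - r, t) := by
    have d := ((hasDeriv_dt isOpen_Om hZ (hin x)).sub (hasDeriv_dt isOpen_Om hZ (hin (x - r))))
    refine deriv_nonneg_of_left_max d htδ fun s hs1 hs2 => ?_
    have hms : (x, r, s) ∈ S := ⟨⟨hx1, hx2⟩, ⟨hr1, hr2⟩, ⟨hs1, hs2.trans ht2⟩⟩
    have := hmax hms
    simp only [mem_ofPred_eq, Φ] at this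
    simp only [Pi.sub_apply]
    linarith
  rw [heq x t ht1 ht2, heq (x - r) t ht1 ht2] at vt
  obtain ⟨vx1, vx2⟩ := vx
  obtain ⟨vy1, vy2⟩ := vy
  have ha1 := ha x t ht1 ht2
  have ha2 := ha (x - r) t ht1 ht2
  have hb1 := hb x t ht1 ht2
  have hb2 := hb (x - r) t ht1 ht2
  have hf1 := (abs_le.1 (hf x t ht1 ht2)).2
  have hf2 := (abs_le.1 (hf (x - r) t ht1 ht2)).1
  have eZ1 : dx Z (x, t) = L * (1 - 2 * m * r) + 2 * η * x := by linarith
  have eZ2 : dx Z (x - r, t) = L * (1 - 2 * m * r) := by linarith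
  have hψ' : 0 ≤ L * (1 - 2 * m * r) ∧ L * (1 - 2 * m * r) ≤ L := by
    have h1 : m * r ≤ 1 / 2 := by rw [← hms0]; gcongr
    have h2 : 0 ≤ m * r := by positivity
    constructor
    · have : 0 ≤ 1 - 2 * m * r := by linarith
      positivity
    · exact mul_le_of_le_one_right (by linarith) (by linarith)
  rw [eZ1, eZ2] at vt
  have q1 : a (x, t) * dx (dx Z) (x, t) ≤ ε * (2 * η - L * (2 * m)) := by
    have : dx (dx Z) (x, t) ≤ 2 * η - L * (2 * m) := by linarith
    have hneg : 2 * η - L * (2 * m) ≤ 0 := by linarith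
    exact (mul_le_mul_of_nonneg_left this (hε.le.trans ha1)).trans (mul_le_mul_of_nonpos_right ha1 hneg)
  have q2 : -(a (x - r, t) * dx (dx Z) (x - r, t)) ≤ -(ε * (L * (2 * m))) := by
    have : L * (2 * m) ≤ dx (dx Z) (x - r, t) := by linarith
    have h0' : 0 ≤ L * (2 * m) := by positivity
    exact neg_le_neg (mul_le_mul ha2 this h0' (hε.le.trans ha2))
  have q3 : b (x, t) * (L * (1 - 2 * m * r) + 2 * η * x) ≤ K * L + 2 * K * η * |x| := by
    have e1 : b (x, t) * (L * (1 - 2 * m * r)) ≤ K * L := by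
      calc b (x, t) * (L * (1 - 2 * m * r)) ≤ |b (x, t)| * (L * (1 - 2 * m * r)) := by
            gcongr
            · exact hψ'.1
            · exact le_abs_self _
        _ ≤ K * L := by gcongr; exact hψ'.1; exact hψ'.2
    have e2 : b (x, t) * x ≤ K * |x| := by
      calc b (x, t) * x ≤ |b (x, t) * x| := le_abs_self _
        _ = |b (x, t)| * |x| := abs_mul _ _
        _ ≤ K * |x| := by gcongr
    have e3 := mul_le_mul_of_nonneg_left e2 (by positivity : 0 ≤ 2 * η)
    have e4 : b (x, t) * (L * (1 - 2 * m * r) + 2 * η * x) =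
      b (x, t) * (L * (1 - 2 * m * r)) + 2 * η * (b (x, t) * x) := by ring
    rw [e4]; linarith
  have q4 : -(b (x - r, t) * (L * (1 - 2 * m * r))) ≤ K * L := by
    calc -(b (x - r, t) * (L * (1 - 2 * m * r))) = -b (x - r, t) * (L * (1 - 2 * m * r)) := by ring
      _ ≤ |b (x - r, t)| * (L * (1 - 2 * m * r)) := by
            gcongr
            · exact hψ'.1
            · exact neg_le_abs _
      _ ≤ K * L := by gcongr; exact hψ'.1; exact hψ'.2
  have q5 : 2 * K * η * |x| < 1 := by
    have : (2 * K * η * |x|) ^ 2 < 1 := by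
      calc (2 * K * η * |x|) ^ 2 = 4 * K ^ 2 * η * (η * x ^ 2) := by
            rw [mul_pow, sq_abs]; ring
        _ ≤ 4 * K ^ 2 * η * (2 * M) := by gcongr
        _ < 1 := by linarith
    exact (sq_lt_one_iff₀ (by positivity)).1 this
  have q6 : ε * (L * (2 * m)) = L * (2 * K + 1) := by rw [← h2me]; ring
  have q7 : K ≤ K * L := le_mul_of_one_le_right hK hL1
  linarith

/-- bounded on every strip -/
def Bd (F : ℝ × ℝ → ℝ) : Prop := ∀ δ T : ℝ, 0 < δ → ∃ K, ∀ x t, δ ≤ t → t ≤ T → |F (x, t)| ≤ K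

theorem Bd.mul {F G : ℝ × ℝ → ℝ} (hF : Bd F) (hG : Bd G) : Bd (fun p => F p * G p) := by
  intro δ T hδ
  obtain ⟨K, hK⟩ := hF δ T hδ
  obtain ⟨K', hK'⟩ := hG δ T hδ
  refine ⟨K * K', fun x t h1 h2 => ?_⟩
  rw [abs_mul]
  exact mul_le_mul (hK x t h1 h2) (hK' x t h1 h2) (abs_nonneg _) ((abs_nonneg _).trans (hK x t h1 h2))

theorem Bd.add {F G : ℝ × ℝ → ℝ} (hF : Bd F) (hG : Bd G) : Bd (fun p => F p + G p) := by
  intro δ T hδ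
  obtain ⟨K, hK⟩ := hF δ T hδ
  obtain ⟨K', hK'⟩ := hG δ T hδ
  exact ⟨K + K', fun x t h1 h2 => (abs_add_le _ _).trans (add_le_add (hK x t h1 h2) (hK' x t h1 h2))⟩

theorem Bd.congr {F G : ℝ × ℝ → ℝ} (hF : Bd F) (h : ∀ p ∈ Om, G p = F p) : Bd G := by
  intro δ T hδ
  obtain ⟨K, hK⟩ := hF δ T hδ
  exact ⟨K, fun x t h1 h2 => by rw [h (x, t) (lt_of_lt_of_le hδ h1)]; exact hK x t h1 h2⟩

theorem dd_lin (c d : ℝ) (e p : ℝ × ℝ) : dd e (fun p => c * (p.2 - d)) p = c * e.2 := by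
  have h : HasFDerivAt (fun p : ℝ × ℝ => c * (p.2 - d)) (c • ContinuousLinearMap.snd ℝ ℝ ℝ) p :=
    ((hasFDerivAt_snd).sub_const d).const_mul c
  simp [dd, h.fderiv]

theorem deriv_le_of_left {h : ℝ → ℝ} {c x L s0 : ℝ} (hd : HasDerivAt h c x) (hs : 0 < s0)
    (hle : ∀ r, 0 ≤ r → r ≤ s0 → h x - h (x - r) ≤ L * r) : c ≤ L := by
  have h1 := (hasDerivWithinAt_iff_tendsto_slope' (by simp)).1 (hd.hasDerivWithinAt (s := Iio x))
  refine le_of_tendsto h1 ?_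
  have : Ioo (x - s0) x ∈ 𝓝[<] x := Ioo_mem_nhdsLT (by linarith)
  filter_upwards [this] with s hs'
  rw [slope_def_field, ← neg_div_neg_eq, div_le_iff₀ (by linarith [hs'.2])]
  have := hle (x - s) (by linarith [hs'.2]) (by linarith [hs'.1])
  simp only [sub_sub_cancel] at this
  linarith

theorem lip_bd {ε : ℝ} (hε : 0 < ε) {Z a b f : ℝ × ℝ → ℝ} (hZ : Sm Om Z)
    (heq : ∀ p ∈ Om, dt Z p = a p * dx (dx Z) p + b p * dx Z p + f p)
    (ha : ∀ p ∈ Om, ε ≤ a p) (hb : Bd b) (hf : Bd f) (hZb : Bd Z) : Bd (dx Z) := by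
  intro δ T hδ
  have hδ2 : 0 < δ / 2 := by linarith
  obtain ⟨Kb, hKb⟩ := hb (δ / 2) T hδ2
  obtain ⟨Kf, hKf⟩ := hf (δ / 2) T hδ2
  obtain ⟨M, hM⟩ := hZb (δ / 2) T hδ2
  -- the bound for c = ±1
  have main : ∀ c : ℝ, |c| = 1 → ∃ L, ∀ x t, δ ≤ t → t ≤ T → c * dx Z (x, t) ≤ L := by
    intro c hc
    set F : ℝ × ℝ → ℝ := fun p => c * (p.2 - δ / 2) with hF
    have hFs : Sm Om F := by
      apply ContDiff.contDiffOn; fun_prop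
    set W : ℝ × ℝ → ℝ := fun p => F p * Z p with hW
    have hWs : Sm Om W := hFs.mul' hZ
    have hWx : ∀ p ∈ Om, dx W p = F p * dx Z p := by
      intro p hp
      rw [hW, dd_mul isOpen_Om hFs hZ hp, dd_lin]; simp
    have hWxx : ∀ p ∈ Om, dx (dx W) p = F p * dx (dx Z) p := by
      intro p hp
      rw [dd_congr isOpen_Om hWx hp, dd_mul isOpen_Om hFs (hZ.dd isOpen_Om _) hp, dd_lin]; simp
    have hWt : ∀ p ∈ Om, dt W p = c * Z p + F p * dt Z p := by
      intro p hp
      rw [hW, dd_mul isOpen_Om hFs hZ hp, dd_lin]; simp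
    have hFb : ∀ x t, δ / 2 ≤ t → t ≤ T → |F (x, t)| ≤ |T| := by
      intro x t h1 h2
      simp only [hF, abs_mul, hc, one_mul]
      rw [abs_of_nonneg (by linarith)]
      exact le_trans (by linarith) (le_abs_self T)
    set K := |Kb| + (|M| + |T| * |Kf|) with hK
    set m := (2 * K + 1) / (2 * ε) with hm
    set s0 := 1 / (2 * m) with hs0
    have hK0 : 0 ≤ K := by positivity
    have hmpos : 0 < m := by positivity
    have hs0pos : 0 < s0 := by positivity
    set L := max 1 (4 * (|T| * |M|) / s0) with hL
    have core := lip_core (ε := ε) (K := K) (M := |T| * |M|) (δ := δ / 2) (T := T) hε hδ2 (Z := W)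
      (a := a) (b := b) (f := fun p => c * Z p + F p * f p) hWs ?_ ?_ ?_ ?_ ?_ ?_ hm hs0
      (le_max_left _ _ : 1 ≤ L) ?_
    · refine ⟨L / (δ / 2), fun x t h1 h2 => ?_⟩
      have hp : (x, t) ∈ Om := lt_of_lt_of_le hδ h1
      have hd := hasDeriv_dx isOpen_Om hWs hp
      rw [hWx _ hp] at hd
      have h3 := deriv_le_of_left (L := L) hd hs0pos (fun r hr hr' => by
        refine (core x r t (by linarith) h2 hr hr').trans ?_
        have hL0 : 0 ≤ L := le_trans zero_le_one (le_max_left _ _)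
        have : r - m * r ^ 2 ≤ r := by have : 0 ≤ m * r ^ 2 := by positivity
                                       linarith
        exact mul_le_mul_of_nonneg_left this hL0)
      simp only [hF] at h3
      rw [le_div_iff₀ hδ2]
      by_cases hsg : 0 ≤ c * dx Z (x, t)
      · have : c * dx Z (x, t) * (δ / 2) ≤ c * dx Z (x, t) * (t - δ / 2) :=
          mul_le_mul_of_nonneg_left (by linarith) hsg
        linarith
      · push Not at hsg
        have : c * dx Z (x, t) * (δ / 2) ≤ 0 := mul_nonpos_of_nonpos_of_nonneg hsg.le hδ2.le
        have : 1 ≤ L := le_max_left _ _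
        linarith
    · intro x t h1 h2
      have hp : (x, t) ∈ Om := lt_of_lt_of_le hδ2 h1
      rw [hWt _ hp, hWxx _ hp, hWx _ hp, heq _ hp]; ring
    · exact fun x t h1 h2 => ha _ (lt_of_lt_of_le hδ2 h1)
    · intro x t h1 h2
      refine (hKb x t h1 h2).trans ((le_abs_self _).trans ?_)
      rw [hK]; have : 0 ≤ |M| + |T| * |Kf| := by positivity
      linarith
    · intro x t h1 h2
      have e1 : |c * Z (x, t)| ≤ |M| := by
        rw [abs_mul, hc, one_mul]; exact (hM x t h1 h2).trans (le_abs_self _)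
      have e2 : |F (x, t) * f (x, t)| ≤ |T| * |Kf| := by
        rw [abs_mul]
        exact mul_le_mul (hFb x t h1 h2) ((hKf x t h1 h2).trans (le_abs_self _)) (abs_nonneg _) (abs_nonneg _)
      have e3 := abs_add_le (c * Z (x, t)) (F (x, t) * f (x, t))
      have : 0 ≤ |Kb| := abs_nonneg _
      simp only [hK]
      linarith
    · intro x t h1 h2
      simp only [hW, abs_mul]
      exact mul_le_mul (hFb x t h1 h2) ((hM x t h1 h2).trans (le_abs_self _)) (abs_nonneg _) (abs_nonneg _)
    · intro x; simp [hW, hF]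
    · have : 4 * (|T| * |M|) / s0 ≤ L := le_max_right _ _
      rwa [div_le_iff₀ hs0pos] at this
  obtain ⟨L1, hL1⟩ := main 1 (by simp)
  obtain ⟨L2, hL2⟩ := main (-1) (by simp)
  refine ⟨max L1 L2, fun x t h1 h2 => abs_le.2 ⟨?_, ?_⟩⟩
  · have := hL2 x t h1 h2
    have := le_max_right L1 L2
    linarith
  · have := hL1 x t h1 h2
    have := le_max_left L1 L2
    linarith

abbrev R4 := ℝ × ℝ × ℝ × ℝ
def Om4 : Set R4 := {w | 0 < w.1}
theorem isOpen_Om4 : IsOpen Om4 := isOpen_lt continuous_const continuous_fst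

noncomputable def D4 (e : R4) (g : R4 → ℝ) : R4 → ℝ := fun w => fderiv ℝ g w e

theorem D4_smooth {g : R4 → ℝ} (hg : ContDiffOn ℝ ∞ g Om4) (e : R4) :
    ContDiffOn ℝ ∞ (D4 e g) Om4 := by
  have : ContDiffOn ℝ ∞ (fderiv ℝ g) Om4 := hg.fderiv_of_isOpen isOpen_Om4 (by simp)
  exact this.clm_apply contDiffOn_const

def Pm (A B C : ℝ × ℝ → ℝ) : ℝ × ℝ → R4 := fun p => (p.2, A p, B p, C p)

section
variable {A B C : ℝ × ℝ → ℝ} {g : R4 → ℝ}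

theorem Pm_mem {p : ℝ × ℝ} (hp : p ∈ Om) : Pm A B C p ∈ Om4 := hp

theorem Sm_comp (hA : Sm Om A) (hB : Sm Om B) (hC : Sm Om C) (hg : ContDiffOn ℝ ∞ g Om4) :
    Sm Om (fun p => g (Pm A B C p)) :=
  hg.comp (contDiffOn_snd.prodMk (hA.prodMk (hB.prodMk hC))) (fun _ hp => hp)

theorem dd_comp (hA : Sm Om A) (hB : Sm Om B) (hC : Sm Om C) (hg : ContDiffOn ℝ ∞ g Om4)
    {p : ℝ × ℝ} (hp : p ∈ Om) (e : ℝ × ℝ) :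
    dd e (fun p => g (Pm A B C p)) p =
      D4 (1,0,0,0) g (Pm A B C p) * e.2 + D4 (0,1,0,0) g (Pm A B C p) * dd e A p
      + D4 (0,0,1,0) g (Pm A B C p) * dd e B p + D4 (0,0,0,1) g (Pm A B C p) * dd e C p := by
  have h1 : HasFDerivAt (Pm A B C) ((ContinuousLinearMap.snd ℝ ℝ ℝ).prod ((fderiv ℝ A p).prod
      ((fderiv ℝ B p).prod (fderiv ℝ C p)))) p :=
    hasFDerivAt_snd.prodMk ((hA.diffAt isOpen_Om hp).hasFDerivAt.prodMk
      ((hB.diffAt isOpen_Om hp).hasFDerivAt.prodMk (hC.diffAt isOpen_Om hp).hasFDerivAt))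
  have h2 : DifferentiableAt ℝ g (Pm A B C p) :=
    (hg.differentiableOn (by simp)).differentiableAt (isOpen_Om4.mem_nhds hp)
  have h3 : HasFDerivAt (fun p => g (Pm A B C p)) _ p := h2.hasFDerivAt.comp p h1
  simp only [dd, D4, h3.fderiv]
  have : (fderiv ℝ g (Pm A B C p)) (e.2, fderiv ℝ A p e, fderiv ℝ B p e, fderiv ℝ C p e) =
    (fderiv ℝ g (Pm A B C p)) (e.2 • ((1,0,0,0) : R4) + (fderiv ℝ A p e) • ((0,1,0,0) : R4) +
      (fderiv ℝ B p e) • ((0,0,1,0) : R4) + (fderiv ℝ C p e) • ((0,0,0,1) : R4)) := by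
    congr 1; simp
  simp only [ContinuousLinearMap.comp_apply, ContinuousLinearMap.prod_apply, ContinuousLinearMap.coe_snd']
  rw [this]
  simp only [map_add, map_smul, smul_eq_mul]
  ring

theorem Bd_comp (hA : Bd A) (hB : Bd B) (hC : Bd C) (hg : ContDiffOn ℝ ∞ g Om4) :
    Bd (fun p => g (Pm A B C p)) := by
  intro δ T hδ
  obtain ⟨a, ha⟩ := hA δ T hδ
  obtain ⟨b, hb⟩ := hB δ T hδ
  obtain ⟨c, hc⟩ := hC δ T hδ
  have hS : IsCompact (Icc δ T ×ˢ Icc (-a) a ×ˢ Icc (-b) b ×ˢ Icc (-c) c) :=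
    isCompact_Icc.prod (isCompact_Icc.prod (isCompact_Icc.prod isCompact_Icc))
  obtain ⟨K, hK⟩ := hS.exists_bound_of_continuousOn
    (hg.continuousOn.mono (fun w hw => lt_of_lt_of_le hδ hw.1.1))
  exact ⟨K, fun x t h1 h2 => hK _ ⟨⟨h1, h2⟩, abs_le.1 (ha x t h1 h2), abs_le.1 (hb x t h1 h2),
    abs_le.1 (hc x t h1 h2)⟩⟩
end

structure LinHyp (ε : ℝ) (v a b c : ℝ × ℝ → ℝ) : Prop where
  eps : 0 < ε
  sv : Sm Om v
  sa : Sm Om a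
  sb : Sm Om b
  sc : Sm Om c
  ea : ∀ p ∈ Om, ε ≤ a p
  eq : ∀ p ∈ Om, dt v p = a p * dx (dx v) p + b p * dx v p + c p * v p
  bv : Bd v
  bvx : Bd (dx v)
  bvxx : Bd (dx (dx v))
  bvt : Bd (dt v)
  bvxt : Bd (dt (dx v))
  ba : Bd a
  bax : Bd (dx a)
  bat : Bd (dt a)
  bb : Bd b
  bc : Bd c

theorem linearize {ε : ℝ} (hε : 0 < ε) {g : R4 → ℝ} (hg : ContDiffOn ℝ ∞ g Om4)
    (hgq : ∀ w ∈ Om4, ε ≤ D4 (0,0,0,1) g w) {u : ℝ × ℝ → ℝ} (hu : Sm Om u)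
    (heq : ∀ p ∈ Om, dt u p = g (Pm u (dx u) (dx (dx u)) p))
    (bu : Bd u) (bv : Bd (dx u)) (bw : Bd (dx (dx u))) (bθ : Bd (dt u)) :
    ∃ a b c, LinHyp ε (dx u) a b c := by
  have O := isOpen_Om
  have hv : Sm Om (dx u) := hu.dd O _
  have hw : Sm Om (dx (dx u)) := hv.dd O _
  have hwx : Sm Om (dx (dx (dx u))) := hw.dd O _
  have hθ : Sm Om (dt u) := hu.dd O _
  set P := Pm u (dx u) (dx (dx u)) with hP
  have cs : ∀ h : R4 → ℝ, ContDiffOn ℝ ∞ h Om4 → Sm Om (fun p => h (P p)) :=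
    fun h hh => Sm_comp hu hv hw hh
  have cb : ∀ h : R4 → ℝ, ContDiffOn ℝ ∞ h Om4 → Bd (fun p => h (P p)) :=
    fun h hh => Bd_comp bu bv bw hh
  set g1 := D4 (1,0,0,0) g
  set g2 := D4 (0,1,0,0) g
  set g3 := D4 (0,0,1,0) g
  set g4 := D4 (0,0,0,1) g
  have s1 : ContDiffOn ℝ ∞ g1 Om4 := D4_smooth hg _
  have s2 : ContDiffOn ℝ ∞ g2 Om4 := D4_smooth hg _
  have s3 : ContDiffOn ℝ ∞ g3 Om4 := D4_smooth hg _
  have s4 : ContDiffOn ℝ ∞ g4 Om4 := D4_smooth hg _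
  -- time-derivative equation
  have com : ∀ {F : ℝ × ℝ → ℝ}, Sm Om F → ∀ p ∈ Om, dt (dx F) p = dx (dt F) p :=
    fun hF p hp => dd_comm O hF hp _ _
  have hvt : ∀ p ∈ Om, dt (dx u) p = dx (dt u) p := com hu
  have hwt : ∀ p ∈ Om, dt (dx (dx u)) p = dx (dx (dt u)) p := fun p hp => by
    rw [com hv p hp, dd_congr O hvt hp]
  have compx : ∀ h : R4 → ℝ, ContDiffOn ℝ ∞ h Om4 → ∀ p ∈ Om, dx (fun p => h (P p)) p =
      D4 (0,1,0,0) h (P p) * dx u p + D4 (0,0,1,0) h (P p) * dx (dx u) p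
      + D4 (0,0,0,1) h (P p) * dx (dx (dx u)) p := fun h hh p hp => by
    rw [hP, dd_comp hu hv hw hh hp]; simp
  have compt : ∀ h : R4 → ℝ, ContDiffOn ℝ ∞ h Om4 → ∀ p ∈ Om, dt (fun p => h (P p)) p =
      D4 (1,0,0,0) h (P p) + D4 (0,1,0,0) h (P p) * dt u p + D4 (0,0,1,0) h (P p) * dx (dt u) p
      + D4 (0,0,0,1) h (P p) * dx (dx (dt u)) p := fun h hh p hp => by
    rw [hP, dd_comp hu hv hw hh hp, hvt p hp, hwt p hp]; simp
  have eqθ : ∀ p ∈ Om, dt (dt u) p = g4 (P p) * dx (dx (dt u)) p + g3 (P p) * dx (dt u) p +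
      (g2 (P p) * dt u p + g1 (P p)) := fun p hp => by
    rw [dd_congr O heq hp, compt g hg p hp]; ring
  have bθx : Bd (dx (dt u)) := lip_bd hε hθ eqθ (fun p hp => hgq _ hp) (cb _ s3)
    (((cb _ s2).mul bθ).add (cb _ s1)) bθ
  have eqv : ∀ p ∈ Om, dt (dx u) p = g4 (P p) * dx (dx (dx u)) p + g3 (P p) * dx (dx u) p +
      g2 (P p) * dx u p := fun p hp => by
    rw [hvt p hp, dd_congr O heq hp, compx g hg p hp]; ring
  have bwx : Bd (dx (dx (dx u))) := by
    have bneg : Bd (fun _ => (-1 : ℝ)) := fun δ T _ => ⟨1, by simp⟩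
    have b1 : Bd (fun p => dx (dt u) p + (-1) * (g3 (P p) * dx (dx u) p + g2 (P p) * dx u p)) :=
      bθx.add (bneg.mul
        (((cb _ s3).mul bw).add ((cb _ s2).mul bv)))
    intro δ T hδ
    obtain ⟨K, hK⟩ := b1 δ T hδ
    refine ⟨K / ε, fun x t h1 h2 => ?_⟩
    have hp : (x, t) ∈ Om := lt_of_lt_of_le hδ h1
    have e1 := eqv _ hp
    rw [hvt _ hp] at e1
    have e2 : |dx (dt u) (x, t) + (-1) * (g3 (P (x, t)) * dx (dx u) (x, t) + g2 (P (x, t)) * dx u (x, t))| ≤ K := hK x t h1 h2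
    have e3 : dx (dt u) (x, t) + (-1) * (g3 (P (x, t)) * dx (dx u) (x, t) + g2 (P (x, t)) * dx u (x, t))
      = g4 (P (x, t)) * dx (dx (dx u)) (x, t) := by rw [e1]; ring
    rw [e3, abs_mul] at e2
    have e4 : ε ≤ |g4 (P (x, t))| := (hgq _ hp).trans (le_abs_self _)
    rw [le_div_iff₀ hε]
    calc _ ≤ |dx (dx (dx u)) (x, t)| * |g4 (P (x, t))| := by gcongr
      _ ≤ K := by linarith
  have cbx : ∀ h : R4 → ℝ, ContDiffOn ℝ ∞ h Om4 → Bd (dx (fun p => h (P p))) := fun h hh =>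
    ((((cb _ (D4_smooth hh _)).mul bv).add ((cb _ (D4_smooth hh _)).mul bw)).add
      ((cb _ (D4_smooth hh _)).mul bwx)).congr (compx h hh)
  -- second application
  have hθx : Sm Om (dx (dt u)) := hθ.dd O _
  have hθxx : Sm Om (dx (dx (dt u))) := hθx.dd O _
  have eqθx : ∀ p ∈ Om, dt (dx (dt u)) p = g4 (P p) * dx (dx (dx (dt u))) p +
      (dx (fun p => g4 (P p)) p + g3 (P p)) * dx (dx (dt u)) p +
      (dx (fun p => g3 (P p)) p * dx (dt u) p + (dx (fun p => g2 (P p)) p * dt u p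
        + g2 (P p) * dx (dt u) p + dx (fun p => g1 (P p)) p)) := fun p hp => by
    rw [com hθ p hp, dd_congr O eqθ hp]
    rw [dd_add O (((cs _ s4).mul' hθxx).add' ((cs _ s3).mul' hθx)) (((cs _ s2).mul' hθ).add' (cs _ s1)) hp,
      dd_add O ((cs _ s4).mul' hθxx) ((cs _ s3).mul' hθx) hp, dd_add O ((cs _ s2).mul' hθ) (cs _ s1) hp,
      dd_mul O (cs _ s4) hθxx hp, dd_mul O (cs _ s3) hθx hp, dd_mul O (cs _ s2) hθ hp]
    ring
  have bθxx : Bd (dx (dx (dt u))) := lip_bd hε hθx eqθx (fun p hp => hgq _ hp)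
    ((cbx _ s4).add (cb _ s3))
    (((cbx _ s3).mul bθx).add ((((cbx _ s2).mul bθ).add ((cb _ s2).mul bθx)).add (cbx _ s1))) bθx
  have cbt : ∀ h : R4 → ℝ, ContDiffOn ℝ ∞ h Om4 → Bd (dt (fun p => h (P p))) := fun h hh =>
    ((((cb _ (D4_smooth hh _)).add ((cb _ (D4_smooth hh _)).mul bθ)).add
      ((cb _ (D4_smooth hh _)).mul bθx)).add
      ((cb _ (D4_smooth hh _)).mul bθxx)).congr (compt h hh)
  exact ⟨fun p => g4 (P p), fun p => g3 (P p), fun p => g2 (P p),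
    { eps := hε, sv := hv, sa := cs _ s4, sb := cs _ s3, sc := cs _ s2
      ea := fun p hp => hgq _ hp
      eq := eqv
      bv := bv, bvx := bw, bvxx := bwx, bvt := bθx.congr hvt, bvxt := bθxx.congr hwt
      ba := cb _ s4, bax := cbx _ s4, bat := cbt _ s4, bb := cb _ s3, bc := cb _ s2 }⟩

def St (s1 s2 : ℝ) : Set (ℝ × ℝ) := {p | s1 < p.2 ∧ p.2 < s2}
theorem isOpen_St (s1 s2 : ℝ) : IsOpen (St s1 s2) :=
  (isOpen_lt continuous_const continuous_snd).inter (isOpen_lt continuous_snd continuous_const)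

/-- growth condition -/
def Bo (s1 s2 : ℝ) (j : ℕ) (F : ℝ × ℝ → ℝ) : Prop :=
  ∃ K, 0 ≤ K ∧ ∀ p ∈ St s1 s2, |F p| ≤ K * (1 + |p.1|) ^ j

section
variable {s1 s2 : ℝ} {i j : ℕ} {F F' : ℝ × ℝ → ℝ}

theorem Bo.mul (h : Bo s1 s2 i F) (h' : Bo s1 s2 j F') : Bo s1 s2 (i + j) (fun p => F p * F' p) := by
  obtain ⟨K, hK, h⟩ := h
  obtain ⟨K', hK', h'⟩ := h'
  refine ⟨K * K', mul_nonneg hK hK', fun p hp => ?_⟩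
  rw [abs_mul, pow_add]
  calc |F p| * |F' p| ≤ (K * (1 + |p.1|) ^ i) * (K' * (1 + |p.1|) ^ j) :=
        mul_le_mul (h p hp) (h' p hp) (abs_nonneg _) (by positivity)
    _ = _ := by ring

theorem Bo.add (h : Bo s1 s2 j F) (h' : Bo s1 s2 j F') : Bo s1 s2 j (fun p => F p + F' p) := by
  obtain ⟨K, hK, h⟩ := h
  obtain ⟨K', hK', h'⟩ := h'
  refine ⟨K + K', add_nonneg hK hK', fun p hp => ?_⟩
  calc |F p + F' p| ≤ |F p| + |F' p| := abs_add_le _ _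
    _ ≤ _ := by linarith [h p hp, h' p hp]

theorem Bo.mono (h : Bo s1 s2 i F) (hij : i ≤ j) : Bo s1 s2 j F := by
  obtain ⟨K, hK, h⟩ := h
  refine ⟨K, hK, fun p hp => (h p hp).trans ?_⟩
  have : (1 : ℝ) ≤ 1 + |p.1| := by linarith [abs_nonneg p.1]
  gcongr

theorem Bo.congr (h : Bo s1 s2 j F) (e : ∀ p ∈ St s1 s2, F' p = F p) : Bo s1 s2 j F' := by
  obtain ⟨K, hK, h⟩ := h
  exact ⟨K, hK, fun p hp => by rw [e p hp]; exact h p hp⟩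

theorem Bo.const (c : ℝ) : Bo s1 s2 0 (fun _ => c) := ⟨|c|, abs_nonneg _, fun p _ => by simp⟩
end

structure Wt (s1 s2 : ℝ) (G β g : ℝ × ℝ → ℝ) : Prop where
  sG : Sm (St s1 s2) G
  sβ : Sm (St s1 s2) β
  sg : Sm (St s1 s2) g
  pos : ∀ p ∈ St s1 s2, 0 < G p
  dec : ∃ K, 0 ≤ K ∧ ∀ p ∈ St s1 s2, G p ≤ K * ((1 + p.1 ^ 2) ^ 2)⁻¹
  Gx : ∀ p ∈ St s1 s2, dx G p = g p * G p
  Gt : ∀ p ∈ St s1 s2, dt G p = -(dx β p + β p * g p) * G p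
  bβ : Bo s1 s2 1 β
  bg : Bo s1 s2 1 g
  bβx : Bo s1 s2 0 (dx β)

structure Fd (s1 s2 : ℝ) (f a : ℝ × ℝ → ℝ) : Prop where
  sf : Sm (St s1 s2) f
  sa : Sm (St s1 s2) a
  bf : Bo s1 s2 0 f
  bfx : Bo s1 s2 0 (dx f)
  bft : Bo s1 s2 0 (dt f)
  bfxx : Bo s1 s2 0 (dx (dx f))
  bfxt : Bo s1 s2 0 (dt (dx f))
  ba : Bo s1 s2 0 a
  bax : Bo s1 s2 0 (dx a)
  bat : Bo s1 s2 0 (dt a)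

section
variable {s1 s2 : ℝ} {G β g : ℝ × ℝ → ℝ}

theorem Wt.dom (W : Wt s1 s2 G β g) {P : ℝ × ℝ → ℝ} (hP : Bo s1 s2 2 P) :
    ∃ K, 0 ≤ K ∧ ∀ p ∈ St s1 s2, |P p * G p| ≤ K * (1 + p.1 ^ 2)⁻¹ := by
  obtain ⟨K, hK, h⟩ := hP
  obtain ⟨K', hK', h'⟩ := W.dec
  refine ⟨2 * K * K', by positivity, fun p hp => ?_⟩
  rw [abs_mul, abs_of_pos (W.pos p hp)]
  have h1 : (1 + |p.1|) ^ 2 ≤ 2 * (1 + p.1 ^ 2) := by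
    have := sq_abs p.1
    nlinarith [sq_nonneg (1 - |p.1|)]
  have h0 : 0 < 1 + p.1 ^ 2 := by positivity
  calc |P p| * G p ≤ (K * (2 * (1 + p.1 ^ 2))) * (K' * ((1 + p.1 ^ 2) ^ 2)⁻¹) := by
        apply mul_le_mul _ (h' p hp) (W.pos p hp).le (by positivity)
        exact (h p hp).trans (by gcongr)
    _ = _ := by field_simp

theorem Wt.int (W : Wt s1 s2 G β g) {P : ℝ × ℝ → ℝ} (hP : Bo s1 s2 2 P) (hs : Sm (St s1 s2) P)
    {t : ℝ} (h1 : s1 < t) (h2 : t < s2) : Integrable (fun x => P (x, t) * G (x, t)) := by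
  obtain ⟨K, hK, h⟩ := W.dom hP
  refine (integrable_inv_one_add_sq.const_mul K).mono' ?_ (.of_forall fun x => h (x, t) ⟨h1, h2⟩)
  exact ((hs.cont_x (fun x => ⟨h1, h2⟩)).mul (W.sG.cont_x (fun x => ⟨h1, h2⟩))).aestronglyMeasurable

theorem Wt.ibp (W : Wt s1 s2 G β g) {P : ℝ × ℝ → ℝ} (hs : Sm (St s1 s2) P) (hP : Bo s1 s2 1 P)
    (hPx : Bo s1 s2 2 (dx P)) {t : ℝ} (h1 : s1 < t) (h2 : t < s2) :
    ∫ x, (dx P (x, t) + P (x, t) * g (x, t)) * G (x, t) = 0 := by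
  have O := isOpen_St s1 s2
  refine integral_eq_zero_of_hasDerivAt_of_integrable (f := fun x => P (x, t) * G (x, t)) (fun x => ?_) ?_ ?_
  · have d := (hasDeriv_dx O hs (show (x, t) ∈ St s1 s2 from ⟨h1, h2⟩)).mul
      (hasDeriv_dx O W.sG (show (x, t) ∈ St s1 s2 from ⟨h1, h2⟩))
    rw [W.Gx _ ⟨h1, h2⟩] at d
    exact d.congr_deriv (by ring)
  · exact W.int (P := fun p => dx P p + P p * g p) (hPx.add (hP.mul W.bg))
      ((hs.dd O _).add' (hs.mul' W.sg)) h1 h2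
  · exact W.int (hP.mono (by norm_num)) hs h1 h2

theorem Wt.deriv (W : Wt s1 s2 G β g) {P : ℝ × ℝ → ℝ} (hs : Sm (St s1 s2) P) (hP : Bo s1 s2 0 P)
    (hPx : Bo s1 s2 0 (dx P)) (hPt : Bo s1 s2 0 (dt P)) {t : ℝ} (h1 : s1 < t) (h2 : t < s2) :
    HasDerivAt (fun s => ∫ x, P (x, s) * G (x, s))
      (∫ x, (dt P (x, t) + β (x, t) * dx P (x, t)) * G (x, t)) t := by
  have O := isOpen_St s1 s2
  set Q : ℝ × ℝ → ℝ := fun p => dt P p + (-1) * (P p * (dx β p + β p * g p)) with hQ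
  have bQ : Bo s1 s2 2 Q := (hPt.mono (by norm_num)).add
    (((Bo.const (-1)).mul (hP.mul ((W.bβx.mono (by norm_num : 0 ≤ 2)).add (W.bβ.mul W.bg)))))
  have sQ : Sm (St s1 s2) Q := (hs.dd O _).add' (contDiffOn_const.mul (hs.mul' ((W.sβ.dd O _).add' (W.sβ.mul' W.sg))))
  obtain ⟨K, hK, hd⟩ := W.dom bQ
  have key := hasDerivAt_integral_of_dominated_loc_of_deriv_le (μ := volume) (s := Ioo s1 s2)
    (F := fun s x => P (x, s) * G (x, s)) (F' := fun s x => Q (x, s) * G (x, s)) (x₀ := t)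
    (bound := fun x => K * (1 + x ^ 2)⁻¹) (Ioo_mem_nhds h1 h2)
    (by
      filter_upwards [Ioo_mem_nhds h1 h2] with s hs'
      exact (W.int (hP.mono (by norm_num)) hs hs'.1 hs'.2).aestronglyMeasurable)
    (W.int (hP.mono (by norm_num)) hs h1 h2)
    (W.int bQ sQ h1 h2).aestronglyMeasurable
    (.of_forall fun x s hs' => hd (x, s) hs')
    (integrable_inv_one_add_sq.const_mul K)
    (.of_forall fun x s hs' => by
      have d := (hasDeriv_dt O hs (show (x, s) ∈ St s1 s2 from hs')).mul
        (hasDeriv_dt O W.sG (show (x, s) ∈ St s1 s2 from hs'))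
      rw [W.Gt _ hs'] at d
      exact d.congr_deriv (by simp only [hQ]; ring))
  refine key.2.congr_deriv ?_
  have hβP : ∀ p ∈ St s1 s2, dx (fun p => β p * P p) p = dx β p * P p + β p * dx P p :=
    fun p hp => dd_mul O W.sβ hs hp _
  have bβP : Bo s1 s2 1 (dx (fun p => β p * P p)) :=
    (((W.bβx.mul hP).mono (by norm_num)).add (W.bβ.mul hPx)).congr hβP
  have ib := W.ibp (P := fun p => β p * P p) (W.sβ.mul' hs) (W.bβ.mul hP) (bβP.mono (by norm_num)) h1 h2
  have i2 := W.int (P := fun p => dx (fun p => β p * P p) p + (β p * P p) * g p)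
    ((bβP.mono (by norm_num)).add ((W.bβ.mul hP).mul W.bg))
    (((W.sβ.mul' hs).dd O _).add' ((W.sβ.mul' hs).mul' W.sg)) h1 h2
  have := integral_add (W.int bQ sQ h1 h2) i2
  beta_reduce at this ib
  rw [ib, add_zero] at this
  rw [← this]
  congr 1
  ext x
  rw [hβP _ ⟨h1, h2⟩]
  simp only [hQ]; ring

theorem iadd {f g : ℝ → ℝ} (hf : Integrable f) (hg : Integrable g) :
    Integrable (fun x => f x + g x) := hf.add hg

theorem freq (W : Wt s1 s2 G β g) {f a X B γ : ℝ × ℝ → ℝ} (D : Fd s1 s2 f a)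
    (hX : ∀ p ∈ St s1 s2, X p = dt f p + β p * dx f p)
    (hB : ∀ p ∈ St s1 s2, B p = X p - (dx a p * dx f p + a p * dx (dx f) p + a p * dx f p * g p))
    (hγ : ∀ p ∈ St s1 s2, γ p = dt a p + β p * dx a p - 2 * a p * dx β p)
    {t : ℝ} (h1 : s1 < t) (h2 : t < s2) :
    ∃ H' E', HasDerivAt (fun s => ∫ x, f (x, s) ^ 2 * G (x, s)) H' t ∧
      HasDerivAt (fun s => ∫ x, (a (x, s) * dx f (x, s) ^ 2) * G (x, s)) E' t ∧
      Integrable (fun x => f (x, t) ^ 2 * G (x, t)) ∧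
      Integrable (fun x => (a (x, t) * dx f (x, t) ^ 2) * G (x, t)) ∧
      Integrable (fun x => B (x, t) ^ 2 * G (x, t)) ∧
      Integrable (fun x => (γ (x, t) * dx f (x, t) ^ 2) * G (x, t)) ∧
      E' * (∫ x, f (x, t) ^ 2 * G (x, t)) - (∫ x, (a (x, t) * dx f (x, t) ^ 2) * G (x, t)) * H' ≤
        (∫ x, f (x, t) ^ 2 * G (x, t)) * ((∫ x, (γ (x, t) * dx f (x, t) ^ 2) * G (x, t))
          + (∫ x, B (x, t) ^ 2 * G (x, t)) / 2) ∧
      ∀ η > 0, |H' + 2 * (∫ x, (a (x, t) * dx f (x, t) ^ 2) * G (x, t))| ≤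
        (∫ x, f (x, t) ^ 2 * G (x, t)) / η + η * ∫ x, B (x, t) ^ 2 * G (x, t) := by
  have O := isOpen_St s1 s2
  have sfx : Sm (St s1 s2) (dx f) := D.sf.dd O _
  have sft : Sm (St s1 s2) (dt f) := D.sf.dd O _
  have sfxx : Sm (St s1 s2) (dx (dx f)) := sfx.dd O _
  have sX : Sm (St s1 s2) X := (sft.add' (W.sβ.mul' sfx)).congr hX
  have bX : Bo s1 s2 1 X := ((D.bft.mono (by norm_num)).add (W.bβ.mul D.bfx)).congr hX
  set L : ℝ × ℝ → ℝ := fun p => dx a p * dx f p + a p * dx (dx f) p + a p * dx f p * g p with hL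
  have sL : Sm (St s1 s2) L := ((((D.sa.dd O _).mul' sfx).add' (D.sa.mul' sfxx)).add' ((D.sa.mul' sfx).mul' W.sg))
  have bL : Bo s1 s2 1 L := (((D.bax.mul D.bfx).mono (by norm_num)).add
    ((D.ba.mul D.bfxx).mono (by norm_num))).add ((D.ba.mul D.bfx).mul W.bg)
  have sB : Sm (St s1 s2) B := (ContDiffOn.sub sX sL).congr hB
  have bB : Bo s1 s2 1 B := (bX.add ((Bo.const (-1)).mul bL)).congr (fun p hp => by
    rw [hB p hp]; simp only [hL]; ring)
  have sγ : Sm (St s1 s2) γ := by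
    refine ContDiffOn.congr ?_ hγ
    exact ContDiffOn.sub ((D.sa.dd O _).add' (W.sβ.mul' (D.sa.dd O _)))
      ((contDiffOn_const.mul D.sa).mul (W.sβ.dd O _))
  have bγ : Bo s1 s2 1 γ := by
    refine Bo.congr (((D.bat.mono (by norm_num)).add (W.bβ.mul D.bax)).add
      ((((Bo.const (-2)).mul (D.ba.mul W.bβx))).mono (by norm_num))) (fun p hp => ?_)
    rw [hγ p hp]; ring
  have s2f : ∀ {P : ℝ × ℝ → ℝ}, Sm (St s1 s2) P → Sm (St s1 s2) (fun p => P p ^ 2) := fun h =>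
    ContDiffOn.pow h 2
  -- integrability
  have bsq : ∀ {j : ℕ} {P : ℝ × ℝ → ℝ}, Bo s1 s2 j P → Bo s1 s2 (j + j) (fun p => P p ^ 2) :=
    fun h => (h.mul h).congr (fun p _ => by ring)
  have iff' := W.int ((bsq D.bf).mono (by norm_num)) (s2f D.sf) h1 h2
  have ifX := W.int ((D.bf.mul bX).mono (by norm_num)) (D.sf.mul' sX) h1 h2
  have ifB := W.int ((D.bf.mul bB).mono (by norm_num)) (D.sf.mul' sB) h1 h2
  have iXX := W.int (bsq bX) (s2f sX) h1 h2
  have iBB := W.int (bsq bB) (s2f sB) h1 h2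
  have iXB := W.int (bX.mul bB) (sX.mul' sB) h1 h2
  have ie := W.int ((D.ba.mul (bsq D.bfx)).mono (by norm_num)) (D.sa.mul' (s2f sfx)) h1 h2
  have iγ := W.int ((bγ.mul (bsq D.bfx)).mono (by norm_num)) (sγ.mul' (s2f sfx)) h1 h2
  beta_reduce at iff' ifX ifB iXX iBB iXB ie iγ
  have hL' : ∀ x, L (x, t) = X (x, t) - B (x, t) := fun x => by rw [hB _ ⟨h1, h2⟩]; simp [hL]
  have bsx : ∀ {P : ℝ × ℝ → ℝ}, Sm (St s1 s2) P → ∀ e, ∀ p ∈ St s1 s2,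
      dd e (fun p => P p ^ 2) p = 2 * (P p * dd e P p) := fun {P} h e p hp => by
    have := dd_mul O h h hp e
    simp only [pow_two]; rw [this]; ring
  -- H'
  have dH := W.deriv (s2f D.sf) (bsq D.bf) (((Bo.const 2).mul (D.bf.mul D.bfx)).congr (bsx D.sf _))
    (((Bo.const 2).mul (D.bf.mul D.bft)).congr (bsx D.sf _)) h1 h2
  have eH : (∫ x, (dt (fun p => f p ^ 2) (x, t) + β (x, t) * dx (fun p => f p ^ 2) (x, t)) * G (x, t))
      = 2 * ∫ x, f (x, t) * X (x, t) * G (x, t) := by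
    rw [← integral_const_mul]
    congr 1; ext x
    rw [bsx D.sf _ _ ⟨h1, h2⟩, bsx D.sf _ _ ⟨h1, h2⟩, hX _ ⟨h1, h2⟩]; ring
  rw [eH] at dH
  -- E
  have safx : Sm (St s1 s2) (fun p => a p * dx f p) := D.sa.mul' sfx
  have dafx : ∀ p ∈ St s1 s2, dx (fun p => a p * dx f p) p = dx a p * dx f p + a p * dx (dx f) p :=
    fun p hp => dd_mul O D.sa sfx hp _
  have bafx : Bo s1 s2 0 (dx (fun p => a p * dx f p)) :=
    ((D.bax.mul D.bfx).add (D.ba.mul D.bfxx)).congr dafx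
  have parts : ∀ {Z : ℝ × ℝ → ℝ}, Sm (St s1 s2) Z → Bo s1 s2 1 Z → Bo s1 s2 2 (dx Z) →
      ∫ x, (a (x, t) * dx f (x, t) * dx Z (x, t)) * G (x, t) =
       - ∫ x, Z (x, t) * (X (x, t) - B (x, t)) * G (x, t) := by
    intro Z sZ bZ bZx
    have e := fun (p : ℝ × ℝ) (hp : p ∈ St s1 s2) => dd_mul O sZ safx hp ((1 : ℝ), (0 : ℝ))
    have ib := W.ibp (P := fun p => Z p * (a p * dx f p)) (sZ.mul' safx) (bZ.mul (D.ba.mul D.bfx))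
      (((bZx.mul (D.ba.mul D.bfx)).add ((bZ.mul bafx).mono (by norm_num))).congr e) h1 h2
    have i1 := W.int (P := fun p => a p * dx f p * dx Z p) (((D.ba.mul D.bfx).mul bZx))
      (safx.mul' (sZ.dd O _)) h1 h2
    have i2 := W.int (P := fun p => Z p * L p) ((bZ.mul bL)) (sZ.mul' sL) h1 h2
    have i12 := integral_add i1 i2
    have : (∫ x, a (x, t) * dx f (x, t) * dx Z (x, t) * G (x, t) + Z (x, t) * L (x, t) * G (x, t)) = 0 := by
      refine Eq.trans ?_ ib; congr 1; ext x
      rw [e _ ⟨h1, h2⟩, dafx _ ⟨h1, h2⟩]; simp only [hL]; ring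
    beta_reduce at i12
    rw [this] at i12
    simp only [hL'] at i12
    linarith
  have eE := parts D.sf (D.bf.mono (by norm_num)) (D.bfx.mono (by norm_num))
  have eE1 : ∫ x, (a (x, t) * dx f (x, t) ^ 2) * G (x, t) =
      - ((∫ x, f (x, t) * X (x, t) * G (x, t)) - ∫ x, f (x, t) * B (x, t) * G (x, t)) := by
    rw [← integral_sub ifX ifB]
    calc _ = ∫ x, (a (x, t) * dx f (x, t) * dx f (x, t)) * G (x, t) := by congr 1; ext x; ring
      _ = _ := by rw [eE]; congr 2; ext x; ring
  -- E'
  have dXx : ∀ p ∈ St s1 s2, dx X p = dt (dx f) p + (dx β p * dx f p + β p * dx (dx f) p) := fun p hp => by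
    rw [dd_congr O hX hp, dd_add O sft (W.sβ.mul' sfx) hp, dd_mul O W.sβ sfx hp, dd_comm O D.sf hp]
  have bXx : Bo s1 s2 1 (dx X) := Bo.congr ((D.bfxt.mono (by norm_num)).add
    (((W.bβx.mul D.bfx).mono (by norm_num)).add (W.bβ.mul D.bfxx))) dXx
  have eX := parts sX bX (bXx.mono (by norm_num))
  have dP : ∀ e, ∀ p ∈ St s1 s2, dd e (fun p => a p * dx f p ^ 2) p =
      dd e a p * dx f p ^ 2 + a p * (2 * (dx f p * dd e (dx f) p)) := fun e p hp => by
    rw [dd_mul O D.sa (s2f sfx) hp, bsx sfx e p hp]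
  have dE := W.deriv (P := fun p => a p * dx f p ^ 2) (D.sa.mul' (s2f sfx)) (D.ba.mul (bsq D.bfx))
    (Bo.congr ((D.bax.mul (bsq D.bfx)).add (D.ba.mul ((Bo.const 2).mul (D.bfx.mul D.bfxx)))) (dP _))
    (Bo.congr ((D.bat.mul (bsq D.bfx)).add (D.ba.mul ((Bo.const 2).mul (D.bfx.mul D.bfxt)))) (dP _)) h1 h2
  have iaX := W.int (P := fun p => a p * dx f p * dx X p) (((D.ba.mul D.bfx).mul bXx).mono (by norm_num))
      (safx.mul' (sX.dd O _)) h1 h2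
  have eE' : (∫ x, (dt (fun p => a p * dx f p ^ 2) (x, t) + β (x, t) * dx (fun p => a p * dx f p ^ 2) (x, t)) * G (x, t))
      = (∫ x, (γ (x, t) * dx f (x, t) ^ 2) * G (x, t)) - 2 * ((∫ x, X (x, t) ^ 2 * G (x, t))
        - ∫ x, X (x, t) * B (x, t) * G (x, t)) := by
    have q1 : (∫ x, X (x, t) ^ 2 * G (x, t)) - (∫ x, X (x, t) * B (x, t) * G (x, t)) =
       - ∫ x, (a (x, t) * dx f (x, t) * dx X (x, t)) * G (x, t) := by
      rw [eX, ← integral_sub iXX iXB, neg_neg]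
      congr 1; ext x; ring
    rw [q1, mul_neg, sub_neg_eq_add, ← integral_const_mul, ← integral_add iγ (iaX.const_mul 2)]
    congr 1; ext x
    rw [dP _ _ ⟨h1, h2⟩, dP _ _ ⟨h1, h2⟩, hγ _ ⟨h1, h2⟩, dXx _ ⟨h1, h2⟩]; ring
  rw [eE'] at dE
  -- Cauchy-Schwarz type inequalities
  set hf := ∫ x, f (x, t) ^ 2 * G (x, t)
  set fX := ∫ x, f (x, t) * X (x, t) * G (x, t)
  set fB := ∫ x, f (x, t) * B (x, t) * G (x, t)
  set XX := ∫ x, X (x, t) ^ 2 * G (x, t)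
  set XB := ∫ x, X (x, t) * B (x, t) * G (x, t)
  set BB := ∫ x, B (x, t) ^ 2 * G (x, t)
  have gp : ∀ x, 0 ≤ G (x, t) := fun x => (W.pos _ ⟨h1, h2⟩).le
  have cs1 : ∀ s : ℝ, 0 ≤ hf * (s * s) + (2 * fX - fB) * s + (XX - XB + BB / 4) := by
    intro s
    have : 0 ≤ ∫ x, (s * f (x, t) + X (x, t) - B (x, t) / 2) ^ 2 * G (x, t) :=
      integral_nonneg fun x => mul_nonneg (sq_nonneg _) (gp x)
    refine this.trans_eq ?_
    have e : ∀ x, (s * f (x, t) + X (x, t) - B (x, t) / 2) ^ 2 * G (x, t) =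
      (s * s) * (f (x, t) ^ 2 * G (x, t)) + ((2 * s) * (f (x, t) * X (x, t) * G (x, t)) +
      ((-s) * (f (x, t) * B (x, t) * G (x, t)) + (X (x, t) ^ 2 * G (x, t) +
      ((-1) * (X (x, t) * B (x, t) * G (x, t)) + (1/4) * (B (x, t) ^ 2 * G (x, t)))))) := fun x => by ring
    simp only [e]
    have j1 := iadd (iXB.const_mul (-1)) (iBB.const_mul (1 / 4))
    have j2 := iadd iXX j1
    have j3 := iadd (ifB.const_mul (-s)) j2
    have j4 := iadd (ifX.const_mul (2 * s)) j3
    rw [integral_add (iff'.const_mul (s * s)) j4, integral_add (ifX.const_mul (2 * s)) j3,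
      integral_add (ifB.const_mul (-s)) j2, integral_add iXX j1,
      integral_add (iXB.const_mul (-1)) (iBB.const_mul (1 / 4))]
    simp only [integral_const_mul]
    ring
  have cs2 : ∀ s : ℝ, 0 ≤ hf + 2 * s * fB + s ^ 2 * BB := by
    intro s
    have : 0 ≤ ∫ x, (f (x, t) + s * B (x, t)) ^ 2 * G (x, t) :=
      integral_nonneg fun x => mul_nonneg (sq_nonneg _) (gp x)
    refine this.trans_eq ?_
    have e : ∀ x, (f (x, t) + s * B (x, t)) ^ 2 * G (x, t) =
      (f (x, t) ^ 2 * G (x, t)) + ((2 * s) * (f (x, t) * B (x, t) * G (x, t)) +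
      (s ^ 2) * (B (x, t) ^ 2 * G (x, t))) := fun x => by ring
    simp only [e]
    rw [integral_add iff' (iadd (ifB.const_mul (2 * s)) (iBB.const_mul (s ^ 2))),
      integral_add (ifB.const_mul (2 * s)) (iBB.const_mul (s ^ 2))]
    simp only [integral_const_mul]
    ring
  have hd := discrim_le_zero cs1
  rw [discrim] at hd
  refine ⟨_, _, dH, dE, iff', ie, iBB, iγ, ?_, ?_⟩
  · rw [eE1]
    have := sq_nonneg fB
    clear_value hf fX fB XX XB BB
    have e : (2 * fX - fB) ^ 2 = 4 * fX ^ 2 - 4 * (fX * fB) + fB ^ 2 := by ring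
    ring_nf at hd this ⊢
    linarith
  · intro η hη
    rw [eE1]
    have c1 := cs2 η
    have c2 := cs2 (-η)
    have : 2 * fX + 2 * -(fX - fB) = 2 * fB := by ring
    rw [this, abs_le]
    have e : hf / η + η * BB = (hf + η ^ 2 * BB) / η := by field_simp
    rw [e]
    constructor
    · rw [neg_le, le_div_iff₀ hη]; linarith
    · rw [le_div_iff₀ hη]; linarith
end

theorem ode_uniq {H E : ℝ → ℝ} {K s1 s2 : ℝ} (hK : 0 ≤ K) (hH : ∀ t ∈ Ioo s1 s2, 0 ≤ H t)
    (hE : ∀ t ∈ Ioo s1 s2, 0 ≤ E t)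
    (hd : ∀ t ∈ Ioo s1 s2, ∃ H' E', HasDerivAt H H' t ∧ HasDerivAt E E' t ∧
      E' * H t - E t * H' ≤ K * (H t * (H t + E t)) ∧ |H' + 2 * E t| ≤ K * H t + E t)
    {t1 t0 : ℝ} (h1 : t1 ∈ Ioo s1 s2) (h0 : t0 ∈ Ioo s1 s2) (hz : H t0 = 0) : H t1 = 0 := by
  choose! H' E' dH dE i1 i2 using hd
  have hexp : ∀ c t : ℝ, HasDerivAt (fun s => Real.exp (c * s)) (Real.exp (c * t) * c) t := fun c t => by
    have := ((hasDerivAt_id t).const_mul c).exp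
    simpa using this
  rcases le_total t0 t1 with h | h
  · -- forward
    have sub : Icc t0 t1 ⊆ Ioo s1 s2 := fun t ht => ⟨h0.1.trans_le ht.1, ht.2.trans_lt h1.2⟩
    have d : ∀ t ∈ Ioo s1 s2, HasDerivAt (fun s => H s * Real.exp (-K * s))
      (H' t * Real.exp (-K * t) + H t * (Real.exp (-K * t) * (-K))) t := fun t ht =>
      (dH t ht).mul (hexp (-K) t)
    have anti : AntitoneOn (fun s => H s * Real.exp (-K * s)) (Icc t0 t1) := by
      refine antitoneOn_of_hasDerivWithinAt_nonpos (convex_Icc _ _)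
        (fun t ht => (d t (sub ht)).continuousAt.continuousWithinAt)
        (fun t ht => (d t (sub (interior_subset ht))).hasDerivWithinAt) (fun t ht => ?_)
      have ht := sub (interior_subset ht)
      have e1 := (abs_le.1 (i2 t ht)).2
      have e2 := hE t ht
      have : H' t * Real.exp (-K * t) + H t * (Real.exp (-K * t) * (-K)) =
        (H' t - K * H t) * Real.exp (-K * t) := by ring
      rw [this]
      exact mul_nonpos_of_nonpos_of_nonneg (by linarith) (Real.exp_pos _).le
    have := anti (left_mem_Icc.2 h) (right_mem_Icc.2 h) h
    simp only [hz, zero_mul] at this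
    have e3 := nonpos_of_mul_nonpos_left this (Real.exp_pos _)
    exact le_antisymm e3 (hH t1 h1)
  · -- backward
    by_contra hne
    have hpos : 0 < H t1 := lt_of_le_of_ne (hH t1 h1) (Ne.symm hne)
    have sub : Icc t1 t0 ⊆ Ioo s1 s2 := fun t ht => ⟨h1.1.trans_le ht.1, ht.2.trans_lt h0.2⟩
    have hc : ContinuousOn H (Icc t1 t0) := fun t ht => (dH t (sub ht)).continuousAt.continuousWithinAt
    set Z : Set ℝ := Icc t1 t0 ∩ H ⁻¹' {0} with hZ
    have hZc : IsCompact Z := isCompact_Icc.of_isClosed_subset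
      (hc.preimage_isClosed_of_isClosed isClosed_Icc isClosed_singleton) inter_subset_left
    have hZn : Z.Nonempty := ⟨t0, right_mem_Icc.2 h, hz⟩
    set ts := sInf Z with hts
    have hm : ts ∈ Z := hZc.sInf_mem hZn
    have hlt : t1 < ts := lt_of_le_of_ne hm.1.1 (fun e => hne (by rw [e]; exact hm.2))
    have sub2 : Icc t1 ts ⊆ Ioo s1 s2 := (Icc_subset_Icc_right hm.1.2).trans sub
    have Hp : ∀ t ∈ Ico t1 ts, 0 < H t := fun t ht => by
      refine lt_of_le_of_ne (hH t (sub2 (Ico_subset_Icc_self ht))) (fun e => ?_)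
      have : t ∈ Z := ⟨⟨ht.1, ht.2.le.trans hm.1.2⟩, e.symm⟩
      exact absurd (csInf_le hZc.bddBelow this) (not_le.2 ht.2)
    -- frequency
    have dN : ∀ t ∈ Ico t1 ts, HasDerivAt (fun s => (E s + H s) / H s * Real.exp (-K * s))
        (((E' t + H' t) * H t - (E t + H t) * H' t) / H t ^ 2 * Real.exp (-K * t)
          + (E t + H t) / H t * (Real.exp (-K * t) * (-K))) t := fun t ht =>
      have hs := sub2 (Ico_subset_Icc_self ht)
      (((dE t hs).add (dH t hs)).div (dH t hs) (Hp t ht).ne').mul (hexp (-K) t)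
    have antiN : AntitoneOn (fun s => (E s + H s) / H s * Real.exp (-K * s)) (Ico t1 ts) := by
      refine antitoneOn_of_hasDerivWithinAt_nonpos (convex_Ico _ _)
        (fun t ht => (dN t ht).continuousAt.continuousWithinAt)
        (fun t ht => (dN t (interior_subset ht)).hasDerivWithinAt) (fun t ht => ?_)
      have ht := interior_subset ht
      have hp := Hp t ht
      have j1 := i1 t (sub2 (Ico_subset_Icc_self ht))
      have : ((E' t + H' t) * H t - (E t + H t) * H' t) / H t ^ 2 * Real.exp (-K * t)
          + (E t + H t) / H t * (Real.exp (-K * t) * (-K)) =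
          ((E' t * H t - E t * H' t) - K * (H t * (H t + E t))) / H t ^ 2 * Real.exp (-K * t) := by
        field_simp; ring
      rw [this]
      exact mul_nonpos_of_nonpos_of_nonneg (div_nonpos_of_nonpos_of_nonneg (by linarith) (sq_nonneg _))
        (Real.exp_pos _).le
    set M := (E t1 + H t1) / H t1 * Real.exp (-K * t1) * Real.exp (K * ts) with hM
    have hN : ∀ t ∈ Ico t1 ts, E t + H t ≤ M * H t := fun t ht => by
      have hp := Hp t ht
      have a1 := antiN (left_mem_Ico.2 hlt) ht ht.1
      simp only [] at a1
      have a2 : (E t + H t) / H t ≤ M := by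
        have a3 : (E t + H t) / H t = (E t + H t) / H t * Real.exp (-K * t) * Real.exp (K * t) := by
          rw [mul_assoc, ← Real.exp_add]; simp
        rw [a3, hM]
        have : 0 ≤ (E t1 + H t1) / H t1 * Real.exp (-K * t1) :=
          mul_nonneg (div_nonneg (add_nonneg (hE t1 h1) (hH t1 h1)) (hH t1 h1)) (Real.exp_pos _).le
        have e5 : Real.exp (K * t) ≤ Real.exp (K * ts) :=
          Real.exp_le_exp.2 (mul_le_mul_of_nonneg_left ht.2.le hK)
        exact mul_le_mul a1 e5 (Real.exp_pos _).le this
      rwa [div_le_iff₀ hp] at a2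
    have d : ∀ t ∈ Ioo s1 s2, HasDerivAt (fun s => H s * Real.exp ((3 * M + K) * s))
      (H' t * Real.exp ((3 * M + K) * t) + H t * (Real.exp ((3 * M + K) * t) * (3 * M + K))) t := fun t ht =>
      (dH t ht).mul (hexp (3 * M + K) t)
    have mono : MonotoneOn (fun s => H s * Real.exp ((3 * M + K) * s)) (Icc t1 ts) := by
      refine monotoneOn_of_hasDerivWithinAt_nonneg (convex_Icc _ _)
        (fun t ht => (d t (sub2 ht)).continuousAt.continuousWithinAt)
        (fun t ht => (d t (sub2 (interior_subset ht))).hasDerivWithinAt) (fun t ht => ?_)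
      rw [interior_Icc] at ht
      have hs := sub2 (Ioo_subset_Icc_self ht)
      have e1 := (abs_le.1 (i2 t hs)).1
      have e2 := hE t hs
      have e3 := hN t (Ioo_subset_Ico_self ht)
      have e4 := hH t hs
      have : H' t * Real.exp ((3 * M + K) * t) + H t * (Real.exp ((3 * M + K) * t) * (3 * M + K)) =
        (H' t + 3 * (M * H t) + K * H t) * Real.exp ((3 * M + K) * t) := by ring
      rw [this]
      exact mul_nonneg (by linarith) (Real.exp_pos _).le
    have := mono (left_mem_Icc.2 hlt.le) (right_mem_Icc.2 hlt.le) hlt.le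
    have hz' : H ts = 0 := hm.2
    simp only [hz', zero_mul] at this
    have e3 := nonpos_of_mul_nonpos_left this (Real.exp_pos _)
    linarith

theorem Bd.bo {F : ℝ × ℝ → ℝ} (h : Bd F) {s1 s2 : ℝ} (hs : 0 < s1) : Bo s1 s2 0 F := by
  obtain ⟨K, hK⟩ := h s1 s2 hs
  refine ⟨|K|, abs_nonneg _, fun p hp => ?_⟩
  simpa using (hK p.1 p.2 hp.1.le hp.2.le).trans (le_abs_self K)

noncomputable def Gw : ℝ × ℝ → ℝ := fun p => ((1 + p.1 ^ 2) ^ 2)⁻¹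
noncomputable def gw : ℝ × ℝ → ℝ := fun p => -4 * p.1 / (1 + p.1 ^ 2)

theorem gw_bd (p : ℝ × ℝ) : |gw p| ≤ 4 := by
  have h0 : 0 < 1 + p.1 ^ 2 := by positivity
  rw [gw, abs_div, abs_of_pos h0, div_le_iff₀ h0, abs_mul]
  simp only [abs_neg, Nat.abs_ofNat]
  have := sq_abs p.1
  nlinarith [sq_nonneg (1 - |p.1|)]

theorem Gw_hasFDeriv (p : ℝ × ℝ) : HasFDerivAt Gw
    ((gw p * Gw p) • ContinuousLinearMap.fst ℝ ℝ ℝ) p := by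
  have h0 : (1 + p.1 ^ 2) ≠ 0 := by positivity
  have h1 : HasDerivAt (fun x : ℝ => ((1 + x ^ 2) ^ 2)⁻¹) (gw p * Gw p) p.1 := by
    have := (((hasDerivAt_pow 2 p.1).const_add 1).pow 2).inv (pow_ne_zero 2 h0)
    refine this.congr_deriv ?_
    simp only [gw, Gw]; field_simp; norm_num; ring
  exact h1.comp_hasFDerivAt p hasFDerivAt_fst

theorem Wt_Gw (s1 s2 : ℝ) : Wt s1 s2 Gw (fun _ => 0) gw := by
  have z : ∀ e p, dd e (fun _ => (0 : ℝ)) p = 0 := fun e p => by simp [dd]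
  refine ⟨?_, contDiffOn_const, ?_, ?_, ⟨1, by norm_num, fun p _ => by simp [Gw]⟩, ?_, ?_, ?_, ?_, ?_⟩
  · apply ContDiff.contDiffOn
    unfold Gw
    refine ContDiff.inv (by fun_prop) (fun p => by positivity)
  · apply ContDiff.contDiffOn
    unfold gw
    refine ContDiff.div (by fun_prop) (by fun_prop) (fun p => by positivity)
  · intro p _; unfold Gw; positivity
  · intro p _; simp [dd, (Gw_hasFDeriv p).fderiv]
  · intro p _; rw [z]; simp [dd, (Gw_hasFDeriv p).fderiv]
  · exact (Bo.const 0).mono (by norm_num)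
  · refine Bo.mono (i := 0) ⟨4, by norm_num, fun p _ => by simpa using gw_bd p⟩ (by norm_num)
  · exact (Bo.const 0).congr (fun p _ => z _ p)

theorem uniq {ε : ℝ} {v a b c : ℝ × ℝ → ℝ} (L : LinHyp ε v a b c) {t0 : ℝ} (ht0 : 0 < t0)
    (h0 : ∀ x, v (x, t0) = 0) : ∀ p ∈ Om, v p = 0 := by
  rintro ⟨x1, t1⟩ hp1
  have ht1 : 0 < t1 := hp1
  set s1 := min t0 t1 / 2 with hs1
  set s2 := max t0 t1 + 1 with hs2
  have hs1p : 0 < s1 := half_pos (lt_min ht0 ht1)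
  have m0 : t0 ∈ Ioo s1 s2 := ⟨by have := min_le_left t0 t1; linarith, by have := le_max_left t0 t1; linarith⟩
  have m1 : t1 ∈ Ioo s1 s2 := ⟨by have := min_le_right t0 t1; linarith, by have := le_max_right t0 t1; linarith⟩
  have sub : St s1 s2 ⊆ Om := fun p hp => hs1p.trans hp.1
  have W := Wt_Gw s1 s2
  have D : Fd s1 s2 v a := ⟨L.sv.mono sub, L.sa.mono sub, L.bv.bo hs1p, L.bvx.bo hs1p, L.bvt.bo hs1p,
    L.bvxx.bo hs1p, L.bvxt.bo hs1p, L.ba.bo hs1p, L.bax.bo hs1p, L.bat.bo hs1p⟩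
  obtain ⟨Ka, hKa⟩ := L.ba s1 s2 hs1p
  obtain ⟨Kax, hKax⟩ := L.bax s1 s2 hs1p
  obtain ⟨Kat, hKat⟩ := L.bat s1 s2 hs1p
  obtain ⟨Kb, hKb⟩ := L.bb s1 s2 hs1p
  obtain ⟨Kc, hKc⟩ := L.bc s1 s2 hs1p
  have hε := L.eps
  set K1 := |Ka| * 4 + |Kax| + |Kb| + |Kc| with hK1
  have hK1p : 0 ≤ K1 := by positivity
  set K2 := 2 * K1 ^ 2 * (1 + 1 / ε) with hK2
  have hK2p : 0 ≤ K2 := by positivity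
  set K3 := K2 + |Kat| / ε + 1 with hK3
  have hK3p : 0 ≤ K3 := by positivity
  set B : ℝ × ℝ → ℝ := fun p => dt v p - (dx a p * dx v p + a p * dx (dx v) p + a p * dx v p * gw p) with hB
  set H : ℝ → ℝ := fun s => ∫ x, v (x, s) ^ 2 * Gw (x, s) with hH
  set E : ℝ → ℝ := fun s => ∫ x, (a (x, s) * dx v (x, s) ^ 2) * Gw (x, s) with hE
  have Gp : ∀ p, 0 < Gw p := fun p => by unfold Gw; positivity
  have H0 : ∀ t ∈ Ioo s1 s2, 0 ≤ H t := fun t _ =>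
    integral_nonneg fun x => mul_nonneg (sq_nonneg _) (Gp _).le
  have E0 : ∀ t ∈ Ioo s1 s2, 0 ≤ E t := fun t ht =>
    integral_nonneg fun x => mul_nonneg (mul_nonneg (hε.le.trans (L.ea _ (sub ht))) (sq_nonneg _)) (Gp _).le
  have Bb : ∀ p ∈ St s1 s2, B p ^ 2 ≤ K2 * (v p ^ 2 + a p * dx v p ^ 2) := by
    intro p hp
    have eB : B p = (b p + -(dx a p) + -(a p * gw p)) * dx v p + c p * v p := by
      simp only [hB]; rw [L.eq p (sub hp)]; ring
    have q1 : |b p + -(dx a p) + -(a p * gw p)| ≤ K1 := by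
      have r1 := (hKb p.1 p.2 hp.1.le hp.2.le).trans (le_abs_self _)
      have r2 := (hKax p.1 p.2 hp.1.le hp.2.le).trans (le_abs_self _)
      have r3 := (hKa p.1 p.2 hp.1.le hp.2.le).trans (le_abs_self _)
      have r4 := abs_nonneg Kc
      have r5 : |a p * gw p| ≤ |Ka| * 4 := by
        rw [abs_mul]; exact mul_le_mul r3 (gw_bd p) (abs_nonneg _) (abs_nonneg _)
      have r6 := abs_add_three (b p) (-(dx a p)) (-(a p * gw p))
      rw [abs_neg, abs_neg] at r6
      linarith
    have q2 : |c p| ≤ K1 := by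
      have r1 := (hKc p.1 p.2 hp.1.le hp.2.le).trans (le_abs_self _)
      have : 0 ≤ |Ka| * 4 + |Kax| + |Kb| := by positivity
      linarith
    set m := b p + -(dx a p) + -(a p * gw p)
    have q3 : m ^ 2 ≤ K1 ^ 2 := sq_le_sq' (neg_le_of_abs_le q1) (le_of_abs_le q1)
    have q4 : c p ^ 2 ≤ K1 ^ 2 := sq_le_sq' (neg_le_of_abs_le q2) (le_of_abs_le q2)
    have q5 : dx v p ^ 2 ≤ (1 / ε) * (a p * dx v p ^ 2) := by
      rw [← mul_assoc, one_div_mul_eq_div]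
      have : 1 ≤ a p / ε := by rw [le_div_iff₀ hε]; linarith [L.ea p (sub hp)]
      exact le_mul_of_one_le_left (sq_nonneg _) this
    have q6 : 0 ≤ a p * dx v p ^ 2 := mul_nonneg (hε.le.trans (L.ea p (sub hp))) (sq_nonneg _)
    calc B p ^ 2 ≤ 2 * ((m * dx v p) ^ 2 + (c p * v p) ^ 2) := by rw [eB]; exact add_sq_le
      _ ≤ 2 * (K1 ^ 2 * dx v p ^ 2 + K1 ^ 2 * v p ^ 2) := by
        rw [mul_pow, mul_pow]; gcongr
      _ ≤ 2 * (K1 ^ 2 * ((1 / ε) * (a p * dx v p ^ 2)) + K1 ^ 2 * v p ^ 2) := by gcongr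
      _ ≤ K2 * (v p ^ 2 + a p * dx v p ^ 2) := by
        have z1 : 0 ≤ 2 * K1 ^ 2 * (a p * dx v p ^ 2) := by positivity
        have z2 : 0 ≤ 2 * K1 ^ 2 * (1 / ε) * v p ^ 2 := by positivity
        rw [hK2]; linarith
  have gb : ∀ p ∈ St s1 s2, dt a p * dx v p ^ 2 ≤ |Kat| / ε * (a p * dx v p ^ 2) := by
    intro p hp
    have r1 := (le_abs_self _).trans ((hKat p.1 p.2 hp.1.le hp.2.le).trans (le_abs_self _))
    rw [← mul_assoc]
    refine mul_le_mul_of_nonneg_right ?_ (sq_nonneg _)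
    rw [div_mul_eq_mul_div, le_div_iff₀ hε]
    exact mul_le_mul r1 (L.ea p (sub hp)) hε.le (abs_nonneg _)
  have key : ∀ t ∈ Ioo s1 s2, ∃ H' E', HasDerivAt H H' t ∧ HasDerivAt E E' t ∧
      E' * H t - E t * H' ≤ K3 * (H t * (H t + E t)) ∧ |H' + 2 * E t| ≤ (K3 + 1) * H t + E t := by
    intro t ht
    obtain ⟨H', E', dH, dE, iH, iE, iB, ig, j1, j2⟩ := freq W D (X := dt v) (B := B) (γ := dt a)
      (fun p _ => by simp) (fun p _ => rfl) (fun p _ => by simp [dd]) ht.1 ht.2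
    have SB : ∫ x, B (x, t) ^ 2 * Gw (x, t) ≤ K2 * (H t + E t) := by
      rw [hH, hE]; beta_reduce
      rw [← integral_add iH iE, ← integral_const_mul]
      refine integral_mono iB ((iH.add iE).const_mul _) (fun x => ?_)
      have := mul_le_mul_of_nonneg_right (Bb (x, t) ht) (Gp (x, t)).le
      simp only []; linarith
    have Sg : ∫ x, (dt a (x, t) * dx v (x, t) ^ 2) * Gw (x, t) ≤ |Kat| / ε * E t := by
      rw [hE]; beta_reduce
      rw [← integral_const_mul]
      refine integral_mono ig (iE.const_mul _) (fun x => ?_)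
      have := mul_le_mul_of_nonneg_right (gb (x, t) ht) (Gp (x, t)).le
      simp only []; linarith
    have Ht := H0 t ht
    have Et := E0 t ht
    have hKat0 : 0 ≤ |Kat| / ε := by positivity
    refine ⟨H', E', dH, dE, ?_, ?_⟩
    · refine le_trans j1 ?_
      rw [← mul_assoc, mul_comm K3, mul_assoc]
      refine mul_le_mul_of_nonneg_left ?_ Ht
      have z1 : 0 ≤ |Kat| / ε * H t := by positivity
      have z2 : 0 ≤ K2 * (H t + E t) := by positivity
      rw [hK3]; linarith
    · have hK3' : 0 < K3 := by positivity
      refine (j2 (1 / K3) (by positivity)).trans ?_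
      have : 1 / K3 * ∫ x, B (x, t) ^ 2 * Gw (x, t) ≤ H t + E t := by
        rw [one_div_mul_eq_div, div_le_iff₀ hK3']
        refine SB.trans ?_
        rw [mul_comm]
        exact mul_le_mul_of_nonneg_left (by rw [hK3]; linarith) (by linarith)
      have e : (∫ x, v (x, t) ^ 2 * Gw (x, t)) / (1 / K3) = K3 * H t := by simp [hH, mul_comm]
      rw [e]; linarith
  have hz : H t0 = 0 := by simp [hH, h0]
  have fin : H t1 = 0 := ode_uniq (K := K3 + 1) (by linarith) H0 E0 (fun t ht => by
    obtain ⟨H', E', d1, d2, j1, j2⟩ := key t ht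
    refine ⟨H', E', d1, d2, j1.trans ?_, j2⟩
    have := mul_nonneg (H0 t ht) (add_nonneg (H0 t ht) (E0 t ht))
    linarith) m1 m0 hz
  have iH : Integrable (fun x => v (x, t1) ^ 2 * Gw (x, t1)) := by
    obtain ⟨_, _, _, _, iH, _⟩ := freq W D (X := dt v) (B := B) (γ := dt a)
      (fun p _ => by simp) (fun p _ => rfl) (fun p _ => by simp [dd]) m1.1 m1.2
    exact iH
  have ae := (integral_eq_zero_iff_of_nonneg (fun x => mul_nonneg (sq_nonneg (v (x, t1))) (Gp (x, t1)).le) iH).1 fin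
  have cont : Continuous (fun x => v (x, t1) ^ 2 * Gw (x, t1)) :=
    ((D.sf.cont_x (fun x => m1)).pow 2).mul (W.sG.cont_x (fun x => m1))
  have e0 : v (x1, t1) ^ 2 * Gw (x1, t1) = 0 :=
    congrFun ((Continuous.ae_eq_iff_eq volume cont continuous_const).1 ae) x1
  rcases mul_eq_zero.1 e0 with h | h
  · exact pow_eq_zero_iff (by norm_num) |>.1 h
  · exact absurd h (Gp _).ne'

theorem ode_low {H E : ℝ → ℝ} {K t1 t0 : ℝ} (hK : 1 ≤ K) (ht : t1 < t0) (h1 : t0 - t1 ≤ 1)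
    (Hp : ∀ t ∈ Ico t1 t0, 0 < H t) (E0 : ∀ t ∈ Ico t1 t0, 0 ≤ E t)
    (hd : ∀ t ∈ Ico t1 t0, ∃ H' E', HasDerivAt H H' t ∧ HasDerivAt E E' t ∧
      E' * H t - E t * H' ≤ H t * (E t / (t0 - t) + K * (H t + E t)) ∧
      |H' + 2 * E t| ≤ K * H t + E t) :
    ∃ (p : ℕ) (c : ℝ), 0 < c ∧ ∀ t ∈ Ico t1 t0, c * (t0 - t) ^ p ≤ H t := by
  choose! H' E' dH dE i1 i2 using hd
  have hexp : ∀ c t : ℝ, HasDerivAt (fun s => Real.exp (c * s)) (Real.exp (c * t) * c) t := fun c t => by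
    have := ((hasDerivAt_id t).const_mul c).exp
    simpa using this
  have hτ : ∀ t : ℝ, HasDerivAt (fun s => t0 - s) (-1) t := fun t => (hasDerivAt_id t).const_sub t0
  have tp : ∀ t ∈ Ico t1 t0, 0 < t0 - t := fun t h => sub_pos.2 h.2
  have t1' : ∀ t ∈ Ico t1 t0, t0 - t ≤ 1 := fun t h => by linarith [h.1]
  set N : ℝ → ℝ := fun s => ((t0 - s) * E s + H s) / H s with hN
  have dN : ∀ t ∈ Ico t1 t0, HasDerivAt (fun s => N s * Real.exp (-K * s))
      (((((-1) * E t + (t0 - t) * E' t) + H' t) * H t - ((t0 - t) * E t + H t) * H' t) / H t ^ 2 * Real.exp (-K * t)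
        + N t * (Real.exp (-K * t) * (-K))) t := fun t h =>
    (((((hτ t).mul (dE t h)).add (dH t h)).div (dH t h) (Hp t h).ne').mul (hexp (-K) t))
  have anti : AntitoneOn (fun s => N s * Real.exp (-K * s)) (Ico t1 t0) := by
    refine antitoneOn_of_hasDerivWithinAt_nonpos (convex_Ico _ _)
      (fun t ht => (dN t ht).continuousAt.continuousWithinAt)
      (fun t ht => (dN t (interior_subset ht)).hasDerivWithinAt) (fun t ht => ?_)
    have ht := interior_subset ht
    have hp := Hp t ht
    have j1 := mul_le_mul_of_nonneg_left (i1 t ht) (tp t ht).le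
    have q : (t0 - t) * (H t * (E t / (t0 - t) + K * (H t + E t))) =
        H t * E t + K * H t * ((t0 - t) * H t + (t0 - t) * E t) := by
      have := (tp t ht).ne'
      field_simp
    rw [q] at j1
    have j2 : (t0 - t) * H t ≤ H t := mul_le_of_le_one_left hp.le (t1' t ht)
    have j3 := mul_le_mul_of_nonneg_left j2 (show 0 ≤ K * H t by positivity)
    have : (((((-1) * E t + (t0 - t) * E' t) + H' t) * H t - ((t0 - t) * E t + H t) * H' t) / H t ^ 2 * Real.exp (-K * t)
        + N t * (Real.exp (-K * t) * (-K))) =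
        ((t0 - t) * (E' t * H t - E t * H' t) - (H t * E t + K * H t * (H t + (t0 - t) * E t))) / H t ^ 2 * Real.exp (-K * t) := by
      simp only [hN]; field_simp; ring
    rw [this]
    refine mul_nonpos_of_nonpos_of_nonneg (div_nonpos_of_nonpos_of_nonneg ?_ (sq_nonneg _))
        (Real.exp_pos _).le
    linarith
  have m1 : t1 ∈ Ico t1 t0 := left_mem_Ico.2 ht
  set M := N t1 * Real.exp (-K * t1) * Real.exp (K * t0) with hM
  have hNM : ∀ t ∈ Ico t1 t0, (t0 - t) * E t + H t ≤ M * H t := fun t ht' => by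
    have hp := Hp t ht'
    have a1 := anti m1 ht' ht'.1
    beta_reduce at a1
    have a2 : N t ≤ M := by
      have a3 : N t = N t * Real.exp (-K * t) * Real.exp (K * t) := by
        rw [mul_assoc, ← Real.exp_add]; simp
      rw [a3, hM]
      have : 0 ≤ N t1 * Real.exp (-K * t1) :=
        mul_nonneg (div_nonneg (add_nonneg (mul_nonneg (tp t1 m1).le (E0 t1 m1)) (Hp t1 m1).le) (Hp t1 m1).le) (Real.exp_pos _).le
      have e5 : Real.exp (K * t) ≤ Real.exp (K * t0) :=
        Real.exp_le_exp.2 (mul_le_mul_of_nonneg_left ht'.2.le (by linarith))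
      exact mul_le_mul a1 e5 (Real.exp_pos _).le this
    simp only [hN] at a2
    rwa [div_le_iff₀ hp] at a2
  obtain ⟨n, hn⟩ := exists_nat_ge (3 * M + K + 1)
  have dQ : ∀ t ∈ Ico t1 t0, HasDerivAt (fun s => H s / (t0 - s) ^ (n + 1))
      ((H' t * (t0 - t) ^ (n + 1) - H t * (((n + 1 : ℕ) : ℝ) * (t0 - t) ^ n * (-1))) / ((t0 - t) ^ (n + 1)) ^ 2) t :=
    fun t h => (dH t h).div (((hτ t).pow (n + 1))) (pow_ne_zero _ (tp t h).ne')
  have mono : MonotoneOn (fun s => H s / (t0 - s) ^ (n + 1)) (Ico t1 t0) := by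
    refine monotoneOn_of_hasDerivWithinAt_nonneg (convex_Ico _ _)
      (fun t ht => (dQ t ht).continuousAt.continuousWithinAt)
      (fun t ht => (dQ t (interior_subset ht)).hasDerivWithinAt) (fun t ht => ?_)
    have ht := interior_subset ht
    have hp := Hp t ht
    have e : H' t * (t0 - t) ^ (n + 1) - H t * (((n + 1 : ℕ) : ℝ) * (t0 - t) ^ n * (-1)) =
      (t0 - t) ^ n * (H' t * (t0 - t) + (n + 1) * H t) := by push_cast; ring
    rw [e]
    refine div_nonneg (mul_nonneg (pow_nonneg (tp t ht).le _) ?_) (sq_nonneg _)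
    have e1 := (abs_le.1 (i2 t ht)).1
    have e3 := hNM t ht
    have e4 := mul_le_mul_of_nonneg_right e1 (tp t ht).le
    have e5 := mul_le_mul_of_nonneg_right hn hp.le
    have e6 := mul_le_mul_of_nonneg_left (t1' t ht) (show 0 ≤ K * H t by positivity)
    have e7 := E0 t ht
    linarith
  refine ⟨n + 1, H t1 / (t0 - t1) ^ (n + 1), div_pos (Hp t1 m1) (pow_pos (tp t1 m1) _), fun t ht' => ?_⟩
  have := mono m1 ht' ht'.1
  beta_reduce at this
  rwa [le_div_iff₀ (pow_pos (tp t ht') _)] at this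

noncomputable def Gk (t0 : ℝ) : ℝ × ℝ → ℝ := fun p =>
  Real.exp (-(1 / 2) * Real.log (t0 - p.2) - p.1 ^ 2 / (4 * (t0 - p.2)))
noncomputable def bk (t0 : ℝ) : ℝ × ℝ → ℝ := fun p => -p.1 / (2 * (t0 - p.2))

theorem Gk_le {t0 : ℝ} {p : ℝ × ℝ} (h1 : p.2 < t0) (h2 : t0 - 1 ≤ p.2) {ρ : ℝ} (h : ρ ≤ p.1 ^ 2) :
    Gk t0 p ≤ 1 / (t0 - p.2) * Real.exp (-(ρ / (4 * (t0 - p.2)))) := by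
  have tp : 0 < t0 - p.2 := by linarith
  have l0 : Real.log (t0 - p.2) ≤ 0 := Real.log_nonpos tp.le (by linarith)
  have : 1 / (t0 - p.2) = Real.exp (- Real.log (t0 - p.2)) := by
    rw [Real.exp_neg, Real.exp_log tp, one_div]
  rw [this, ← Real.exp_add, Gk]
  apply Real.exp_le_exp.2
  have : ρ / (4 * (t0 - p.2)) ≤ p.1 ^ 2 / (4 * (t0 - p.2)) := by gcongr
  linarith

theorem Gk_smooth {t0 s1 s2 : ℝ} (h2 : s2 ≤ t0) : Sm (St s1 s2) (Gk t0) := by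
  have ne : ∀ p ∈ St s1 s2, t0 - p.2 ≠ 0 := fun p hp => (sub_pos.2 (hp.2.trans_le h2)).ne'
  have sτ : ContDiffOn ℝ ∞ (fun p : ℝ × ℝ => t0 - p.2) (St s1 s2) := by fun_prop
  have s4τ : ContDiffOn ℝ ∞ (fun p : ℝ × ℝ => 4 * (t0 - p.2)) (St s1 s2) := by fun_prop
  have sx : ContDiffOn ℝ ∞ (fun p : ℝ × ℝ => p.1 ^ 2) (St s1 s2) := by fun_prop
  exact ((contDiffOn_const.mul (sτ.log ne)).sub
    (sx.div s4τ (fun p hp => mul_ne_zero (by norm_num) (ne p hp)))).exp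

theorem bk_smooth {t0 s1 s2 : ℝ} (h2 : s2 ≤ t0) : Sm (St s1 s2) (bk t0) := by
  have ne : ∀ p ∈ St s1 s2, t0 - p.2 ≠ 0 := fun p hp => (sub_pos.2 (hp.2.trans_le h2)).ne'
  have s4τ : ContDiffOn ℝ ∞ (fun p : ℝ × ℝ => 2 * (t0 - p.2)) (St s1 s2) := by fun_prop
  have sx : ContDiffOn ℝ ∞ (fun p : ℝ × ℝ => -p.1) (St s1 s2) := by fun_prop
  exact (sx.div s4τ (fun p hp => mul_ne_zero (by norm_num) (ne p hp)))

theorem bk_dx {t0 s1 s2 : ℝ} (h2 : s2 ≤ t0) : ∀ p ∈ St s1 s2, dx (bk t0) p = -1 / (2 * (t0 - p.2)) := by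
  rintro ⟨x, t⟩ hp
  refine (hasDeriv_dx (isOpen_St s1 s2) (bk_smooth h2) hp).unique ?_
  exact (hasDerivAt_neg x).div_const (2 * (t0 - t))

theorem Wt_Gk {t0 s1 s2 : ℝ} (h1 : t0 - 1 ≤ s1) (h2 : s2 < t0) : Wt s1 s2 (Gk t0) (bk t0) (bk t0) := by
  have tp : ∀ p ∈ St s1 s2, 0 < t0 - p.2 := fun p hp => (sub_pos.2 (hp.2.trans h2))
  have hb : Bo s1 s2 1 (bk t0) := by
    have hs : 0 < t0 - s2 := by linarith
    refine ⟨1 / (2 * (t0 - s2)), by positivity, fun p hp => ?_⟩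
    have h3 := tp p hp
    have h4 := hp.2
    rw [bk, abs_div, abs_neg, abs_of_pos (show 0 < 2 * (t0 - p.2) by linarith), div_eq_mul_one_div, mul_comm]
    have : 1 / (2 * (t0 - p.2)) ≤ 1 / (2 * (t0 - s2)) := by gcongr
    simp only [pow_one]
    exact mul_le_mul this (by linarith) (abs_nonneg _) (by positivity)
  refine ⟨Gk_smooth h2.le, bk_smooth h2.le, bk_smooth h2.le, fun p _ => Real.exp_pos _, ?_, ?_, ?_, hb, hb, ?_⟩
  · have hs : 0 < t0 - s2 := by linarith
    refine ⟨1 / (t0 - s2) * 32, by positivity, fun p hp => ?_⟩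
    have h3 := tp p hp
    have h4 := hp.2
    have h5 := hp.1
    refine (Gk_le (by linarith) (by linarith) le_rfl).trans ?_
    rw [mul_assoc]
    have z0 : 0 ≤ p.1 ^ 2 / 4 := by positivity
    have e1 : Real.exp (-(p.1 ^ 2 / (4 * (t0 - p.2)))) ≤ Real.exp (-(p.1 ^ 2 / 4)) := by
      apply Real.exp_le_exp.2
      apply neg_le_neg
      gcongr
      linarith
    have e2 : Real.exp (-(p.1 ^ 2 / 4)) ≤ 32 * ((1 + p.1 ^ 2) ^ 2)⁻¹ := by
      rw [Real.exp_neg, ← div_eq_mul_inv, le_div_iff₀ (by positivity), inv_mul_le_iff₀ (Real.exp_pos _)]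
      have := Real.quadratic_le_exp_of_nonneg z0
      have z1 := sq_nonneg p.1
      nlinarith
    exact mul_le_mul (by gcongr) (e1.trans e2) (Real.exp_pos _).le (by positivity)
  · rintro ⟨x, t⟩ hp
    refine (hasDeriv_dx (isOpen_St s1 s2) (Gk_smooth h2.le) hp).unique ?_
    have := (((hasDerivAt_pow 2 x).div_const (4 * (t0 - t))).const_sub (-(1 / 2) * Real.log (t0 - t))).exp
    refine this.congr_deriv ?_
    have h3 := (tp _ hp).ne'
    simp only [] at h3
    simp only [bk, Gk]; field_simp; norm_num; ring
  · rintro ⟨x, t⟩ hp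
    rw [bk_dx h2.le _ hp]
    refine (hasDeriv_dt (isOpen_St s1 s2) (Gk_smooth h2.le) hp).unique ?_
    have h3 := (tp _ hp).ne'
    simp only [] at h3
    have hτ : HasDerivAt (fun s => t0 - s) (-1) t := (hasDerivAt_id t).const_sub t0
    have := (((hτ.log h3).const_mul (-(1 / 2))).sub ((hasDerivAt_const t (x ^ 2)).div (hτ.const_mul 4)
      (mul_ne_zero (by norm_num) h3))).exp
    have this' : HasDerivAt (fun s => Gk t0 (x, s)) (Gk t0 (x, t) * (-(1 / 2) * (-1 / (t0 - t)) -
      (0 * (4 * (t0 - t)) - x ^ 2 * (4 * (-1))) / (4 * (t0 - t)) ^ 2)) t := this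
    refine this'.congr_deriv ?_
    generalize Gk t0 (x, t) = e
    simp only [bk]; field_simp; ring
  · have hs : 0 < t0 - s2 := by linarith
    refine ⟨1 / (2 * (t0 - s2)), by positivity, fun p hp => ?_⟩
    have h3 := tp p hp
    have h4 := hp.2
    rw [bk_dx h2.le _ hp, abs_div, abs_of_pos (show 0 < 2 * (t0 - p.2) by linarith)]
    simp only [pow_zero, mul_one, abs_neg, abs_one]
    gcongr

theorem lowint {φ : ℝ → ℝ} {a b k : ℝ} (hab : a ≤ b) (hφ : Integrable φ) (h0 : ∀ y, 0 ≤ φ y)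
    (h : ∀ y ∈ Icc a b, k ≤ φ y) : (b - a) * k ≤ ∫ y, φ y := by
  have h1 : ∫ y in Icc a b, k ≤ ∫ y in Icc a b, φ y :=
    setIntegral_mono_on (integrableOn_const (by simp)) hφ.integrableOn measurableSet_Icc h
  have h2 : ∫ y in Icc a b, φ y ≤ ∫ y, φ y := setIntegral_le_integral hφ (.of_forall h0)
  rw [setIntegral_const, Real.volume_real_Icc_of_le hab, smul_eq_mul] at h1
  linarith

theorem upint {φ ψ : ℝ → ℝ} {a b k : ℝ} (hab : a ≤ b) (hφ : Integrable φ) (hψ : Integrable ψ)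
    (h : ∀ y, φ y ≤ ψ y + (Icc a b).indicator (fun _ => k) y) :
    ∫ y, φ y ≤ (∫ y, ψ y) + (b - a) * k := by
  have hi : Integrable ((Icc a b).indicator (fun _ => k)) :=
    (integrable_indicator_iff measurableSet_Icc).2 (integrableOn_const (by simp))
  have h1 := integral_mono hφ (hψ.add hi) h
  have h2 : ∫ y, (ψ + (Icc a b).indicator (fun _ => k)) y = (∫ y, ψ y) + (b - a) * k := by
    rw [integral_add' hψ hi, integral_indicator measurableSet_Icc, setIntegral_const,
      Real.volume_real_Icc_of_le hab, smul_eq_mul]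
  linarith

set_option maxHeartbeats 2000000 in
theorem suc {g b c : ℝ × ℝ → ℝ} {t0 r : ℝ} (ht0 : 0 < t0) (sg : Sm Om g)
    (eq : ∀ p ∈ Om, dt g p = dx (dx g) p + b p * dx g p + c p * g p)
    (cb : ContinuousOn b Om) (cc : ContinuousOn c Om) (hr : 0 < r)
    (flat : ∀ k : ℕ, ∃ C, ∀ y t, |y| ≤ r → t0 / 2 ≤ t → t ≤ t0 → |g (y, t)| ≤ C * (t0 - t) ^ k)
    (y0 : ℝ) : g (y0, t0) = 0 := by
  by_contra hne
  have O := isOpen_Om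
  have hy0 := abs_nonneg y0
  set R := |y0| + 2 with hR
  have hR0 : 0 < R := by linarith
  let χ : ContDiffBump (0 : ℝ) := ⟨R, R + 1, hR0, by linarith⟩
  set f : ℝ × ℝ → ℝ := fun p => χ p.1 * g p with hf
  have sf : Sm Om f := (χ.contDiff.comp contDiff_fst).contDiffOn.mul sg
  set Vo : Set (ℝ × ℝ) := Om ∩ {p | R + 1 < |p.1|} with hVo
  set Vi : Set (ℝ × ℝ) := Om ∩ {p | |p.1| < R} with hVi
  have oVo : IsOpen Vo := O.inter (isOpen_lt continuous_const (continuous_abs.comp continuous_fst))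
  have oVi : IsOpen Vi := O.inter (isOpen_lt (continuous_abs.comp continuous_fst) continuous_const)
  have fo : ∀ p ∈ Vo, f p = 0 := fun p hp => by
    have : χ p.1 = 0 := χ.zero_of_le_dist (by simp only [Real.dist_eq, sub_zero]; exact le_of_lt hp.2)
    simp [hf, this]
  have fi : ∀ p ∈ Vi, f p = g p := fun p hp => by
    have : χ p.1 = 1 := χ.one_of_mem_closedBall (by
      simp only [Metric.mem_closedBall, Real.dist_eq, sub_zero]; exact le_of_lt hp.2)
    simp [hf, this]
  have vanish : ∀ {F : ℝ × ℝ → ℝ} (e : ℝ × ℝ), (∀ p ∈ Vo, F p = 0) → ∀ p ∈ Vo, dd e F p = 0 := by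
    intro F e h p hp
    rw [dd_congr oVo (G := fun _ => 0) h hp]; simp [dd]
  have bdd : ∀ {F : ℝ × ℝ → ℝ}, ContinuousOn F Om → (∀ p ∈ Vo, F p = 0) →
      ∃ K, 0 ≤ K ∧ ∀ p : ℝ × ℝ, t0 / 2 ≤ p.2 → p.2 ≤ t0 → |F p| ≤ K := by
    intro F sF hF
    obtain ⟨K, hK⟩ := (isCompact_Icc.prod isCompact_Icc).exists_bound_of_continuousOn
      (sF.mono (t := Icc (-(R + 1)) (R + 1) ×ˢ Icc (t0 / 2) t0)
        (fun p hp => (half_pos ht0).trans_le hp.2.1))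
    refine ⟨|K|, abs_nonneg _, fun p h1 h2 => ?_⟩
    by_cases h : |p.1| ≤ R + 1
    · exact (hK p ⟨abs_le.1 h, h1, h2⟩).trans (le_abs_self _)
    · rw [hF p ⟨(half_pos ht0).trans_le h1, not_le.1 h⟩]; simp
  have bo : ∀ {F : ℝ × ℝ → ℝ} {s1 s2 : ℝ}, Sm Om F → (∀ p ∈ Vo, F p = 0) → t0 / 2 ≤ s1 → s2 ≤ t0 →
      Bo s1 s2 0 F := by
    intro F s1 s2 sF hF h1 h2
    obtain ⟨K, hK, h⟩ := bdd sF.continuousOn hF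
    exact ⟨K, hK, fun p hp => by simpa using h p (h1.trans hp.1.le) (hp.2.le.trans h2)⟩
  have sfx : Sm Om (dx f) := sf.dd O _
  have sft : Sm Om (dt f) := sf.dd O _
  have sfxx : Sm Om (dx (dx f)) := sfx.dd O _
  have sfxt : Sm Om (dt (dx f)) := sfx.dd O _
  set B : ℝ × ℝ → ℝ := fun p => dt f p - dx (dx f) p with hB
  have Bo0 : ∀ p ∈ Vo, B p = 0 := fun p hp => by
    simp only [hB]; rw [vanish _ fo p hp, vanish _ (vanish _ fo) p hp, sub_zero]
  have Bi : ∀ p ∈ Vi, B p = b p * dx f p + c p * f p := fun p hp => by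
    simp only [hB]
    rw [dd_congr oVi fi hp, dd_congr oVi (fun q hq => dd_congr oVi fi hq (1, 0)) hp,
      dd_congr oVi fi hp, fi p hp, eq p hp.1]; ring
  obtain ⟨KB, hKB0, hKB⟩ := bdd (F := B) (ContDiffOn.sub sft sfxx).continuousOn Bo0
  obtain ⟨Kf, hKf0, hKf⟩ := bdd (F := f) sf.continuousOn fo
  obtain ⟨K1, hK1⟩ := (isCompact_Icc.prod isCompact_Icc).exists_bound_of_continuousOn
      (cb.mono (t := Icc (-R) R ×ˢ Icc (t0 / 2) t0) (fun p hp => (half_pos ht0).trans_le hp.2.1))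
  obtain ⟨K2, hK2⟩ := (isCompact_Icc.prod isCompact_Icc).exists_bound_of_continuousOn
      (cc.mono (t := Icc (-R) R ×ˢ Icc (t0 / 2) t0) (fun p hp => (half_pos ht0).trans_le hp.2.1))
  -- lower bound region
  set m := |g (y0, t0)| / 2 with hm
  have hm0 : 0 < m := half_pos (abs_pos.2 hne)
  have hmem0 : (y0, t0) ∈ Om := ht0
  obtain ⟨d, hd0, hd1, hd2, hd⟩ : ∃ d, 0 < d ∧ d ≤ 1 / 2 ∧ d ≤ t0 / 2 ∧ ∀ y t, |y - y0| ≤ d → t0 - d ≤ t → t ≤ t0 →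
      m ≤ |g (y, t)| := by
    have hc : ContinuousAt (fun p => |g p|) (y0, t0) := (sg.cdAt O hmem0).continuousAt.abs
    have he := hc.eventually (lt_mem_nhds (show m < |g (y0, t0)| by rw [hm]; linarith [abs_pos.2 hne]))
    obtain ⟨δ, hδ, h⟩ := Metric.eventually_nhds_iff_ball.1 he
    have ha : min (δ / 2) (min (1 / 2) (t0 / 2)) ≤ δ / 2 := min_le_left _ _
    refine ⟨min (δ / 2) (min (1 / 2) (t0 / 2)), by positivity, (min_le_right _ _).trans (min_le_left _ _),
      (min_le_right _ _).trans (min_le_right _ _), fun y t h1 h2 h3 => (h (y, t) ?_).le⟩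
    rw [Metric.mem_ball, Prod.dist_eq, max_lt_iff, Real.dist_eq, Real.dist_eq]
    refine ⟨by linarith, ?_⟩
    rw [abs_lt]; constructor <;> linarith
  -- weight
  set w : ℝ → ℝ := fun t => Real.exp (-(1 / 2) * Real.log (t0 - t) - R ^ 2 / (4 * (t0 - t))) with hw
  have w0 : ∀ t, 0 < w t := fun t => Real.exp_pos _
  have Gp : ∀ p, 0 < Gk t0 p := fun p => Real.exp_pos _
  have Glow : ∀ y t, t < t0 → |y| ≤ R → w t ≤ Gk t0 (y, t) := fun y t h1 h2 => by
    apply Real.exp_le_exp.2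
    have : 0 < t0 - t := by linarith
    have q : y ^ 2 ≤ R ^ 2 := sq_le_sq' (neg_le_of_abs_le h2) (le_of_abs_le h2)
    have : y ^ 2 / (4 * (t0 - t)) ≤ R ^ 2 / (4 * (t0 - t)) := by gcongr
    simp only []; linarith
  have Gup : ∀ y t, t < t0 → R ≤ |y| → Gk t0 (y, t) ≤ w t := fun y t h1 h2 => by
    apply Real.exp_le_exp.2
    have : 0 < t0 - t := by linarith
    have q : R ^ 2 ≤ y ^ 2 := by rw [← sq_abs y]; gcongr
    have : R ^ 2 / (4 * (t0 - t)) ≤ y ^ 2 / (4 * (t0 - t)) := by gcongr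
    simp only []; linarith
  set H : ℝ → ℝ := fun s => ∫ x, f (x, s) ^ 2 * Gk t0 (x, s) with hH
  set E : ℝ → ℝ := fun s => ∫ x, ((fun _ => (1 : ℝ)) (x, s) * dx f (x, s) ^ 2) * Gk t0 (x, s) with hE
  have E0 : ∀ t, 0 ≤ E t := fun t =>
    integral_nonneg fun x => mul_nonneg (mul_nonneg zero_le_one (sq_nonneg _)) (Gp _).le
  -- the frequency lemma
  have fq : ∀ t, t0 - d < t → t < t0 → ∃ H' E', HasDerivAt H H' t ∧ HasDerivAt E E' t ∧
      Integrable (fun x => f (x, t) ^ 2 * Gk t0 (x, t)) ∧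
      Integrable (fun x => ((fun _ => (1 : ℝ)) (x, t) * dx f (x, t) ^ 2) * Gk t0 (x, t)) ∧
      Integrable (fun x => B (x, t) ^ 2 * Gk t0 (x, t)) ∧
      E' * H t - E t * H' ≤ H t * (E t / (t0 - t) + (∫ x, B (x, t) ^ 2 * Gk t0 (x, t)) / 2) ∧
      ∀ η > 0, |H' + 2 * E t| ≤ H t / η + η * ∫ x, B (x, t) ^ 2 * Gk t0 (x, t) := by
    intro t h1 h2
    have k1 : t0 / 2 ≤ t0 - d := by linarith
    have k2 : (t + t0) / 2 < t0 := by linarith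
    have sub : St (t0 - d) ((t + t0) / 2) ⊆ Om := fun p hp => by
      have := hp.1
      show 0 < p.2
      linarith
    have W : Wt (t0 - d) ((t + t0) / 2) (Gk t0) (bk t0) (bk t0) := Wt_Gk (by linarith) k2
    have z : ∀ e, ∀ p : ℝ × ℝ, dd e (fun _ => (1 : ℝ)) p = 0 := fun e p => by simp [dd]
    have D : Fd (t0 - d) ((t + t0) / 2) f (fun _ => 1) :=
      ⟨sf.mono sub, contDiffOn_const, bo sf fo k1 k2.le, bo sfx (vanish _ fo) k1 k2.le,
        bo sft (vanish _ fo) k1 k2.le, bo sfxx (vanish _ (vanish _ fo)) k1 k2.le,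
        bo sfxt (vanish _ (vanish _ fo)) k1 k2.le, Bo.const 1, (Bo.const 0).congr (fun p _ => z _ p),
        (Bo.const 0).congr (fun p _ => z _ p)⟩
    obtain ⟨H', E', dH, dE, iH, iE, iB, ig, j1, j2⟩ := freq W D (X := fun p => dt f p + bk t0 p * dx f p)
      (B := B) (γ := fun p => 1 / (t0 - p.2)) (fun p _ => rfl)
      (fun p _ => by simp only [hB, z]; ring)
      (fun p hp => by
        rw [bk_dx k2.le p hp, z, z]
        have h5 : 0 < t0 - p.2 := by linarith [hp.2]
        field_simp; ring) h1 (by linarith)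
    refine ⟨H', E', dH, dE, iH, iE, iB, j1.trans_eq ?_, j2⟩
    congr 2
    simp only [hE]
    rw [← integral_div]
    congr 1; ext x; ring
  have Hlow : ∀ t, t0 - d < t → t < t0 → 2 * d * m ^ 2 * w t ≤ H t := by
    intro t h1 h2
    obtain ⟨_, _, _, _, iH, _⟩ := fq t h1 h2
    have := lowint (a := y0 - d) (b := y0 + d) (k := m ^ 2 * w t) (by linarith) iH
      (fun y => mul_nonneg (sq_nonneg _) (Gp _).le) (fun y hy => by
        have q1 : |y - y0| ≤ d := abs_le.2 ⟨by linarith [hy.1], by linarith [hy.2]⟩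
        have q2 := hd y t q1 h1.le h2.le
        have q3 : |y| ≤ |y0| + 1 := by
          have := abs_add_le (y - y0) y0
          rw [sub_add_cancel] at this; linarith
        have q4 : (y, t) ∈ Vi := ⟨show 0 < t by linarith, show |y| < R by linarith⟩
        rw [fi _ q4]
        have q5 : m ^ 2 ≤ g (y, t) ^ 2 := by rw [← sq_abs (g (y, t))]; gcongr
        exact mul_le_mul q5 (Glow y t h2 (by linarith)) (w0 t).le (sq_nonneg _))
    calc _ = (y0 + d - (y0 - d)) * (m ^ 2 * w t) := by ring
      _ ≤ _ := this
  set K3 := |K1| + |K2| with hK3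
  set K6 := 2 * K3 ^ 2 with hK6
  set K7 := (R + 1 - (-(R + 1))) * KB ^ 2 / (2 * d * m ^ 2) with hK7
  have hK60 : 0 ≤ K6 := by positivity
  have hK70 : 0 ≤ K7 := by
    have : 0 ≤ R + 1 - (-(R + 1)) := by linarith
    positivity
  set K := K6 + K7 + 1 with hK
  have SB : ∀ t, t0 - d < t → t < t0 → ∫ x, B (x, t) ^ 2 * Gk t0 (x, t) ≤ (K - 1) * (H t + E t) := by
    intro t h1 h2
    obtain ⟨_, _, _, _, iH, iE, iB, _⟩ := fq t h1 h2
    have up := upint (a := -(R + 1)) (b := R + 1) (k := KB ^ 2 * w t) (by linarith) iB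
      ((iadd iH iE).const_mul K6) (fun y => by
        have mO : (y, t) ∈ Om := show 0 < t by linarith
        have i0 : 0 ≤ (Icc (-(R + 1)) (R + 1)).indicator (fun _ => KB ^ 2 * w t) y :=
          indicator_nonneg (fun _ _ => mul_nonneg (sq_nonneg _) (w0 t).le) y
        have g0 := (Gp (y, t)).le
        have p0 : 0 ≤ K6 * (f (y, t) ^ 2 * Gk t0 (y, t) + 1 * dx f (y, t) ^ 2 * Gk t0 (y, t)) := by positivity
        rcases lt_or_ge |y| R with h | h
        · have e := Bi (y, t) ⟨mO, h⟩
          have hy : y ∈ Icc (-R) R := abs_le.1 h.le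
          have ht : t ∈ Icc (t0 / 2) t0 := ⟨by linarith, h2.le⟩
          have b1 : |b (y, t)| ≤ K3 := (hK1 (y, t) ⟨hy, ht⟩).trans
            ((le_abs_self _).trans (by rw [hK3]; linarith [abs_nonneg K2]))
          have b2 : |c (y, t)| ≤ K3 := (hK2 (y, t) ⟨hy, ht⟩).trans
            ((le_abs_self _).trans (by rw [hK3]; linarith [abs_nonneg K1]))
          have q3 : b (y, t) ^ 2 ≤ K3 ^ 2 := sq_le_sq' (neg_le_of_abs_le b1) (le_of_abs_le b1)
          have q4 : c (y, t) ^ 2 ≤ K3 ^ 2 := sq_le_sq' (neg_le_of_abs_le b2) (le_of_abs_le b2)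
          have q5 : B (y, t) ^ 2 ≤ K6 * (f (y, t) ^ 2 + dx f (y, t) ^ 2) := by
            calc B (y, t) ^ 2 ≤ 2 * ((b (y, t) * dx f (y, t)) ^ 2 + (c (y, t) * f (y, t)) ^ 2) := by
                  rw [e]; exact add_sq_le
              _ ≤ 2 * (K3 ^ 2 * dx f (y, t) ^ 2 + K3 ^ 2 * f (y, t) ^ 2) := by
                  rw [mul_pow, mul_pow]; gcongr
              _ = _ := by rw [hK6]; ring
          have q6 := mul_le_mul_of_nonneg_right q5 g0
          simp only []
          linarith
        · rcases le_or_gt |y| (R + 1) with h' | h'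
          · rw [indicator_of_mem (show y ∈ Icc (-(R + 1)) (R + 1) from abs_le.1 h')]
            have b1 := hKB (y, t) (show t0 / 2 ≤ t by linarith) h2.le
            have q3 : B (y, t) ^ 2 ≤ KB ^ 2 := sq_le_sq' (neg_le_of_abs_le b1) (le_of_abs_le b1)
            have q4 := mul_le_mul q3 (Gup y t h2 h) g0 (sq_nonneg _)
            simp only []
            linarith
          · rw [Bo0 (y, t) ⟨mO, h'⟩]
            simp only []
            have : (0 : ℝ) ^ 2 * Gk t0 (y, t) = 0 := by ring
            linarith)
    rw [integral_const_mul, integral_add iH iE] at up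
    have hl := Hlow t h1 h2
    have q : (R + 1 - (-(R + 1))) * (KB ^ 2 * w t) ≤ K7 * H t := by
      have : (R + 1 - (-(R + 1))) * (KB ^ 2 * w t) = K7 * (2 * d * m ^ 2 * w t) := by
        rw [hK7]; field_simp
      rw [this]; exact mul_le_mul_of_nonneg_left hl hK70
    have q2 := mul_nonneg hK70 (E0 t)
    have : K - 1 = K6 + K7 := by rw [hK]; ring
    rw [this]
    have up' : ∫ x, B (x, t) ^ 2 * Gk t0 (x, t) ≤ K6 * (H t + E t) + (R + 1 - (-(R + 1))) * (KB ^ 2 * w t) := up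
    linarith
  have Hpos : ∀ t, t0 - d < t → t < t0 → 0 < H t := fun t h1 h2 =>
    lt_of_lt_of_le (mul_pos (by positivity) (w0 t)) (Hlow t h1 h2)
  obtain ⟨p, c1, hc1, hlow⟩ := ode_low (H := H) (E := E) (K := K + 1) (t1 := t0 - d / 2) (t0 := t0)
    (by rw [hK]; linarith) (by linarith) (by linarith)
    (fun t ht => Hpos t (by linarith [ht.1]) ht.2) (fun t _ => E0 t) (fun t ht => by
      have h1 : t0 - d < t := by linarith [ht.1]
      obtain ⟨H', E', d1, d2, _, _, _, j1, j2⟩ := fq t h1 ht.2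
      have sb := SB t h1 ht.2
      have hp := Hpos t h1 ht.2
      have he := E0 t
      have hKp : 0 < K := by linarith
      refine ⟨H', E', d1, d2, j1.trans ?_, ?_⟩
      · refine mul_le_mul_of_nonneg_left ?_ hp.le
        have s1 : 0 ≤ (K - 1) * (H t + E t) := mul_nonneg (by linarith) (by linarith)
        linarith
      · refine (j2 (1 / K) (by positivity)).trans ?_
        have q1 : H t / (1 / K) = K * H t := by field_simp
        have q2 : 1 / K * ∫ x, B (x, t) ^ 2 * Gk t0 (x, t) ≤ H t + E t := by
          rw [one_div_mul_eq_div, div_le_iff₀ hKp]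
          linarith
        rw [q1]; linarith)
  -- upper bound
  obtain ⟨C, hC⟩ := flat (p + 1)
  set n := p + 2 with hn
  set C9 := C ^ 2 + Kf ^ 2 * ((n.factorial : ℝ) * (4 / r ^ 2) ^ n) with hC9
  have hC90 : 0 ≤ C9 := by positivity
  have Hup : ∀ t, t0 - d < t → t < t0 → H t ≤ (R + 1 - (-(R + 1))) * (C9 * (t0 - t) ^ (p + 1)) := by
    intro t h1 h2
    obtain ⟨_, _, _, _, iH, _⟩ := fq t h1 h2
    have tp : 0 < t0 - t := by linarith
    have t1 : t0 - t ≤ 1 := by linarith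
    have up := upint (a := -(R + 1)) (b := R + 1) (k := C9 * (t0 - t) ^ (p + 1)) (ψ := fun _ => 0) (by linarith) iH
      (integrable_zero _ _ _) (fun y => by
        have mO : (y, t) ∈ Om := show 0 < t by linarith
        have g0 := (Gp (y, t)).le
        rcases le_or_gt |y| (R + 1) with h' | h'
        swap
        · rw [fo (y, t) ⟨mO, h'⟩]
          have i0 : 0 ≤ (Icc (-(R + 1)) (R + 1)).indicator (fun _ => C9 * (t0 - t) ^ (p + 1)) y :=
            indicator_nonneg (fun _ _ => by positivity) y
          have : (0 : ℝ) ^ 2 * Gk t0 (y, t) = 0 := by ring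
          linarith
        rw [indicator_of_mem (show y ∈ Icc (-(R + 1)) (R + 1) from abs_le.1 h')]
        rw [zero_add]
        rcases le_or_gt |y| r with hyr | hyr
        · have q1 := hC y t hyr (by linarith) h2.le
          have q2 : |f (y, t)| ≤ |g (y, t)| := by
            simp only [hf]
            rw [abs_mul, abs_of_nonneg χ.nonneg]
            exact mul_le_of_le_one_left (abs_nonneg _) χ.le_one
          have q3 : f (y, t) ^ 2 ≤ (C * (t0 - t) ^ (p + 1)) ^ 2 :=
            sq_le_sq' (neg_le_of_abs_le (q2.trans q1)) (le_of_abs_le (q2.trans q1))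
          have q4 := Gk_le (p := (y, t)) h2 (show t0 - 1 ≤ t by linarith) (sq_nonneg y)
          simp only [zero_div, neg_zero, Real.exp_zero, mul_one] at q4
          calc f (y, t) ^ 2 * Gk t0 (y, t) ≤ (C * (t0 - t) ^ (p + 1)) ^ 2 * (1 / (t0 - t)) :=
                mul_le_mul q3 q4 g0 (sq_nonneg _)
            _ = C ^ 2 * (t0 - t) ^ (p + 1) * (t0 - t) ^ p := by field_simp; ring
            _ ≤ C ^ 2 * (t0 - t) ^ (p + 1) * 1 := by
                gcongr; exact pow_le_one₀ tp.le t1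
            _ ≤ C9 * (t0 - t) ^ (p + 1) := by
                rw [mul_one, hC9]
                have : 0 ≤ Kf ^ 2 * ((n.factorial : ℝ) * (4 / r ^ 2) ^ n) := by positivity
                gcongr; linarith
        · have b1 := hKf (y, t) (show t0 / 2 ≤ t by linarith) h2.le
          have q3 : f (y, t) ^ 2 ≤ Kf ^ 2 := sq_le_sq' (neg_le_of_abs_le b1) (le_of_abs_le b1)
          have q5 : r ^ 2 ≤ y ^ 2 := by rw [← sq_abs y]; gcongr
          have q4 := Gk_le (p := (y, t)) h2 (show t0 - 1 ≤ t by linarith) q5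
          simp only [] at q4
          have z0 : 0 < r ^ 2 / (4 * (t0 - t)) := by positivity
          have q6 := Real.pow_div_factorial_le_exp _ z0.le n
          have q7 : Real.exp (-(r ^ 2 / (4 * (t0 - t)))) ≤ (n.factorial : ℝ) * (4 / r ^ 2) ^ n * (t0 - t) ^ n := by
            rw [Real.exp_neg]
            have : ((n.factorial : ℝ) * (4 / r ^ 2) ^ n * (t0 - t) ^ n) = ((r ^ 2 / (4 * (t0 - t))) ^ n / (n.factorial : ℝ))⁻¹ := by
              rw [inv_div, div_pow, div_pow, mul_pow]; field_simp
            rw [this]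
            exact inv_anti₀ (by positivity) q6
          calc f (y, t) ^ 2 * Gk t0 (y, t) ≤ Kf ^ 2 * (1 / (t0 - t) * ((n.factorial : ℝ) * (4 / r ^ 2) ^ n * (t0 - t) ^ n)) :=
                mul_le_mul q3 (q4.trans (by gcongr)) g0 (sq_nonneg _)
            _ = Kf ^ 2 * ((n.factorial : ℝ) * (4 / r ^ 2) ^ n) * (t0 - t) ^ (p + 1) := by
                have : (t0 - t) ^ n = (t0 - t) ^ (p + 1) * (t0 - t) := by rw [hn]; ring
                rw [this]; field_simp
            _ ≤ C9 * (t0 - t) ^ (p + 1) := by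
                rw [hC9]
                have : 0 ≤ C ^ 2 := sq_nonneg _
                gcongr; linarith)
    simpa [integral_zero] using up
  set D := (R + 1 - (-(R + 1))) * C9 with hD
  have hD0 : 0 ≤ D := mul_nonneg (by linarith) hC90
  set τ := min (d / 2) (c1 / (2 * (D + 1))) with hτ
  have hτ0 : 0 < τ := by positivity
  have hτ1 : τ ≤ d / 2 := min_le_left _ _
  have a1 := hlow (t0 - τ) ⟨by linarith, by linarith⟩
  have a2 := Hup (t0 - τ) (by linarith) (by linarith)
  rw [sub_sub_cancel] at a1 a2
  have a3 : c1 * τ ^ p ≤ (D * τ) * τ ^ p := by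
    calc _ ≤ _ := a1.trans a2
      _ = _ := by rw [hD]; ring
  have a4 : c1 ≤ D * τ := le_of_mul_le_mul_right a3 (pow_pos hτ0 _)
  have a5 : D * τ ≤ D * (c1 / (2 * (D + 1))) := mul_le_mul_of_nonneg_left (min_le_right _ _) hD0
  have a6 : D * (c1 / (2 * (D + 1))) < c1 := by
    rw [mul_div_assoc', div_lt_iff₀ (by positivity)]
    have : 0 ≤ D * c1 := mul_nonneg hD0 hc1.le
    calc D * c1 < 2 * (D * c1) + 2 * c1 := by linarith only [this, hc1]
      _ = _ := by ring
  linarith only [a4, a5, a6]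

/-- The differential ideal (in `x`) generated by `v` on `Om`. -/
inductive Jd (v : ℝ × ℝ → ℝ) : (ℝ × ℝ → ℝ) → Prop
  | base : Jd v v
  | mul {g F : ℝ × ℝ → ℝ} : Sm Om g → Jd v F → Jd v (fun p => g p * F p)
  | add {F G : ℝ × ℝ → ℝ} : Jd v F → Jd v G → Jd v (fun p => F p + G p)
  | der {F : ℝ × ℝ → ℝ} : Jd v F → Jd v (dd ((1 : ℝ), (0 : ℝ)) F)
  | congr {F G : ℝ × ℝ → ℝ} : Jd v F → (∀ p ∈ Om, G p = F p) → Jd v G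

theorem Jd.sm {v F : ℝ × ℝ → ℝ} (sv : Sm Om v) (h : Jd v F) : Sm Om F := by
  induction h with
  | base => exact sv
  | mul hg _ ih => exact hg.mul' ih
  | add _ _ ih1 ih2 => exact ih1.add' ih2
  | der _ ih => exact ih.dd isOpen_Om _
  | congr _ h ih => exact ContDiffOn.congr ih h

theorem Jd.vanish {v F : ℝ × ℝ → ℝ} {t0 l r : ℝ} (ht0 : 0 < t0) (sv : Sm Om v)
    (h0 : ∀ x ∈ Ioo l r, v (x, t0) = 0) (h : Jd v F) : ∀ x ∈ Ioo l r, F (x, t0) = 0 := by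
  induction h with
  | base => exact h0
  | mul hg _ ih => exact fun x hx => by simp [ih x hx]
  | add _ _ ih1 ih2 => exact fun x hx => by simp [ih1 x hx, ih2 x hx]
  | @der F hF ih =>
    intro x hx
    have h1 := hasDeriv_dx (x := x) (t := t0) isOpen_Om (hF.sm sv) ht0
    have h2 : HasDerivAt (fun y => F (y, t0)) 0 x :=
      (hasDerivAt_const x (0 : ℝ)).congr_of_eventuallyEq (by
        filter_upwards [isOpen_Ioo.mem_nhds hx] with y hy using ih y hy)
    exact h1.unique h2
  | congr _ h ih => exact fun x hx => (h _ ht0).trans (ih x hx)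

theorem Jd.dt {ε : ℝ} {v a b c F : ℝ × ℝ → ℝ} (L : LinHyp ε v a b c) (h : Jd v F) : Jd v (dt F) := by
  induction h with
  | base =>
    exact (((Jd.base.der.der.mul L.sa).add (Jd.base.der.mul L.sb)).add (Jd.base.mul L.sc)).congr L.eq
  | @mul g F hg hF ih =>
    exact ((hF.mul (hg.dd isOpen_Om (0, 1))).add (ih.mul hg)).congr
      (fun p hp => dd_mul isOpen_Om hg (hF.sm L.sv) hp _)
  | @add F G hF hG ih1 ih2 =>
    exact (ih1.add ih2).congr (fun p hp => dd_add isOpen_Om (hF.sm L.sv) (hG.sm L.sv) hp _)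
  | @der F hF ih => exact ih.der.congr (fun p hp => dd_comm isOpen_Om (hF.sm L.sv) hp _ _)
  | @congr F G hF h ih => exact ih.congr (fun p hp => dd_congr isOpen_Om h hp _)

theorem Jd.flat {ε : ℝ} {v a b c : ℝ × ℝ → ℝ} {t0 l r l' r' : ℝ} (ht0 : 0 < t0) (L : LinHyp ε v a b c)
    (h0 : ∀ x ∈ Ioo l r, v (x, t0) = 0) (hl : l < l') (hr : r' < r) (k : ℕ) :
    ∀ F, Jd v F → ∃ C, 0 ≤ C ∧ ∀ x t, l' ≤ x → x ≤ r' → t0 / 2 ≤ t → t ≤ t0 →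
      |F (x, t)| ≤ C * (t0 - t) ^ k := by
  induction k with
  | zero =>
    intro F hF
    obtain ⟨K, hK⟩ := (isCompact_Icc.prod isCompact_Icc).exists_bound_of_continuousOn
      ((hF.sm L.sv).continuousOn.mono (t := Icc l' r' ×ˢ Icc (t0 / 2) t0)
        (fun p hp => (half_pos ht0).trans_le hp.2.1))
    refine ⟨|K|, abs_nonneg _, fun x t h1 h2 h3 h4 => ?_⟩
    rw [pow_zero, mul_one]
    exact (hK (x, t) ⟨⟨h1, h2⟩, h3, h4⟩).trans (le_abs_self _)
  | succ k ih =>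
    intro F hF
    obtain ⟨C, hC0, hC⟩ := ih _ (hF.dt L)
    refine ⟨C, hC0, fun x t h1 h2 h3 h4 => ?_⟩
    have z : F (x, t0) = 0 := hF.vanish ht0 L.sv h0 x ⟨by linarith, by linarith⟩
    have mv := (convex_Icc t t0).norm_image_sub_le_of_norm_hasDerivWithin_le
      (f := fun s => F (x, s)) (f' := fun s => PUC.dd (0, 1) F (x, s)) (C := C * (t0 - t) ^ k)
      (fun s hs => (hasDeriv_dt isOpen_Om (hF.sm L.sv)
        (show 0 < s by linarith [hs.1])).hasDerivWithinAt)
      (fun s hs => (hC x s h1 h2 (by linarith [hs.1]) hs.2).trans (by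
        have : 0 ≤ t0 - s := by linarith [hs.2]
        have : t0 - s ≤ t0 - t := by linarith [hs.1]
        gcongr))
      (right_mem_Icc.2 h4) (left_mem_Icc.2 h4)
    beta_reduce at mv
    rw [z, sub_zero, Real.norm_eq_abs, Real.norm_eq_abs, abs_sub_comm, abs_of_nonneg (by linarith : 0 ≤ t0 - t)] at mv
    rw [pow_succ, ← mul_assoc]; exact mv

noncomputable def Pi0 (x0 : ℝ) (M : ℝ × ℝ → ℝ) : ℝ × ℝ → ℝ := fun p => ∫ s in x0..p.1, M (s, p.2)

theorem Pi0_cont {x0 : ℝ} {M : ℝ × ℝ → ℝ} (hM : Continuous M) : Continuous (Pi0 x0 M) :=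
  intervalIntegral.continuous_parametric_intervalIntegral_of_continuous
    (f := fun (p : ℝ × ℝ) s => M (s, p.2)) (by fun_prop) continuous_fst

theorem Pi0_dx {x0 : ℝ} {M : ℝ × ℝ → ℝ} (p : ℝ × ℝ) (h : Continuous fun s => M (s, p.2)) :
    HasDerivAt (fun y => Pi0 x0 M (y, p.2)) (M p) p.1 := by
  exact intervalIntegral.integral_hasDerivAt_right (h.intervalIntegrable _ _)
    (h.stronglyMeasurableAtFilter _ _) h.continuousAt

theorem Pi0_dt {x0 : ℝ} {M : ℝ × ℝ → ℝ} (hM : Sm univ M) (p : ℝ × ℝ) :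
    HasDerivAt (fun t => Pi0 x0 M (p.1, t)) (Pi0 x0 (dt M) p) p.2 := by
  have cM : Continuous M := continuousOn_univ.1 hM.continuousOn
  have cD : Continuous (dt M) := continuousOn_univ.1 (hM.dd isOpen_univ _).continuousOn
  obtain ⟨K, hK⟩ := (isCompact_uIcc.prod isCompact_Icc).exists_bound_of_continuousOn
    (cD.continuousOn (s := uIcc x0 p.1 ×ˢ Icc (p.2 - 1) (p.2 + 1)))
  refine (intervalIntegral.hasDerivAt_integral_of_dominated_loc_of_deriv_le (μ := volume)
    (F := fun t s => M (s, t)) (F' := fun t s => dt M (s, t)) (bound := fun _ => K)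
    (s := Icc (p.2 - 1) (p.2 + 1)) (Icc_mem_nhds (by linarith) (by linarith)) ?_ ?_ ?_ ?_ ?_ ?_).2
  · exact .of_forall fun t => (by fun_prop : Continuous fun s => M (s, t)).aestronglyMeasurable
  · exact (by fun_prop : Continuous fun s => M (s, p.2)).intervalIntegrable _ _
  · exact (by fun_prop : Continuous fun s => dt M (s, p.2)).aestronglyMeasurable
  · exact .of_forall fun s hs t ht => hK (s, t) ⟨uIoc_subset_uIcc hs, ht⟩
  · exact intervalIntegrable_const
  · exact .of_forall fun s hs t ht => hasDeriv_dt isOpen_univ hM (mem_univ _)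

theorem Pi0_fderiv {x0 : ℝ} {M : ℝ × ℝ → ℝ} (hM : Sm univ M) (p : ℝ × ℝ) :
    HasFDerivAt (Pi0 x0 M) (M p • ContinuousLinearMap.fst ℝ ℝ ℝ + Pi0 x0 (dt M) p • ContinuousLinearMap.snd ℝ ℝ ℝ) p := by
  have cM : Continuous M := continuousOn_univ.1 hM.continuousOn
  have cD : Continuous (Pi0 x0 (dt M)) := Pi0_cont (continuousOn_univ.1 (hM.dd isOpen_univ _).continuousOn)
  have := hasStrictFDerivAt_uncurry_coprod (𝕜 := ℝ) (u := p) (f := fun x t => Pi0 x0 M (x, t))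
    (f₁ := fun x t => ContinuousLinearMap.toSpanSingleton ℝ (M (x, t)))
    (f₂ := fun x t => ContinuousLinearMap.toSpanSingleton ℝ (Pi0 x0 (dt M) (x, t)))
    (.of_forall fun q => (Pi0_dx q (by fun_prop)).hasFDerivAt) (.of_forall fun q => (Pi0_dt hM q).hasFDerivAt)
    (by
      have : Continuous fun q : ℝ × ℝ => ContinuousLinearMap.toSpanSingleton ℝ (M q) :=
        (ContinuousLinearMap.toSpanSingletonCLE (𝕜 := ℝ) (E := ℝ)).continuous.comp cM
      exact this.continuousAt)
    (by
      have : Continuous fun q : ℝ × ℝ => ContinuousLinearMap.toSpanSingleton ℝ (Pi0 x0 (dt M) q) :=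
        (ContinuousLinearMap.toSpanSingletonCLE (𝕜 := ℝ) (E := ℝ)).continuous.comp cD
      exact this.continuousAt)
  refine this.hasFDerivAt.congr_fderiv ?_
  ext <;> simp [Function.HasUncurry.uncurry]

theorem Pi0_cd {x0 : ℝ} (n : ℕ) : ∀ {M : ℝ × ℝ → ℝ}, Sm univ M → ContDiff ℝ n (Pi0 x0 M) := by
  induction n with
  | zero => exact fun hM => contDiff_zero.2 (Pi0_cont (continuousOn_univ.1 hM.continuousOn))
  | succ n ih =>
    intro M hM
    have : ((n + 1 : ℕ) : WithTop ℕ∞) = (n : WithTop ℕ∞) + 1 := by simp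
    rw [this, contDiff_succ_iff_hasFDerivAt]
    refine ⟨_, ?_, Pi0_fderiv hM⟩
    have h1 : ContDiff ℝ n M := (contDiffOn_univ.1 hM).of_le (by exact_mod_cast le_top)
    have h2 := ih (hM.dd isOpen_univ (0, 1))
    fun_prop

theorem Pi0_sm {x0 : ℝ} {m : ℝ × ℝ → ℝ} (hm : Sm Om m) : Sm Om (Pi0 x0 m) := by
  have h1 : Sm univ (fun p : ℝ × ℝ => m (p.1, Real.exp p.2)) :=
    ContDiffOn.comp hm (by fun_prop) (fun p _ => Real.exp_pos p.2)
  have h2 : ContDiff ℝ ∞ (Pi0 x0 (fun p : ℝ × ℝ => m (p.1, Real.exp p.2))) :=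
    contDiff_infty.2 fun n => Pi0_cd n h1
  have h3 : Sm Om (fun p => Pi0 x0 (fun p : ℝ × ℝ => m (p.1, Real.exp p.2)) (p.1, Real.log p.2)) :=
    h2.comp_contDiffOn (contDiffOn_fst.prodMk (contDiffOn_snd.log (fun p hp => ne_of_gt hp)))
  refine ContDiffOn.congr h3 fun p hp => ?_
  have : Real.exp (Real.log p.2) = p.2 := Real.exp_log hp
  simp only [Pi0, this]

theorem fd_eq {F : ℝ × ℝ → ℝ} (p e : ℝ × ℝ) : fderiv ℝ F p e = e.1 * dx F p + e.2 * dt F p := by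
  have : e = e.1 • ((1 : ℝ), (0 : ℝ)) + e.2 • ((0 : ℝ), (1 : ℝ)) := by ext <;> simp
  conv_lhs => rw [this]
  simp only [map_add, map_smul, smul_eq_mul, dd]

theorem inv_sm {Y X : ℝ × ℝ → ℝ} (sY : Sm Om Y) (hm : ∀ p ∈ Om, dx Y p ≠ 0)
    (hX : ∀ p ∈ Om, Y (X p, p.2) = p.1) (hl : ∀ p ∈ Om, X (Y p, p.2) = p.1) : Sm Om X := by
  intro q hq
  set p : ℝ × ℝ := (X q, q.2) with hp
  have hpO : p ∈ Om := hq
  set Φ : ℝ × ℝ → ℝ × ℝ := fun p => (Y p, p.2) with hΦ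
  have cΦ : ContDiffAt ℝ ∞ Φ p := (sY.cdAt isOpen_Om hpO).prodMk contDiffAt_snd
  have m0 := hm p hpO
  let e : (ℝ × ℝ) ≃L[ℝ] (ℝ × ℝ) := ContinuousLinearEquiv.equivOfInverse
    ((fderiv ℝ Y p).prod (ContinuousLinearMap.snd ℝ ℝ ℝ))
    (((dx Y p)⁻¹ • (ContinuousLinearMap.fst ℝ ℝ ℝ - dt Y p • ContinuousLinearMap.snd ℝ ℝ ℝ)).prod
      (ContinuousLinearMap.snd ℝ ℝ ℝ))
    (fun h => by
      ext
      · simp [fd_eq]; field_simp; ring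
      · simp)
    (fun h => by
      ext
      · simp [fd_eq]; field_simp; ring
      · simp)
  have hd : HasFDerivAt Φ (e : (ℝ × ℝ) →L[ℝ] (ℝ × ℝ)) p :=
    (sY.diffAt isOpen_Om hpO).hasFDerivAt.prodMk hasFDerivAt_snd
  have hn : (∞ : WithTop ℕ∞) ≠ 0 := by simp
  have h1 := cΦ.to_localInverse hd hn
  have hst := cΦ.hasStrictFDerivAt' hd hn
  have h2 := hst.localInverse_unique (g := fun z => (X z, z.2)) (by
    filter_upwards [isOpen_Om.mem_nhds hpO] with z hz
    exact Prod.ext (hl z hz) rfl)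
  have hq' : Φ p = q := Prod.ext (hX q hq) rfl
  rw [hq'] at h1 h2
  have h3 : ContDiffAt ℝ ∞ (fun z => (X z, z.2)) q := h1.congr_of_eventuallyEq h2
  exact (contDiffAt_fst.comp q h3).contDiffWithinAt

theorem chain_rule {Y G : ℝ × ℝ → ℝ} {p : ℝ × ℝ} (sY : Sm Om Y) (sG : Sm Om G) (hp : p ∈ Om) :
    dx (fun p => G (Y p, p.2)) p = dx G (Y p, p.2) * dx Y p ∧
    dt (fun p => G (Y p, p.2)) p = dx G (Y p, p.2) * dt Y p + dt G (Y p, p.2) := by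
  have h1 := (sY.diffAt isOpen_Om hp).hasFDerivAt.prodMk (hasFDerivAt_snd (𝕜 := ℝ) (p := p))
  have hq : (Y p, p.2) ∈ Om := hp
  have h2 : HasFDerivAt G (fderiv ℝ G (Y p, p.2)) (Y p, p.2) := (sG.diffAt isOpen_Om hq).hasFDerivAt
  have h3 := (h2.comp p h1).fderiv
  have key : ∀ e, dd e (fun p => G (Y p, p.2)) p = dd e Y p * dx G (Y p, p.2) + e.2 * dt G (Y p, p.2) := by
    intro e
    have : dd e (fun p => G (Y p, p.2)) p = fderiv ℝ G (Y p, p.2) (dd e Y p, e.2) := by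
      show fderiv ℝ (G ∘ fun p => (Y p, p.2)) p e = _
      rw [h3]; rfl
    rw [this, fd_eq]
  constructor
  · rw [key]; ring
  · rw [key]; ring

theorem chvar {ε : ℝ} {v a b c : ℝ × ℝ → ℝ} {t0 l r : ℝ} (L : LinHyp ε v a b c) (ht0 : 0 < t0)
    (hlr : l < r) (h0 : ∀ x ∈ Ioo l r, v (x, t0) = 0) (z : ℝ) : v (z, t0) = 0 := by
  have O := isOpen_Om
  have a0 : ∀ p ∈ Om, 0 < a p := fun p hp => L.eps.trans_le (L.ea p hp)
  set m : ℝ × ℝ → ℝ := fun p => (Real.sqrt (a p))⁻¹ with hmdef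
  have sm : Sm Om m := (ContDiffOn.sqrt L.sa (fun p hp => (a0 p hp).ne')).inv
    (fun p hp => (Real.sqrt_pos.2 (a0 p hp)).ne')
  have m0 : ∀ p ∈ Om, 0 < m p := fun p hp => inv_pos.2 (Real.sqrt_pos.2 (a0 p hp))
  have am : ∀ p ∈ Om, a p * (m p * m p) = 1 := fun p hp => by
    simp only [hmdef]
    rw [← mul_inv, Real.mul_self_sqrt (a0 p hp).le, mul_inv_cancel₀ (a0 p hp).ne']
  set x0 := (l + r) / 2 with hx0
  set Y := Pi0 x0 m with hY
  have sY : Sm Om Y := Pi0_sm sm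
  have Yd : ∀ x t, 0 < t → HasDerivAt (fun y => Y (y, t)) (m (x, t)) x := fun x t ht =>
    Pi0_dx (x, t) (sm.cont_x (fun _ => ht))
  have Yx : ∀ p ∈ Om, dx Y p = m p := fun p hp => (hasDeriv_dx O sY hp).unique (Yd p.1 p.2 hp)
  have Y0 : ∀ t, Y (x0, t) = 0 := fun t => by simp [hY, Pi0]
  -- lower bounds
  have low : ∀ δ T : ℝ, 0 < δ → ∃ κ, 0 < κ ∧ ∀ t, δ ≤ t → t ≤ T → ∀ x x', x ≤ x' →
      κ * (x' - x) ≤ Y (x', t) - Y (x, t) := by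
    intro δ T hδ
    obtain ⟨K, hK⟩ := L.ba δ T hδ
    refine ⟨(Real.sqrt (|K| + 1))⁻¹, by positivity, fun t h1 h2 x x' hx => ?_⟩
    have ht : 0 < t := hδ.trans_le h1
    have mon : Monotone (fun x => Y (x, t) - (Real.sqrt (|K| + 1))⁻¹ * x) := by
      have hd : ∀ x, HasDerivAt (fun x => Y (x, t) - (Real.sqrt (|K| + 1))⁻¹ * x)
          (m (x, t) - (Real.sqrt (|K| + 1))⁻¹ * 1) x := fun x =>
        (Yd x t ht).sub ((hasDerivAt_id x).const_mul _)
      refine monotone_of_deriv_nonneg (fun x => (hd x).differentiableAt) (fun x => ?_)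
      rw [(hd x).deriv, mul_one, sub_nonneg]
      refine inv_anti₀ (Real.sqrt_pos.2 (a0 _ ht)) (Real.sqrt_le_sqrt ?_)
      have := (le_abs_self _).trans (hK x t h1 h2)
      linarith [le_abs_self K]
    have := mon hx
    beta_reduce at this
    linarith
  have inj : ∀ t, 0 < t → ∀ x x', Y (x, t) = Y (x', t) → x = x' := by
    intro t ht x x' h
    obtain ⟨κ, hκ, hl⟩ := low t t ht
    rcases le_total x x' with hx | hx
    · have := hl t le_rfl le_rfl x x' hx
      rw [h, sub_self] at this
      have := nonpos_of_mul_nonpos_right this hκ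
      linarith
    · have := hl t le_rfl le_rfl x' x hx
      rw [h, sub_self] at this
      have := nonpos_of_mul_nonpos_right this hκ
      linarith
  have surj : ∀ p : ℝ × ℝ, ∃ x, 0 < p.2 → Y (x, p.2) = p.1 := by
    intro p
    by_cases ht : 0 < p.2
    swap
    · exact ⟨0, fun h => absurd h ht⟩
    obtain ⟨κ, hκ, hl⟩ := low p.2 p.2 ht
    have hs : Function.Surjective (fun x => Y (x, p.2)) := by
      refine Continuous.surjective (sY.cont_x (fun _ => ht)) ?_ ?_
      · refine tendsto_atTop_mono' _ ?_ ((tendsto_atTop_add_const_right _ (-x0) tendsto_id).const_mul_atTop hκ)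
        filter_upwards [eventually_ge_atTop x0] with x hx
        have := hl p.2 le_rfl le_rfl x0 x hx
        rw [Y0, sub_zero] at this
        exact this
      · refine tendsto_atBot_mono' _ ?_ ((tendsto_atBot_add_const_right _ (-x0) tendsto_id).const_mul_atBot hκ)
        filter_upwards [eventually_le_atBot x0] with x hx
        have := hl p.2 le_rfl le_rfl x x0 hx
        rw [Y0] at this
        simp only [id]
        linarith
    obtain ⟨x, hx⟩ := hs p.1
    exact ⟨x, fun _ => hx⟩
  choose X hX using surj
  have hXl : ∀ p ∈ Om, X (Y p, p.2) = p.1 := fun p hp => inj p.2 hp _ _ (hX (Y p, p.2) hp)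
  have sX : Sm Om X := inv_sm sY (fun p hp => by rw [Yx p hp]; exact (m0 p hp).ne') hX hXl
  have sΨ : ContDiffOn ℝ ∞ (fun p : ℝ × ℝ => (X p, p.2)) Om := sX.prodMk contDiffOn_snd
  have mΨ : MapsTo (fun p : ℝ × ℝ => (X p, p.2)) Om Om := fun p hp => hp
  set g : ℝ × ℝ → ℝ := fun p => v (X p, p.2) with hg
  have sg : Sm Om g := ContDiffOn.comp L.sv sΨ mΨ
  have vg : ∀ p ∈ Om, v p = g (Y p, p.2) := fun p hp => by simp only [hg]; rw [hXl p hp]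
  have sΦ : ContDiffOn ℝ ∞ (fun p : ℝ × ℝ => (Y p, p.2)) Om := sY.prodMk contDiffOn_snd
  have mΦ : MapsTo (fun p : ℝ × ℝ => (Y p, p.2)) Om Om := fun p hp => hp
  have sgx : Sm Om (dx g) := sg.dd O _
  have vx : ∀ p ∈ Om, dx v p = dx g (Y p, p.2) * m p := fun p hp => by
    rw [dd_congr O vg hp, (chain_rule sY sg hp).1, Yx p hp]
  have vt : ∀ p ∈ Om, dt v p = dx g (Y p, p.2) * dt Y p + dt g (Y p, p.2) := fun p hp => by
    rw [dd_congr O vg hp, (chain_rule sY sg hp).2]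
  have vxx : ∀ p ∈ Om, dx (dx v) p = dx (dx g) (Y p, p.2) * (m p * m p) + dx g (Y p, p.2) * dx m p := fun p hp => by
    rw [dd_congr O vx hp, dd_mul O (F := fun p => dx g (Y p, p.2)) (ContDiffOn.comp sgx sΦ mΦ) sm hp,
      (chain_rule sY sgx hp).1, Yx p hp]; ring
  have eqg : ∀ p ∈ Om, dt g (Y p, p.2) = dx (dx g) (Y p, p.2) +
      (a p * dx m p + b p * m p - dt Y p) * dx g (Y p, p.2) + c p * g (Y p, p.2) := fun p hp => by
    have h := L.eq p hp
    rw [vt p hp, vxx p hp, vx p hp, vg p hp] at h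
    linear_combination h + dx (dx g) (Y p, p.2) * am p hp
  have cB : ContinuousOn (fun p => a p * dx m p + b p * m p - dt Y p) Om :=
    ((L.sa.continuousOn.mul (sm.dd O _).continuousOn).add (L.sb.continuousOn.mul sm.continuousOn)).sub
      (sY.dd O _).continuousOn
  obtain ⟨κ, hκ, hlow⟩ := low (t0 / 2) t0 (half_pos ht0)
  have fin := suc (g := g) (t0 := t0) (r := κ * ((r - l) / 4)) ht0 sg
    (b := fun p => a (X p, p.2) * dx m (X p, p.2) + b (X p, p.2) * m (X p, p.2) - dt Y (X p, p.2))
    (c := fun p => c (X p, p.2))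
    (fun p hp => by
      have h := eqg (X p, p.2) hp
      have e : (Y (X p, p.2), p.2) = p := Prod.ext (hX p hp) rfl
      simp only [e] at h
      exact h)
    (cB.comp sΨ.continuousOn mΨ) (L.sc.continuousOn.comp sΨ.continuousOn mΨ)
    (mul_pos hκ (by linarith))
    (fun k => by
      obtain ⟨C, _, hC⟩ := Jd.flat (l' := x0 - (r - l) / 4) (r' := x0 + (r - l) / 4) ht0 L h0
        (by rw [hx0]; linarith) (by rw [hx0]; linarith) k v Jd.base
      refine ⟨C, fun y t hy h1 h2 => ?_⟩
      have ht : 0 < t := (half_pos ht0).trans_le h1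
      have e := hX (y, t) ht
      simp only at e
      have hy' := abs_le.1 hy
      refine hC (X (y, t)) t ?_ ?_ h1 h2
      · rcases le_total (X (y, t)) x0 with hx | hx
        · have := hlow t h1 h2 _ _ hx
          rw [Y0, e] at this
          have := le_of_mul_le_mul_left (this.trans (by linarith : 0 - y ≤ κ * ((r - l) / 4))) hκ
          linarith
        · linarith
      · rcases le_total x0 (X (y, t)) with hx | hx
        · have := hlow t h1 h2 _ _ hx
          rw [Y0, e] at this
          have := le_of_mul_le_mul_left (this.trans (by linarith : y - 0 ≤ κ * ((r - l) / 4))) hκ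
          linarith
        · linarith)
    (Y (z, t0))
  rw [vg (z, t0) ht0]; exact fin

theorem main (ε C : ℝ) (hε : 0 < ε)
    (σ : ℝ → ℝ → ℝ → ℝ → ℝ)
    (hσ_smooth : ContDiffOn ℝ (⊤ : ℕ∞)
      (fun w : ℝ × ℝ × ℝ × ℝ => σ w.1 w.2.1 w.2.2.1 w.2.2.2)
      {w : ℝ × ℝ × ℝ × ℝ | 0 < w.1})
    (hσq : ∀ t z p q : ℝ, 0 < t →
      ε ≤ deriv (fun q' => σ t z p q') q ∧ deriv (fun q' => σ t z p q') q ≤ C)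
    (u : ℝ → ℝ → ℝ)
    (hu_smooth : ContDiffOn ℝ (⊤ : ℕ∞) (fun w : ℝ × ℝ => u w.1 w.2) {w : ℝ × ℝ | 0 < w.2})
    (hu_eq : ∀ x t : ℝ, 0 < t →
      deriv (fun s => u x s) t =
        σ t (u x t) (deriv (fun y => u y t) x) (deriv (deriv (fun y => u y t)) x))
    (hu_bdd : ∃ M : ℝ, ∀ x t : ℝ, 0 < t →
      |u x t| ≤ M ∧ |deriv (fun y => u y t) x| ≤ M ∧
      |deriv (deriv (fun y => u y t)) x| ≤ M ∧ |deriv (fun s => u x s) t| ≤ M)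
    (t₀ : ℝ) (ht₀ : 0 < t₀) (x₁ x₂ : ℝ) (hx : x₁ < x₂)
    (hconst : ∀ x ∈ Set.Icc x₁ x₂, u x t₀ = u x₁ t₀) :
    ∃ α : ℝ → ℝ, (∀ t : ℝ, 0 < t → HasDerivAt α (σ t (α t) 0 0) t) ∧
      ∀ x t : ℝ, 0 < t → u x t = α t := by
  have O := isOpen_Om
  set U : ℝ × ℝ → ℝ := fun w => u w.1 w.2 with hU
  have sU : Sm Om U := hu_smooth
  have sUx : Sm Om (dx U) := sU.dd O _
  set g : R4 → ℝ := fun w => σ w.1 w.2.1 w.2.2.1 w.2.2.2 with hg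
  have sg : ContDiffOn ℝ ∞ g Om4 := hσ_smooth
  have ex : ∀ x t, 0 < t → deriv (fun y => u y t) x = dx U (x, t) := fun x t ht =>
    (hasDeriv_dx (x := x) (t := t) O sU ht).deriv
  have et : ∀ x t, 0 < t → HasDerivAt (fun s => u x s) (dt U (x, t)) t := fun x t ht =>
    hasDeriv_dt (x := x) (t := t) O sU ht
  have exx : ∀ x t, 0 < t → deriv (deriv (fun y => u y t)) x = dx (dx U) (x, t) := fun x t ht => by
    have : deriv (fun y => u y t) = fun y => dx U (y, t) := funext fun y => ex y t ht
    rw [this]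
    exact (hasDeriv_dx (x := x) (t := t) O sUx ht).deriv
  have heq : ∀ p ∈ Om, dt U p = g (Pm U (dx U) (dx (dx U)) p) := fun p hp => by
    have h := hu_eq p.1 p.2 hp
    rw [(et p.1 p.2 hp).deriv, ex p.1 p.2 hp, exx p.1 p.2 hp] at h
    exact h
  have hgq : ∀ w ∈ Om4, ε ≤ D4 (0, 0, 0, 1) g w := fun w hw => by
    have h := (hσq w.1 w.2.1 w.2.2.1 w.2.2.2 hw).1
    have hd : HasFDerivAt g (fderiv ℝ g w) w :=
      ((sg.differentiableOn (by simp)).differentiableAt (isOpen_Om4.mem_nhds hw)).hasFDerivAt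
    have h2 : HasDerivAt (fun q : ℝ => ((w.1, w.2.1, w.2.2.1, q) : R4)) ((0, 0, 0, 1) : R4) w.2.2.2 :=
      (hasDerivAt_const _ _).prodMk ((hasDerivAt_const _ _).prodMk
        ((hasDerivAt_const _ _).prodMk (hasDerivAt_id _)))
    have h3 : HasDerivAt (fun q' => σ w.1 w.2.1 w.2.2.1 q') (D4 (0, 0, 0, 1) g w) w.2.2.2 :=
      HasFDerivAt.comp_hasDerivAt (l := g) w.2.2.2 hd h2
    rw [h3.deriv] at h
    exact h
  obtain ⟨M, hM⟩ := hu_bdd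
  obtain ⟨a, b, c, L⟩ := linearize hε sg hgq sU heq
    (fun δ T hδ => ⟨M, fun x t h1 _ => (hM x t (hδ.trans_le h1)).1⟩)
    (fun δ T hδ => ⟨M, fun x t h1 _ => by
      rw [← ex x t (hδ.trans_le h1)]; exact (hM x t (hδ.trans_le h1)).2.1⟩)
    (fun δ T hδ => ⟨M, fun x t h1 _ => by
      rw [← exx x t (hδ.trans_le h1)]; exact (hM x t (hδ.trans_le h1)).2.2.1⟩)
    (fun δ T hδ => ⟨M, fun x t h1 _ => by
      rw [← (et x t (hδ.trans_le h1)).deriv]; exact (hM x t (hδ.trans_le h1)).2.2.2⟩)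
  have v0 : ∀ x ∈ Ioo x₁ x₂, dx U (x, t₀) = 0 := fun x hx' => by
    have h1 := hasDeriv_dx (x := x) (t := t₀) O sU ht₀
    have h2 : HasDerivAt (fun y => U (y, t₀)) 0 x :=
      (hasDerivAt_const x (u x₁ t₀)).congr_of_eventuallyEq (by
        filter_upwards [isOpen_Ioo.mem_nhds hx'] with y hy
        exact hconst y (Ioo_subset_Icc_self hy))
    exact h1.unique h2
  have vz := uniq L ht₀ (chvar L ht₀ hx v0)
  have cst : ∀ x t, 0 < t → u x t = u 0 t := fun x t ht =>
    is_const_of_deriv_eq_zero (f := fun y => u y t)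
      (fun y => (hasDeriv_dx (x := y) (t := t) O sU ht).differentiableAt)
      (fun y => (ex y t ht).trans (vz (y, t) ht)) x 0
  refine ⟨fun t => u 0 t, fun t ht => ?_, cst⟩
  refine (et 0 t ht).congr_deriv ?_
  have h1 := hu_eq 0 t ht
  have h2 : deriv (fun y => u y t) = fun _ => 0 := funext fun y => (ex y t ht).trans (vz (y, t) ht)
  rw [(et 0 t ht).deriv, h2] at h1
  simpa using h1

end PUC

theorem constant_on_interval_implies_spatially_constant
    (ε C : ℝ) (hε : 0 < ε) (hC : 0 < C)
    (σ : ℝ → ℝ → ℝ → ℝ → ℝ)  -- σ t z p q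
    (hσ_smooth : ContDiffOn ℝ (⊤ : ℕ∞)
      (fun w : ℝ × ℝ × ℝ × ℝ => σ w.1 w.2.1 w.2.2.1 w.2.2.2)
      {w : ℝ × ℝ × ℝ × ℝ | 0 < w.1})
    (hσq : ∀ t z p q : ℝ, 0 < t →
      ε ≤ deriv (fun q' => σ t z p q') q ∧ deriv (fun q' => σ t z p q') q ≤ C)
    (u : ℝ → ℝ → ℝ)
    (hu_smooth : ContDiffOn ℝ (⊤ : ℕ∞) (fun w : ℝ × ℝ => u w.1 w.2) {w : ℝ × ℝ | 0 < w.2})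
    (hu_eq : ∀ x t : ℝ, 0 < t →
      deriv (fun s => u x s) t =
        σ t (u x t) (deriv (fun y => u y t) x) (deriv (deriv (fun y => u y t)) x))
    (hu_bdd : ∃ M : ℝ, ∀ x t : ℝ, 0 < t →
      |u x t| ≤ M ∧ |deriv (fun y => u y t) x| ≤ M ∧
      |deriv (deriv (fun y => u y t)) x| ≤ M ∧ |deriv (fun s => u x s) t| ≤ M)
    (t₀ : ℝ) (ht₀ : 0 < t₀) (x₁ x₂ : ℝ) (hx : x₁ < x₂)
    (hconst : ∀ x ∈ Set.Icc x₁ x₂, u x t₀ = u x₁ t₀) :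
    ∃ α : ℝ → ℝ, (∀ t : ℝ, 0 < t → HasDerivAt α (σ t (α t) 0 0) t) ∧
      ∀ x t : ℝ, 0 < t → u x t = α t := by
  exact PUC.main ε C hε σ hσ_smooth hσq u hu_smooth hu_eq hu_bdd t₀ ht₀ x₁ x₂ hx hconst
end
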